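/- There is an absolute constant A such that for every prime q ≥ 17 and every integer k, |C(k)| ≤ A (log q)^{2/3} (log log q)². -/

import Mathlib

open scoped Classical Real
open Complex MeasureTheory

/-- The sawtooth function `ψ`. -/
noncomputable def saw (x : ℝ) : ℝ := if Int.fract x = 0 then 0 else Int.fract x - 1/2

/-- The Euler product `A_{q,χ}`. -/
noncomputable def Aq (q : ℕ) (χ : DirichletCharacter ℂ q) : ℂ :=
  ∏' p : Nat.Primes, if (p : ℕ) ∣ q then 1 else
    1 - (1 - χ ((p : ℕ) : ZMod q)) ^ 2 / (((p : ℕ) : ℂ) - 1) ^ 2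

/-- The quantity `C(k) = C(k; q)` (a real number; we take the real part of the
defining expression, which is real). -/
noncomputable def Cfun (q : ℕ) (k : ℤ) : ℝ :=
  if h : q = 0 then 0 else
    haveI : NeZero q := ⟨h⟩
    ((↑q.totient : ℂ)⁻¹ *
      ∑ χ ∈ Finset.univ.filter (fun χ : DirichletCharacter ℂ q => χ ≠ 1),
        (starRingEnd ℂ) (χ ((k : ZMod q))) * DirichletCharacter.LFunction χ 0 *
          DirichletCharacter.LFunction χ 1 * Aq q χ).re

/-- The primes in the dyadic block `[2^j, 2^(j+1))`. -/
def dyadicPrimes (j : ℕ) : Finset ℕ := (Finset.Ico (2 ^ j) (2 ^ (j + 1))).filter Nat.Prime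

lemma mem_dyadicPrimes {j p : ℕ} :
    p ∈ dyadicPrimes j ↔ (2 ^ j ≤ p ∧ p < 2 ^ (j + 1)) ∧ p.Prime := by
  simp [dyadicPrimes]

lemma card_dyadicPrimes_le (j : ℕ) : (dyadicPrimes j).card ≤ 2 ^ j := by
  refine (Finset.card_filter_le _ _).trans ?_
  rw [Nat.card_Ico, pow_succ]; omega

lemma prime_pow_dvd_factorial_mul {p : ℕ} (hp : 0 < p) (m : ℕ) : p ^ m ∣ (p * m).factorial := by
  induction m with
  | zero => simp
  | succ m ih =>
    obtain ⟨c, hc⟩ : ∃ c, p * (m + 1) = c + 1 := ⟨p * (m + 1) - 1, by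
      have : 0 < p * (m + 1) := by positivity
      omega⟩
    have h1 : p * m ≤ c := by
      have : p * (m + 1) = p * m + p := by ring
      omega
    rw [hc, Nat.factorial_succ, pow_succ, mul_comm]
    exact mul_dvd_mul (hc ▸ dvd_mul_right _ _) (ih.trans (Nat.factorial_dvd_factorial h1))

lemma sum_log_div_prime_le (N : ℕ) (hN : 1 ≤ N) :
    ∑ p ∈ N.primesLE, Real.log p / p ≤ Real.log N + Real.log 4 := by
  have hNpos : (0 : ℝ) < N := by exact_mod_cast hN
  have hdvd : ∏ p ∈ N.primesLE, p ^ (N / p) ∣ N.factorial := by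
    apply Finset.prod_dvd_of_isRelPrime
    · intro p hp r hr hpr
      exact Nat.coprime_iff_isRelPrime.1 (Nat.Coprime.pow _ _ ((Nat.coprime_primes
        (Nat.prime_of_mem_primesLE hp) (Nat.prime_of_mem_primesLE hr)).2 hpr))
    · intro p hp
      have hp' := Nat.prime_of_mem_primesLE hp
      exact (prime_pow_dvd_factorial_mul hp'.pos _).trans
        (Nat.factorial_dvd_factorial (Nat.mul_div_le N p))
  have h1 : ∑ p ∈ N.primesLE, ((N / p : ℕ) : ℝ) * Real.log p ≤ N * Real.log N := by
    have h2 : ((∏ p ∈ N.primesLE, p ^ (N / p) : ℕ) : ℝ) ≤ (N : ℝ) ^ N := by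
      exact_mod_cast (Nat.le_of_dvd (Nat.factorial_pos _) hdvd).trans (Nat.factorial_le_pow N)
    have h3 : 0 < ((∏ p ∈ N.primesLE, p ^ (N / p) : ℕ) : ℝ) := by
      exact_mod_cast Finset.prod_pos fun p hp => pow_pos (Nat.prime_of_mem_primesLE hp).pos _
    have h4 := Real.log_le_log h3 h2
    rw [Real.log_pow] at h4
    push_cast at h4
    rw [Real.log_prod (fun p hp => by
      have := (Nat.prime_of_mem_primesLE hp).pos
      positivity)] at h4
    simpa [Real.log_pow] using h4
  have h2 : ∑ p ∈ N.primesLE, Real.log p ≤ Real.log 4 * N := by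
    rw [← Chebyshev.theta_eq_sum_primesLE_log]
    exact Chebyshev.theta_le_log4_mul_x hNpos.le
  have h3 : N * ∑ p ∈ N.primesLE, Real.log p / p
      ≤ ∑ p ∈ N.primesLE, (((N / p : ℕ) : ℝ) * Real.log p + Real.log p) := by
    rw [Finset.mul_sum]
    refine Finset.sum_le_sum fun p hp => ?_
    have hp' := Nat.prime_of_mem_primesLE hp
    have hl : 0 ≤ Real.log p := Real.log_natCast_nonneg p
    have : (N : ℝ) / p ≤ ((N / p : ℕ) : ℝ) + 1 := by
      rw [← Nat.floor_div_eq_div (K := ℝ)]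
      exact (Nat.lt_floor_add_one _).le
    calc (N : ℝ) * (Real.log p / p) = (N / p) * Real.log p := by ring
      _ ≤ (((N / p : ℕ) : ℝ) + 1) * Real.log p := by gcongr
      _ = _ := by ring
  rw [Finset.sum_add_distrib] at h3
  have : (N : ℝ) * ∑ p ∈ N.primesLE, Real.log p / p ≤ N * (Real.log N + Real.log 4) := by
    linarith
  exact le_of_mul_le_mul_left this hNpos

lemma primesBelow_two_pow_succ (J : ℕ) :
    Nat.primesBelow (2 ^ (J + 1)) = Nat.primesBelow (2 ^ J) ∪ dyadicPrimes J := by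
  have h : 2 ^ J ≤ 2 ^ (J + 1) := Nat.pow_le_pow_right (by norm_num) (by omega)
  ext p
  simp only [Nat.mem_primesBelow, Finset.mem_union, mem_dyadicPrimes]
  constructor
  · rintro ⟨h1, h2⟩
    rcases lt_or_ge p (2 ^ J) with h3 | h3
    · exact Or.inl ⟨h3, h2⟩
    · exact Or.inr ⟨⟨h3, h1⟩, h2⟩
  · rintro (⟨h1, h2⟩ | ⟨⟨h1, h2⟩, h3⟩)
    · exact ⟨by omega, h2⟩
    · exact ⟨h2, h3⟩

lemma sum_primesBelow_two_pow_succ (f : ℕ → ℝ) (J : ℕ) :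
    ∑ p ∈ Nat.primesBelow (2 ^ (J + 1)), f p
      = ∑ p ∈ Nat.primesBelow (2 ^ J), f p + ∑ p ∈ dyadicPrimes J, f p := by
  rw [primesBelow_two_pow_succ, Finset.sum_union]
  rw [Finset.disjoint_left]
  intro p hp hp'
  have h1 := Nat.lt_of_mem_primesBelow hp
  have h2 := (mem_dyadicPrimes.1 hp').1.1
  omega

lemma log_two_pow_le_of_mem {j p : ℕ} (hp : p ∈ dyadicPrimes j) :
    j * Real.log 2 ≤ Real.log p := by
  have h := (mem_dyadicPrimes.1 hp).1.1
  rw [← Real.log_pow]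
  exact Real.log_le_log (by positivity) (by exact_mod_cast h)

lemma sum_inv_dyadicPrimes_le_log (j : ℕ) (hj : 1 ≤ j) :
    ∑ p ∈ dyadicPrimes j, (1 : ℝ) / p
      ≤ (∑ p ∈ dyadicPrimes j, Real.log p / p) / (j * Real.log 2) := by
  have hj' : (0 : ℝ) < j := by exact_mod_cast hj
  have hpos : 0 < j * Real.log 2 := mul_pos hj' (Real.log_pos one_lt_two)
  rw [le_div_iff₀ hpos, Finset.sum_mul]
  refine Finset.sum_le_sum fun p hp => ?_
  rw [div_mul_eq_mul_div, one_mul]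
  gcongr
  exact log_two_pow_le_of_mem hp

lemma sum_inv_dyadicPrimes_le (j : ℕ) (hj : 1 ≤ j) :
    ∑ p ∈ dyadicPrimes j, (1 : ℝ) / p ≤ 4 / j := by
  have hj' : (0 : ℝ) < j := by exact_mod_cast hj
  have hl : 0 < Real.log 2 := Real.log_pos one_lt_two
  refine (sum_inv_dyadicPrimes_le_log j hj).trans ?_
  have h4 : Real.log 4 = 2 * Real.log 2 := by
    rw [show (4 : ℝ) = 2 ^ 2 by norm_num, Real.log_pow]; norm_num
  have h1 : ∑ p ∈ dyadicPrimes j, Real.log p / p ≤ 4 * Real.log 2 := by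
    calc ∑ p ∈ dyadicPrimes j, Real.log p / p
        ≤ ∑ p ∈ dyadicPrimes j, Real.log p / 2 ^ j := by
          refine Finset.sum_le_sum fun p hp => ?_
          have := (mem_dyadicPrimes.1 hp).1.1
          have hl : 0 ≤ Real.log p := Real.log_natCast_nonneg p
          gcongr
          exact_mod_cast this
      _ = (∑ p ∈ dyadicPrimes j, Real.log p) / 2 ^ j := by rw [Finset.sum_div]
      _ ≤ (∑ p ∈ Nat.primesLE (2 ^ (j + 1)), Real.log p) / 2 ^ j := by
          refine div_le_div_of_nonneg_right (Finset.sum_le_sum_of_subset_of_nonneg ?_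
            fun p _ _ => Real.log_natCast_nonneg p) (by positivity)
          intro p hp
          rw [Nat.mem_primesLE]
          exact ⟨(mem_dyadicPrimes.1 hp).1.2.le, (mem_dyadicPrimes.1 hp).2⟩
      _ ≤ (Real.log 4 * (2 ^ (j + 1) : ℕ)) / 2 ^ j := by
          gcongr
          rw [← Chebyshev.theta_eq_sum_primesLE_log]
          exact Chebyshev.theta_le_log4_mul_x (by positivity)
      _ = 4 * Real.log 2 := by
          rw [h4]; push_cast; field_simp; ring
  rw [div_le_div_iff₀ (by positivity) hj']
  nlinarith

lemma sum_log_div_primesBelow_le (J : ℕ) :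
    ∑ p ∈ Nat.primesBelow (2 ^ J), Real.log p / p ≤ (J + 2) * Real.log 2 := by
  have h := sum_log_div_prime_le (2 ^ J) Nat.one_le_two_pow
  have h4 : Real.log 4 = 2 * Real.log 2 := by
    rw [show (4 : ℝ) = 2 ^ 2 by norm_num, Real.log_pow]; norm_num
  have h5 : ∑ p ∈ Nat.primesBelow (2 ^ J), Real.log p / p ≤ ∑ p ∈ Nat.primesLE (2 ^ J), Real.log p / p := by
    refine Finset.sum_le_sum_of_subset_of_nonneg ?_ fun p _ _ =>
      div_nonneg (Real.log_natCast_nonneg p) (by positivity)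
    intro p hp
    rw [Nat.mem_primesLE]
    exact ⟨(Nat.lt_of_mem_primesBelow hp).le, Nat.prime_of_mem_primesBelow hp⟩
  rw [h4] at h
  push_cast at h
  rw [Real.log_pow] at h
  linarith

lemma sum_inv_primesBelow_le (J : ℕ) (hJ : 1 ≤ J) :
    ∑ p ∈ Nat.primesBelow (2 ^ J), (1 : ℝ) / p ≤ Real.log J + 6 := by
  have hl : 0 < Real.log 2 := Real.log_pos one_lt_two
  have key : ∀ J : ℕ, 1 ≤ J → ∑ p ∈ Nat.primesBelow (2 ^ J), (1 : ℝ) / p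
      - (∑ p ∈ Nat.primesBelow (2 ^ J), Real.log p / p) / (J * Real.log 2)
      ≤ (harmonic (J - 1) : ℝ) + 2 - 2 / J := by
    intro J hJ
    induction J, hJ using Nat.le_induction with
    | base =>
      simp
    | succ J hJ ih =>
      have hJ' : (0 : ℝ) < J := by exact_mod_cast hJ
      obtain ⟨i, rfl⟩ : ∃ i, J = i + 1 := ⟨J - 1, by omega⟩
      have h1 := sum_inv_dyadicPrimes_le_log (i + 1) hJ
      have h2 := sum_log_div_primesBelow_le (i + 1 + 1)
      rw [sum_primesBelow_two_pow_succ] at h2 ⊢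
      rw [sum_primesBelow_two_pow_succ (fun p => Real.log p / p)]
      set a := ∑ p ∈ Nat.primesBelow (2 ^ (i + 1)), (1 : ℝ) / p
      set b := ∑ p ∈ Nat.primesBelow (2 ^ (i + 1)), Real.log p / p
      set c := ∑ p ∈ dyadicPrimes (i + 1), (1 : ℝ) / p
      set d := ∑ p ∈ dyadicPrimes (i + 1), Real.log p / p
      simp only [Nat.add_sub_cancel] at ih ⊢
      rw [harmonic_succ]
      push_cast at *
      set x : ℝ := (i : ℝ) with hx
      have hx0 : 0 ≤ x := by positivity
      have e1 : (b + d) / ((x + 1) * Real.log 2) - (b + d) / ((x + 1 + 1) * Real.log 2)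
          ≤ (x + 4) / ((x + 1) * (x + 2)) := by
        have : (b + d) / ((x + 1) * Real.log 2) - (b + d) / ((x + 1 + 1) * Real.log 2)
          = ((b + d) / Real.log 2) / ((x + 1) * (x + 2)) := by
          field_simp; ring
        rw [this]
        gcongr
        rw [div_le_iff₀ hl]
        linarith
      have e2 : (x + 4) / ((x + 1) * (x + 2)) = (x + 1)⁻¹ + 2 / (x + 1) - 2 / (x + 1 + 1) := by
        field_simp; ring
      have e3 : (b + d) / ((x + 1) * Real.log 2)
          = b / ((x + 1) * Real.log 2) + d / ((x + 1) * Real.log 2) := add_div _ _ _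
      linarith
  have h := key J hJ
  have hJ' : (1 : ℝ) ≤ J := by exact_mod_cast hJ
  have h1 : (harmonic (J - 1) : ℝ) ≤ 1 + Real.log J := by
    refine le_trans ?_ (harmonic_le_one_add_log J)
    obtain ⟨i, rfl⟩ : ∃ i, J = i + 1 := ⟨J - 1, by omega⟩
    rw [harmonic_succ]
    push_cast
    have : (0 : ℝ) ≤ ((i : ℝ) + 1)⁻¹ := by positivity
    simpa using this
  have h2 : (∑ p ∈ Nat.primesBelow (2 ^ J), Real.log p / p) / (J * Real.log 2) ≤ 1 + 2 / J := by
    rw [div_le_iff₀ (by positivity)]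
    refine (sum_log_div_primesBelow_le J).trans (le_of_eq ?_)
    field_simp
  linarith

/-- The reciprocal sum of the `2^J`-smooth numbers is `O(J)`. -/
lemma sum_inv_smoothNumbers_le (J : ℕ) (hJ : 1 ≤ J) (M : Finset ℕ)
    (hM : ∀ m ∈ M, m ∈ (2 ^ J).smoothNumbers) :
    ∑ m ∈ M, (1 : ℝ) / m ≤ Real.exp 7 * J := by
  let f : ℕ →* ℝ :=
    { toFun := fun n => (n : ℝ)⁻¹
      map_one' := by simp
      map_mul' := fun a b => by push_cast; rw [mul_inv] }
  have hs := EulerProduct.summable_and_hasSum_smoothNumbers_prod_primesBelow_geometric (f := f)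
    (fun {p} hp => by
      have : (1 : ℝ) < p := by exact_mod_cast hp.one_lt
      simp only [f, MonoidHom.coe_mk, OneHom.coe_mk, norm_inv, RCLike.norm_natCast]
      exact inv_lt_one_of_one_lt₀ this) (2 ^ J)
  have h1 : ∑ m ∈ M, (1 : ℝ) / m ≤ ∏ p ∈ Nat.primesBelow (2 ^ J), (1 - f p)⁻¹ := by
    have h2 : ∑ m ∈ M, (1 : ℝ) / m
        = ∑ m ∈ M.subtype (· ∈ (2 ^ J).smoothNumbers), f (m : ℕ) := by
      refine (Finset.sum_congr rfl fun m _ => ?_).trans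
        (Finset.sum_subtype_of_mem (fun m : ℕ => f m) hM).symm
      simp [f]
    rw [h2]
    exact sum_le_hasSum _ (fun m _ => by simp [f]) hs.2
  have h3 : ∏ p ∈ Nat.primesBelow (2 ^ J), (1 - f p)⁻¹
      ≤ Real.exp (∑ p ∈ Nat.primesBelow (2 ^ J), ((1 : ℝ) / p + 1 / (p * (p - 1)))) := by
    rw [Real.exp_sum]
    refine Finset.prod_le_prod (fun p hp => ?_) fun p hp => ?_
    · have : (1 : ℝ) < p := by exact_mod_cast (Nat.prime_of_mem_primesBelow hp).one_lt
      simp only [f, MonoidHom.coe_mk, OneHom.coe_mk]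
      have := inv_lt_one_of_one_lt₀ this
      exact inv_nonneg.2 (by linarith)
    · have hp1 : (1 : ℝ) < p := by exact_mod_cast (Nat.prime_of_mem_primesBelow hp).one_lt
      have hp0 : (p : ℝ) - 1 ≠ 0 := by linarith
      simp only [f, MonoidHom.coe_mk, OneHom.coe_mk]
      have e : (1 - (p : ℝ)⁻¹)⁻¹ = ((1 : ℝ) / p + 1 / (p * (p - 1))) + 1 := by
        have : (p : ℝ) ≠ 0 := by linarith
        rw [show 1 - (p : ℝ)⁻¹ = (p - 1) / p by field_simp, inv_div]
        field_simp; ring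
      rw [e]
      exact Real.add_one_le_exp _
  have h4 : ∀ n : ℕ, 1 ≤ n → ∑ p ∈ n.primesBelow, (1 : ℝ) / (p * (p - 1)) ≤ 1 := by
    intro n hn
    have h5 : ∀ n : ℕ, 1 ≤ n → ∑ k ∈ Finset.Ico 2 (n + 1), (1 : ℝ) / (k * (k - 1)) = 1 - 1 / n := by
      intro n hn
      induction n, hn using Nat.le_induction with
      | base => simp
      | succ n hn ih =>
        have : (0 : ℝ) < n := by exact_mod_cast hn
        rw [Finset.sum_Ico_succ_top (by omega), ih]
        push_cast
        rw [add_sub_cancel_right]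
        field_simp; ring
    refine (Finset.sum_le_sum_of_subset_of_nonneg (t := Finset.Ico 2 (n + 1)) ?_ ?_).trans ?_
    · intro p hp
      have h6 := (Nat.prime_of_mem_primesBelow hp).two_le
      have h7 := Nat.lt_of_mem_primesBelow hp
      rw [Finset.mem_Ico]; omega
    · intro k hk _
      have : (2 : ℝ) ≤ k := by exact_mod_cast (Finset.mem_Ico.1 hk).1
      exact div_nonneg zero_le_one (mul_nonneg (by linarith) (by linarith))
    · rw [h5 n hn]
      have : (0 : ℝ) ≤ 1 / n := by positivity
      linarith
  have hJ' : (0 : ℝ) < J := by exact_mod_cast hJ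
  refine h1.trans (h3.trans ?_)
  rw [Finset.sum_add_distrib]
  calc _ ≤ Real.exp (Real.log J + 6 + 1) :=
        Real.exp_le_exp.2 (add_le_add (sum_inv_primesBelow_le J hJ) (h4 _ Nat.one_le_two_pow))
    _ = Real.exp 7 * J := by
        rw [show Real.log J + 6 + 1 = 7 + Real.log J by ring, Real.exp_add, Real.exp_log hJ']

/-- The additive energy of `f` on `X`: the number of pairs in `X` with equal values. -/
noncomputable def collisions {ι G : Type*} (X : Finset ι) (f : ι → G) : ℕ :=
  ((X ×ˢ X).filter fun z : ι × ι => f z.1 = f z.2).card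

lemma exists_unimodular_mul_eq_norm (z : ℂ) : ∃ θ : ℂ, ‖θ‖ ≤ 1 ∧ θ * z = ‖z‖ := by
  by_cases hz : z = 0
  · exact ⟨0, by simp, by simp [hz]⟩
  · refine ⟨(starRingEnd ℂ) z / ‖z‖, ?_, ?_⟩
    · have : ‖z‖ ≠ 0 := norm_ne_zero_iff.2 hz
      rw [norm_div, RCLike.norm_conj, Complex.norm_real, norm_norm, div_self this]
    · have : (‖z‖ : ℂ) ≠ 0 := by exact_mod_cast norm_ne_zero_iff.2 hz
      rw [div_mul_eq_mul_div, mul_comm, Complex.mul_conj, div_eq_iff this, Complex.normSq_eq_norm_sq]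
      push_cast; ring

section Bilinear

variable {q : ℕ} [NeZero q] {ι κ : Type*}

lemma stdAddChar_sum (s : Finset ι) (f : ι → ZMod q) :
    ZMod.stdAddChar (∑ i ∈ s, f i) = ∏ i ∈ s, ZMod.stdAddChar (f i) := by
  induction s using Finset.induction_on with
  | empty => simp
  | insert a s ha ih => rw [Finset.sum_insert ha, Finset.prod_insert ha, AddChar.map_add_eq_mul, ih]

lemma sum_norm_sq_fiber_le (X : Finset ι) (F : ι → ZMod q) (a : ι → ℂ) (ha : ∀ i, ‖a i‖ ≤ 1) :
    ∑ c : ZMod q, ‖∑ i ∈ X with F i = c, a i‖ ^ 2 ≤ collisions X F := by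
  have h : ∀ c : ZMod q, ‖∑ i ∈ X with F i = c, a i‖ ^ 2
      ≤ ((((X ×ˢ X).filter fun z => F z.1 = F z.2).filter fun z => F z.1 = c).card : ℝ) := by
    intro c
    have h1 : ‖∑ i ∈ X with F i = c, a i‖ ≤ ((X.filter fun i => F i = c).card : ℝ) := by
      refine (norm_sum_le _ _).trans ((Finset.sum_le_sum fun i _ => ha i).trans ?_)
      simp
    refine (pow_le_pow_left₀ (norm_nonneg _) h1 2).trans ?_
    rw [sq, ← Nat.cast_mul, ← Finset.card_product]
    norm_cast
    refine Finset.card_le_card fun z hz => ?_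
    simp only [Finset.mem_product, Finset.mem_filter] at hz ⊢
    exact ⟨⟨⟨hz.1.1, hz.2.1⟩, hz.1.2.trans hz.2.2.symm⟩, hz.1.2⟩
  refine (Finset.sum_le_sum fun c _ => h c).trans ?_
  rw [← Nat.cast_sum]
  norm_cast
  rw [collisions, ← Finset.card_eq_sum_card_fiberwise (fun _ _ => Finset.mem_univ _)]
  exact Nat.le_of_eq (by congr)

lemma sum_norm_sq_expSum_le (Y : Finset κ) (G : κ → ZMod q) (b : κ → ℂ) (hb : ∀ i, ‖b i‖ ≤ 1) :
    ∑ c : ZMod q, ‖∑ y ∈ Y, b y * ZMod.stdAddChar (c * G y)‖ ^ 2 ≤ q * collisions Y G := by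
  have h : ((∑ c : ZMod q, ‖∑ y ∈ Y, b y * ZMod.stdAddChar (c * G y)‖ ^ 2 : ℝ) : ℂ)
      = ∑ z ∈ (Y ×ˢ Y).filter (fun z => G z.1 = G z.2), q * (b z.1 * (starRingEnd ℂ) (b z.2)) := by
    push_cast
    calc ∑ c : ZMod q, ((‖∑ y ∈ Y, b y * ZMod.stdAddChar (c * G y)‖ : ℂ)) ^ 2
        = ∑ c : ZMod q, ∑ z ∈ Y ×ˢ Y, (b z.1 * (starRingEnd ℂ) (b z.2))
            * ZMod.stdAddChar (c * (G z.1 - G z.2)) := by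
          refine Finset.sum_congr rfl fun c _ => ?_
          rw [← Complex.mul_conj', map_sum, Finset.sum_mul_sum, ← Finset.sum_product']
          refine Finset.sum_congr rfl fun z _ => ?_
          rw [(starRingEnd ℂ).map_mul, mul_sub, sub_eq_add_neg, AddChar.map_add_eq_mul,
            AddChar.map_neg_eq_conj]
          ring
      _ = ∑ z ∈ Y ×ˢ Y, if G z.1 = G z.2 then q * (b z.1 * (starRingEnd ℂ) (b z.2)) else 0 := by
          rw [Finset.sum_comm]
          refine Finset.sum_congr rfl fun z _ => ?_
          rw [← Finset.mul_sum, AddChar.sum_mulShift _ (ZMod.isPrimitive_stdAddChar q)]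
          simp only [sub_eq_zero, ZMod.card]
          split_ifs <;> simp [mul_comm]
      _ = _ := by rw [Finset.sum_filter]
  have h2 : ‖((∑ c : ZMod q, ‖∑ y ∈ Y, b y * ZMod.stdAddChar (c * G y)‖ ^ 2 : ℝ) : ℂ)‖
      ≤ q * collisions Y G := by
    rw [h]
    refine (norm_sum_le _ _).trans ((Finset.sum_le_sum (g := fun _ => (q : ℝ))
      fun z _ => ?_).trans ?_)
    · rw [norm_mul, norm_mul, RCLike.norm_natCast, RCLike.norm_conj]
      exact mul_le_of_le_one_right (Nat.cast_nonneg _)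
        (mul_le_one₀ (hb _) (norm_nonneg _) (hb _))
    · rw [Finset.sum_const, nsmul_eq_mul, collisions, mul_comm]
      exact le_of_eq (by congr)
  rw [Complex.norm_real] at h2
  exact (le_abs_self _).trans h2

/-- The bilinear (large sieve) bound for additive characters. -/
lemma norm_bilinear_sq_le (X : Finset ι) (Y : Finset κ) (F : ι → ZMod q) (G : κ → ZMod q)
    (a : ι → ℂ) (b : κ → ℂ) (ha : ∀ i, ‖a i‖ ≤ 1) (hb : ∀ i, ‖b i‖ ≤ 1) :
    ‖∑ x ∈ X, a x * ∑ y ∈ Y, b y * ZMod.stdAddChar (F x * G y)‖ ^ 2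
      ≤ q * collisions X F * collisions Y G := by
  have h : ∑ x ∈ X, a x * ∑ y ∈ Y, b y * ZMod.stdAddChar (F x * G y)
      = ∑ c : ZMod q, (∑ i ∈ X with F i = c, a i) * ∑ y ∈ Y, b y * ZMod.stdAddChar (c * G y) := by
    rw [← Finset.sum_fiberwise_of_maps_to (s := X) (t := Finset.univ) (g := F)
      (fun _ _ => Finset.mem_univ _)]
    refine Finset.sum_congr rfl fun c _ => ?_
    rw [Finset.sum_mul]
    refine Finset.sum_congr rfl fun x hx => ?_
    rw [(Finset.mem_filter.1 hx).2]
  rw [h]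
  have h1 : ‖∑ c : ZMod q, (∑ i ∈ X with F i = c, a i)
        * ∑ y ∈ Y, b y * ZMod.stdAddChar (c * G y)‖
      ≤ ∑ c : ZMod q, ‖∑ i ∈ X with F i = c, a i‖
        * ‖∑ y ∈ Y, b y * ZMod.stdAddChar (c * G y)‖ :=
    (norm_sum_le _ _).trans (Finset.sum_le_sum fun c _ => (norm_mul _ _).le)
  refine (pow_le_pow_left₀ (norm_nonneg _) h1 2).trans
    ((Finset.sum_mul_sq_le_sq_mul_sq _ _ _).trans ?_)
  calc _ ≤ (collisions X F : ℝ) * (q * collisions Y G) := by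
        gcongr
        · exact sum_norm_sq_fiber_le X F a ha
        · exact sum_norm_sq_expSum_le Y G b hb
    _ = _ := by ring

lemma sum_norm_pow_le (Z : Finset κ) (X : Finset ι) (f : ι → ZMod q) (g : κ → ZMod q)
    (a : ι → ℂ) (k : ℕ) :
    (∑ z ∈ Z, ‖∑ x ∈ X, a x * ZMod.stdAddChar (f x * g z)‖) ^ (k + 1)
      ≤ (Z.card : ℝ) ^ k * ∑ z ∈ Z, ‖∑ t ∈ Fintype.piFinset fun _ : Fin (k + 1) => X,
          (∏ i, a (t i)) * ZMod.stdAddChar ((∑ i, f (t i)) * g z)‖ := by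
  refine (pow_sum_le_card_mul_sum_pow (fun _ _ => norm_nonneg _) k).trans (le_of_eq ?_)
  congr 1
  refine Finset.sum_congr rfl fun z _ => ?_
  rw [← norm_pow]
  congr 1
  rw [Finset.sum_pow']
  refine Finset.sum_congr rfl fun t _ => ?_
  rw [Finset.prod_mul_distrib, Finset.sum_mul, stdAddChar_sum]

/-- Exchange of summation: the absolute values on one side of a bilinear form can be moved to the
other side, at the cost of new bounded weights. -/
lemma exists_sum_norm_swap_le (Z : Finset κ) (X : Finset ι) (f : ι → ZMod q) (g : κ → ZMod q)
    (a : ι → ℂ) (ha : ∀ i, ‖a i‖ ≤ 1) :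
    ∃ b : κ → ℂ, (∀ z, ‖b z‖ ≤ 1) ∧
      ∑ z ∈ Z, ‖∑ x ∈ X, a x * ZMod.stdAddChar (f x * g z)‖
        ≤ ∑ x ∈ X, ‖∑ z ∈ Z, b z * ZMod.stdAddChar (g z * f x)‖ := by
  choose b hb hb' using fun z =>
    exists_unimodular_mul_eq_norm (∑ x ∈ X, a x * ZMod.stdAddChar (f x * g z))
  refine ⟨b, hb, ?_⟩
  have h : ((∑ z ∈ Z, ‖∑ x ∈ X, a x * ZMod.stdAddChar (f x * g z)‖ : ℝ) : ℂ)
      = ∑ x ∈ X, a x * ∑ z ∈ Z, b z * ZMod.stdAddChar (g z * f x) := by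
    push_cast
    simp_rw [← hb', Finset.mul_sum]
    rw [Finset.sum_comm]
    refine Finset.sum_congr rfl fun x _ => Finset.sum_congr rfl fun z _ => ?_
    rw [mul_comm (f x)]; ring
  calc _ = ‖((∑ z ∈ Z, ‖∑ x ∈ X, a x * ZMod.stdAddChar (f x * g z)‖ : ℝ) : ℂ)‖ := by
        rw [Complex.norm_real, Real.norm_of_nonneg (Finset.sum_nonneg fun _ _ => norm_nonneg _)]
    _ ≤ ∑ x ∈ X, ‖a x * ∑ z ∈ Z, b z * ZMod.stdAddChar (g z * f x)‖ := by
        rw [h]; exact norm_sum_le _ _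
    _ ≤ _ := by
        refine Finset.sum_le_sum fun x _ => ?_
        rw [norm_mul]
        exact mul_le_of_le_one_left (norm_nonneg _) (ha x)

/-- The number of pairs of `k`-tuples from `X` with equal sums of `f`. -/
noncomputable def tupleEnergy (X : Finset ι) (f : ι → ZMod q) (k : ℕ) : ℕ :=
  collisions (Fintype.piFinset fun _ : Fin k => X) fun t => ∑ i, f (t i)

/-- Karatsuba's bound for bilinear exponential sums in terms of additive energies. -/
lemma norm_bilinear_pow_le (X : Finset ι) (Y : Finset κ) (f : ι → ZMod q) (g : κ → ZMod q)
    (a : ι → ℂ) (b : κ → ℂ) (ha : ∀ i, ‖a i‖ ≤ 1) (hb : ∀ i, ‖b i‖ ≤ 1) (k l : ℕ) :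
    (‖∑ y ∈ Y, b y * ∑ x ∈ X, a x * ZMod.stdAddChar (f x * g y)‖ ^ ((k + 1) * (l + 1))) ^ 2
      ≤ ((Y.card : ℝ) ^ (k * (l + 1)) * (X.card : ℝ) ^ ((k + 1) * l)) ^ 2
        * (q * tupleEnergy X f (k + 1) * tupleEnergy Y g (l + 1)) := by
  have h1 : ‖∑ y ∈ Y, b y * ∑ x ∈ X, a x * ZMod.stdAddChar (f x * g y)‖
      ≤ ∑ y ∈ Y, ‖∑ x ∈ X, a x * ZMod.stdAddChar (f x * g y)‖ := by
    refine (norm_sum_le _ _).trans (Finset.sum_le_sum fun y _ => ?_)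
    rw [norm_mul]
    exact mul_le_of_le_one_left (norm_nonneg _) (hb y)
  have h2 := sum_norm_pow_le Y X f g a k
  set T := Fintype.piFinset fun _ : Fin (k + 1) => X
  set F : (Fin (k + 1) → ι) → ZMod q := fun t => ∑ i, f (t i)
  have hT : (T.card : ℝ) = (X.card : ℝ) ^ (k + 1) := by simp [T]
  obtain ⟨c, hc, h3⟩ := exists_sum_norm_swap_le Y T F g (fun t => ∏ i, a (t i)) fun t => by
    rw [norm_prod]
    exact Finset.prod_le_one (fun _ _ => norm_nonneg _) fun i _ => ha _
  have h4 := sum_norm_pow_le T Y g F c l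
  set U := Fintype.piFinset fun _ : Fin (l + 1) => Y
  set H : (Fin (l + 1) → κ) → ZMod q := fun t => ∑ i, g (t i)
  obtain ⟨d, hd, h5⟩ := exists_sum_norm_swap_le T U H F (fun t => ∏ i, c (t i)) fun t => by
    rw [norm_prod]
    exact Finset.prod_le_one (fun _ _ => norm_nonneg _) fun i _ => hc _
  choose e he he' using fun u =>
    exists_unimodular_mul_eq_norm (∑ t ∈ T, d t * ZMod.stdAddChar (F t * H u))
  have h6 : ((∑ u ∈ U, ‖∑ t ∈ T, d t * ZMod.stdAddChar (F t * H u)‖ : ℝ) : ℂ)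
      = ∑ u ∈ U, e u * ∑ t ∈ T, d t * ZMod.stdAddChar (H u * F t) := by
    push_cast
    refine Finset.sum_congr rfl fun u _ => ?_
    rw [← he']
    simp_rw [mul_comm (F _)]
  have h7 := norm_bilinear_sq_le U T H F e d he hd
  rw [← h6, Complex.norm_real, Real.norm_of_nonneg (Finset.sum_nonneg fun _ _ => norm_nonneg _)] at h7
  set V := ∑ u ∈ U, ‖∑ t ∈ T, d t * ZMod.stdAddChar (F t * H u)‖
  have h8 : ‖∑ y ∈ Y, b y * ∑ x ∈ X, a x * ZMod.stdAddChar (f x * g y)‖ ^ ((k + 1) * (l + 1))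
      ≤ (Y.card : ℝ) ^ (k * (l + 1)) * (X.card : ℝ) ^ ((k + 1) * l) * V := by
    calc _ = (‖∑ y ∈ Y, b y * ∑ x ∈ X, a x * ZMod.stdAddChar (f x * g y)‖ ^ (k + 1)) ^ (l + 1) := by
          rw [pow_mul]
      _ ≤ ((∑ y ∈ Y, ‖∑ x ∈ X, a x * ZMod.stdAddChar (f x * g y)‖) ^ (k + 1)) ^ (l + 1) := by
          gcongr
      _ ≤ ((Y.card : ℝ) ^ k * ∑ t ∈ T, ‖∑ y ∈ Y, c y * ZMod.stdAddChar (g y * F t)‖) ^ (l + 1) := by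
          gcongr
          exact h2.trans (by gcongr)
      _ = ((Y.card : ℝ) ^ k) ^ (l + 1)
            * (∑ t ∈ T, ‖∑ y ∈ Y, c y * ZMod.stdAddChar (g y * F t)‖) ^ (l + 1) := mul_pow _ _ _
      _ ≤ ((Y.card : ℝ) ^ k) ^ (l + 1) * ((T.card : ℝ) ^ l * V) := by
          gcongr
          exact h4.trans (by gcongr)
      _ = _ := by rw [hT, ← pow_mul, ← pow_mul, mul_assoc]
  calc _ ≤ ((Y.card : ℝ) ^ (k * (l + 1)) * (X.card : ℝ) ^ ((k + 1) * l) * V) ^ 2 := by gcongr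
    _ = ((Y.card : ℝ) ^ (k * (l + 1)) * (X.card : ℝ) ^ ((k + 1) * l)) ^ 2 * V ^ 2 := mul_pow _ _ _
    _ ≤ _ := by
        gcongr
        refine h7.trans (le_of_eq ?_)
        simp only [tupleEnergy, T, U, F, H]
        ring

end Bilinear

lemma card_le_of_modEq {S : Finset ℕ} {M B : ℕ} (hS : ∀ n ∈ S, n ≤ M)
    (h : ∀ m ∈ S, ∀ n ∈ S, m ≡ n [MOD B]) : S.card ≤ M / B + 1 := by
  rw [← Finset.card_range (M / B + 1)]
  refine Finset.card_le_card_of_injOn (fun n => n / B) (fun n hn => ?_) fun m hm n hn hmn => ?_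
  · have : n / B ≤ M / B := Nat.div_le_div_right (hS n hn)
    simp only [Finset.coe_range, Set.mem_Iio]
    omega
  · have h1 : m % B = n % B := h m hm n hn
    have h2 : m / B = n / B := hmn
    rw [← Nat.div_add_mod m B, ← Nat.div_add_mod n B, h1, h2]

lemma card_prod_eq_le {k : ℕ} (X : Finset ℕ) (hX : ∀ p ∈ X, p.Prime) (Q : ℕ) :
    ((Fintype.piFinset fun _ : Fin k => X).filter fun t : Fin k → ℕ => ∏ i, t i = Q).card
      ≤ k ^ k := by
  rcases Finset.eq_empty_or_nonempty
    ((Fintype.piFinset fun _ : Fin k => X).filter fun t : Fin k → ℕ => ∏ i, t i = Q) with h | h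
  · rw [h]; simp
  · obtain ⟨s, hs⟩ := h
    rw [Finset.mem_filter, Fintype.mem_piFinset] at hs
    have hsub : (Fintype.piFinset fun _ : Fin k => X).filter (fun t : Fin k → ℕ => ∏ i, t i = Q)
        ⊆ Fintype.piFinset fun _ : Fin k => Finset.univ.image s := by
      intro t ht
      rw [Finset.mem_filter, Fintype.mem_piFinset] at ht
      rw [Fintype.mem_piFinset]
      intro i
      have h1 : t i ∣ ∏ j, s j := by
        rw [hs.2, ← ht.2]; exact Finset.dvd_prod_of_mem _ (Finset.mem_univ i)
      obtain ⟨j, -, hj⟩ := (Nat.Prime.prime (hX _ (ht.1 i))).exists_mem_finset_dvd h1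
      rw [Finset.mem_image]
      exact ⟨j, Finset.mem_univ j,
        ((Nat.prime_dvd_prime_iff_eq (hX _ (ht.1 i)) (hX _ (hs.1 j))).1 hj).symm⟩
    refine (Finset.card_le_card hsub).trans ?_
    rw [Fintype.card_piFinset_const]
    exact Nat.pow_le_pow_left (Finset.card_image_le.trans (by simp)) k

lemma coprime_sum_prod_erase {k : ℕ} (t : Fin k → ℕ) (ht : ∀ i, (t i).Prime)
    (hk : ∀ i, k < t i) :
    (∑ i, ∏ p ∈ (Finset.univ.image t).erase (t i), p).Coprime (∏ p ∈ Finset.univ.image t, p) := by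
  refine Nat.Coprime.prod_right fun p hp => ?_
  obtain ⟨i₀, -, rfl⟩ := Finset.mem_image.1 hp
  refine ((Nat.Prime.coprime_iff_not_dvd (ht i₀)).2 fun hdvd => ?_).symm
  rw [← Finset.sum_filter_add_sum_filter_not Finset.univ (fun i => t i = t i₀)] at hdvd
  have h1 : t i₀ ∣ ∑ i with ¬ t i = t i₀, ∏ p ∈ (Finset.univ.image t).erase (t i), p := by
    refine Finset.dvd_sum fun i hi => Finset.dvd_prod_of_mem _ ?_
    rw [Finset.mem_erase]
    exact ⟨fun h => (Finset.mem_filter.1 hi).2 h.symm, hp⟩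
  have h2 := (Nat.dvd_add_left h1).1 hdvd
  rw [Finset.sum_congr rfl (g := fun _ => ∏ p ∈ (Finset.univ.image t).erase (t i₀), p)
    fun i hi => by rw [(Finset.mem_filter.1 hi).2], Finset.sum_const, smul_eq_mul,
    (ht i₀).dvd_mul] at h2
  rcases h2 with h2 | h2
  · have hpos : 0 < (Finset.univ.filter fun i => t i = t i₀).card :=
      Finset.card_pos.2 ⟨i₀, by simp⟩
    have h3 := Nat.le_of_dvd hpos h2
    have h4 : (Finset.univ.filter fun i => t i = t i₀).card ≤ k :=
      (Finset.card_filter_le _ _).trans (by simp)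
    have := hk i₀
    omega
  · obtain ⟨p, hp', hdiv⟩ := (Nat.Prime.prime (ht i₀)).exists_mem_finset_dvd h2
    rw [Finset.mem_erase, Finset.mem_image] at hp'
    obtain ⟨hne, j, -, rfl⟩ := hp'
    exact hne ((Nat.prime_dvd_prime_iff_eq (ht i₀) (ht j)).1 hdiv).symm

lemma sum_inv_mul_prod_eq {k : ℕ} {F : Type*} [Field F] (t : Fin k → F) (ht : ∀ i, t i ≠ 0) :
    (∑ i, (t i)⁻¹) * ∏ i, t i = ∑ i, ∏ j ∈ Finset.univ.erase i, t j := by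
  rw [Finset.sum_mul]
  refine Finset.sum_congr rfl fun i _ => ?_
  rw [← Finset.mul_prod_erase _ _ (Finset.mem_univ i), inv_mul_cancel_left₀ (ht i)]

lemma sum_inv_mul_prod_image_eq {k : ℕ} {F : Type*} [Field F] (t : Fin k → ℕ)
    (ht : ∀ i, (t i : F) ≠ 0) :
    (∑ i, (t i : F)⁻¹) * ((∏ p ∈ Finset.univ.image t, p : ℕ) : F)
      = ((∑ i, ∏ p ∈ (Finset.univ.image t).erase (t i), p : ℕ) : F) := by
  push_cast
  rw [Finset.sum_mul]
  refine Finset.sum_congr rfl fun i _ => ?_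
  rw [← Finset.mul_prod_erase _ _ (Finset.mem_image_of_mem t (Finset.mem_univ i)),
    inv_mul_cancel_left₀ (ht i)]

/-- For a fixed tuple `t` of primes, the number of tuples with the same sum of inverses modulo `q`. -/
lemma card_sum_inv_eq_le {q P k : ℕ} [Fact q.Prime] (hP : 0 < P) (X : Finset ℕ)
    (hX : ∀ p ∈ X, p.Prime ∧ P ≤ p ∧ p ≤ 2 * P ∧ p < q) (hkP : k < P) (t : Fin k → ℕ)
    (ht : ∀ i, t i ∈ X) :
    ((Fintype.piFinset fun _ : Fin k => X).filter fun s : Fin k → ℕ =>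
        ∑ i, (t i : ZMod q)⁻¹ = ∑ i, (s i : ZMod q)⁻¹).card
      ≤ k ^ k * (((2 * P) ^ k / (∏ p ∈ Finset.univ.image t, p) + 1)
        * (2 * (k * (2 * P) ^ (2 * k) / (P * q)) + 1)) := by
  have hq : q.Prime := Fact.out
  have hne : ∀ p ∈ X, (p : ZMod q) ≠ 0 := by
    intro p hp h
    rw [ZMod.natCast_eq_zero_iff] at h
    exact absurd (Nat.le_of_dvd (hX p hp).1.pos h) (not_le.2 (hX p hp).2.2.2)
  set I := Finset.univ.image t with hI
  have hIX : ∀ p ∈ I, p ∈ X := by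
    intro p hp; obtain ⟨i, -, rfl⟩ := Finset.mem_image.1 hp; exact ht i
  have hIc : I.card ≤ k := Finset.card_image_le.trans (by simp)
  set B := ∏ p ∈ I, p with hB
  set A := ∑ i, ∏ p ∈ I.erase (t i), p with hA
  set T := k * (2 * P) ^ (2 * k) / (P * q) with hT
  have hcop : A.Coprime B := coprime_sum_prod_erase t (fun i => (hX _ (ht i)).1)
    fun i => hkP.trans_le (hX _ (ht i)).2.1
  have hBle : B ≤ (2 * P) ^ k :=
    (Finset.prod_le_pow_card _ _ _ fun p hp => (hX p (hIX p hp)).2.2.1).trans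
      (Nat.pow_le_pow_right (by omega) hIc)
  have hPA : P * A ≤ k * (2 * P) ^ k := by
    rw [hA, Finset.mul_sum]
    refine (Finset.sum_le_card_nsmul _ _ ((2 * P) ^ k) fun i _ => ?_).trans (by simp)
    refine le_trans ?_ hBle
    rw [hB, ← Finset.mul_prod_erase I _ (Finset.mem_image_of_mem t (Finset.mem_univ i))]
    exact Nat.mul_le_mul_right _ (hX _ (ht i)).2.1
  set S := (Fintype.piFinset fun _ : Fin k => X).filter fun s : Fin k → ℕ =>
        ∑ i, (t i : ZMod q)⁻¹ = ∑ i, (s i : ZMod q)⁻¹ with hS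
  set prd : (Fin k → ℕ) → ℕ := fun s => ∏ i, s i with hprd
  have h1 : S.card ≤ k ^ k * (S.image prd).card := by
    refine Finset.card_le_mul_card_image _ _ fun Q _ => ?_
    refine le_trans (Finset.card_le_card ?_) (card_prod_eq_le X (fun p hp => (hX p hp).1) Q)
    exact Finset.filter_subset_filter _ (Finset.filter_subset _ _)
  have hkey : ∀ Q ∈ S.image prd, Q ≤ (2 * P) ^ k ∧ ∃ u ∈ Finset.Icc (-(T : ℤ)) T,
      (B : ℤ) ∣ A * Q - u * q := by
    intro Q hQ
    obtain ⟨s, hs, rfl⟩ := Finset.mem_image.1 hQ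
    rw [hS, Finset.mem_filter, Fintype.mem_piFinset] at hs
    obtain ⟨hsX, hsum⟩ := hs
    have hQle : prd s ≤ (2 * P) ^ k := by
      refine (Finset.prod_le_pow_card _ _ _ fun i _ => (hX _ (hsX i)).2.2.1).trans (by simp)
    refine ⟨hQle, ?_⟩
    set R := ∑ i, ∏ j ∈ Finset.univ.erase i, s j with hR
    have hPR : P * R ≤ k * (2 * P) ^ k := by
      rw [hR, Finset.mul_sum]
      refine (Finset.sum_le_card_nsmul _ _ ((2 * P) ^ k) fun i _ => ?_).trans (by simp)
      refine le_trans ?_ hQle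
      rw [hprd]
      simp only
      rw [← Finset.mul_prod_erase Finset.univ _ (Finset.mem_univ i)]
      exact Nat.mul_le_mul_right _ (hX _ (hsX i)).2.1
    have e1 : (∑ i, (t i : ZMod q)⁻¹) * (B : ZMod q) = A :=
      sum_inv_mul_prod_image_eq t fun i => hne _ (ht i)
    have e2 : (∑ i, (s i : ZMod q)⁻¹) * (prd s : ZMod q) = R := by
      rw [hprd, hR]
      push_cast
      exact sum_inv_mul_prod_eq (F := ZMod q) (fun i => (s i : ZMod q)) fun i => hne _ (hsX i)
    have e3 : (((A * prd s : ℕ) : ℤ) : ZMod q) = ((B * R : ℕ) : ℤ) := by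
      push_cast
      rw [← e1, ← e2, hsum]
      ring
    rw [← sub_eq_zero, ← Int.cast_sub, ZMod.intCast_zmod_eq_zero_iff_dvd] at e3
    obtain ⟨u, hu⟩ := e3
    have hbd : ∀ m n : ℕ, P * m ≤ k * (2 * P) ^ k → n ≤ (2 * P) ^ k →
        P * (m * n) ≤ k * (2 * P) ^ (2 * k) := by
      intro m n hm hn
      calc P * (m * n) = P * m * n := by ring
        _ ≤ k * (2 * P) ^ k * (2 * P) ^ k := Nat.mul_le_mul hm hn
        _ = k * (2 * P) ^ (2 * k) := by rw [two_mul k, pow_add]; ring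
    have b1 := hbd A (prd s) hPA hQle
    have b2 := hbd R B hPR hBle
    have hPq : 0 < P * q := Nat.mul_pos hP hq.pos
    have hle : ∀ v : ℕ, P * (q * v) ≤ k * (2 * P) ^ (2 * k) → v ≤ T := by
      intro v hv
      rw [hT, Nat.le_div_iff_mul_le hPq]
      calc v * (P * q) = P * (q * v) := by ring
        _ ≤ _ := hv
    refine ⟨u, ?_, ⟨R, ?_⟩⟩
    · rw [Finset.mem_Icc]
      rcases le_total 0 u with h0 | h0
      · obtain ⟨v, rfl⟩ := Int.eq_ofNat_of_zero_le h0
        have : v ≤ T := hle v (le_trans (Nat.mul_le_mul_left _ (by zify; push_cast at hu; nlinarith [Int.natCast_nonneg (B * R)])) b1)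
        omega
      · obtain ⟨v, hv⟩ := Int.eq_ofNat_of_zero_le (neg_nonneg.2 h0)
        obtain rfl : u = -v := by omega
        have : v ≤ T := hle v (le_trans (Nat.mul_le_mul_left _ (by zify; push_cast at hu; nlinarith [Int.natCast_nonneg (A * prd s)])) b2)
        omega
    · push_cast at hu ⊢
      linarith
  choose! hQle u hu using hkey
  have h2 : (S.image prd).card ≤ ((2 * P) ^ k / B + 1) * (Finset.Icc (-(T : ℤ)) T).card := by
    refine Finset.card_le_mul_card_image_of_maps_to (f := u) (fun Q hQ => (hu Q hQ).1) _
      fun v _ => card_le_of_modEq (fun Q hQ => hQle Q (Finset.mem_filter.1 hQ).1)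
        fun Q hQ Q' hQ' => ?_
    rw [Finset.mem_filter] at hQ hQ'
    have d1 := (hu Q hQ.1).2
    have d2 := (hu Q' hQ'.1).2
    rw [hQ.2] at d1
    rw [hQ'.2] at d2
    have d3 : (B : ℤ) ∣ A * (Q' - Q) := by
      have := dvd_sub d2 d1
      rwa [sub_sub_sub_cancel_right, ← mul_sub] at this
    have d4 := (Nat.isCoprime_iff_coprime.2 hcop.symm).dvd_of_dvd_mul_left d3
    exact (Nat.modEq_iff_dvd).2 d4
  calc S.card ≤ k ^ k * (S.image prd).card := h1
    _ ≤ _ := by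
      refine Nat.mul_le_mul_left _ (h2.trans (le_of_eq ?_))
      rw [Int.card_Icc]
      congr 1
      omega

lemma card_image_card_eq_le (k d : ℕ) (hd : d ≤ k) (X : Finset ℕ) :
    ((Fintype.piFinset fun _ : Fin k => X).filter
      fun t : Fin k → ℕ => (Finset.univ.image t).card = d).card ≤ k ^ k * X.card ^ d := by
  refine (Finset.card_le_mul_card_image_of_maps_to
    (f := fun t : Fin k → ℕ => Finset.univ.image t) (t := Finset.powersetCard d X) (fun t ht => ?_)
      (k ^ k) fun I hI => ?_).trans ?_
  · rw [Finset.mem_filter, Fintype.mem_piFinset] at ht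
    rw [Finset.mem_powersetCard]
    refine ⟨fun p hp => ?_, ht.2⟩
    obtain ⟨i, -, rfl⟩ := Finset.mem_image.1 hp
    exact ht.1 i
  · rw [Finset.mem_powersetCard] at hI
    refine (Finset.card_le_card (t := Fintype.piFinset fun _ : Fin k => I) fun t ht => ?_).trans ?_
    · rw [Finset.mem_filter] at ht
      rw [Fintype.mem_piFinset]
      intro i
      rw [← ht.2]
      exact Finset.mem_image_of_mem t (Finset.mem_univ i)
    · rw [Fintype.card_piFinset_const, hI.2]
      exact Nat.pow_le_pow_left hd k
  · rw [Finset.card_powersetCard]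
    exact Nat.mul_le_mul_left _ (Nat.choose_le_pow _ _)

/-- A bound for the additive energy of the inverses of primes modulo `q`. -/
lemma tupleEnergy_inv_le {q P k : ℕ} [Fact q.Prime] (hP : 0 < P) (X : Finset ℕ)
    (hX : ∀ p ∈ X, p.Prime ∧ P ≤ p ∧ p ≤ 2 * P ∧ p < q) (hXP : X.card ≤ P) (hkP : k < P)
    (hk : 1 ≤ k) {c : ZMod q} (hc : c ≠ 0) :
    (tupleEnergy X (fun p => c * (p : ZMod q)⁻¹) k : ℝ)
      ≤ (k : ℝ) ^ k * (k ^ k * k * (2 * (2 * P) ^ k))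
        * (2 * (k * (2 * P) ^ (2 * k) / (P * q)) + 1) := by
  have hP' : (0 : ℝ) < P := by exact_mod_cast hP
  set T : ℕ := k * (2 * P) ^ (2 * k) / (P * q) with hT
  have hTr : (T : ℝ) ≤ k * (2 * P) ^ (2 * k) / (P * q) := by
    refine Nat.cast_div_le.trans (le_of_eq ?_)
    push_cast; rfl
  set W := Fintype.piFinset fun _ : Fin k => X with hW
  have h1 : (tupleEnergy X (fun p => c * (p : ZMod q)⁻¹) k : ℕ) = ∑ t ∈ W,
      (W.filter fun s : Fin k → ℕ => ∑ i, (t i : ZMod q)⁻¹ = ∑ i, (s i : ZMod q)⁻¹).card := by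
    rw [tupleEnergy, collisions, Finset.card_filter, Finset.sum_product]
    refine Finset.sum_congr rfl fun t _ => ?_
    rw [Finset.card_filter]
    refine Finset.sum_congr rfl fun s _ => ?_
    simp only [← Finset.mul_sum, mul_right_inj' hc]
  have h2 : ∀ t ∈ W, ((W.filter fun s : Fin k → ℕ =>
      ∑ i, (t i : ZMod q)⁻¹ = ∑ i, (s i : ZMod q)⁻¹).card : ℝ)
      ≤ (k : ℝ) ^ k * (2 * (2 * P) ^ k * (2 * T + 1)) * (1 / P ^ (Finset.univ.image t).card) := by
    intro t ht
    have htX := Fintype.mem_piFinset.1 ht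
    have h3 := card_sum_inv_eq_le hP X hX hkP t htX
    have h4 : (((W.filter fun s : Fin k → ℕ =>
      ∑ i, (t i : ZMod q)⁻¹ = ∑ i, (s i : ZMod q)⁻¹).card : ℕ) : ℝ) ≤ _ := Nat.cast_le.2 h3
    refine h4.trans ?_
    push_cast
    set I := Finset.univ.image t
    have hIX : ∀ p ∈ I, p ∈ X := by
      intro p hp; obtain ⟨i, -, rfl⟩ := Finset.mem_image.1 hp; exact htX i
    have hIc : I.card ≤ k := Finset.card_image_le.trans (by simp)
    have hB : ((P : ℝ)) ^ I.card ≤ ∏ p ∈ I, (p : ℝ) := by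
      rw [← Finset.prod_const]
      exact Finset.prod_le_prod (fun _ _ => hP'.le) fun p hp => by
        exact_mod_cast (hX p (hIX p hp)).2.1
    have h5 : (((2 * P) ^ k / (∏ p ∈ I, p) : ℕ) : ℝ) ≤ (2 * P) ^ k / P ^ I.card := by
      refine Nat.cast_div_le.trans ?_
      push_cast
      gcongr
    have h6 : (1 : ℝ) ≤ (2 * P) ^ k / P ^ I.card := by
      rw [one_le_div (by positivity)]
      have h1P : (1 : ℝ) ≤ P := by exact_mod_cast hP
      calc (P : ℝ) ^ I.card ≤ P ^ k := pow_le_pow_right₀ h1P hIc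
        _ ≤ _ := by gcongr; linarith
    calc (k : ℝ) ^ k * (((((2 * P) ^ k / (∏ p ∈ I, p) : ℕ) : ℝ) + 1) * (2 * T + 1))
        ≤ (k : ℝ) ^ k * (((2 * P) ^ k / P ^ I.card + (2 * P) ^ k / P ^ I.card) * (2 * T + 1)) := by
          gcongr
      _ = _ := by ring
  have h3 : ∑ t ∈ W, (1 : ℝ) / P ^ (Finset.univ.image t).card ≤ k ^ k * k := by
    rw [← Finset.sum_fiberwise_of_maps_to (t := Finset.Icc 1 k)
      (g := fun t : Fin k → ℕ => (Finset.univ.image t).card) (fun t _ => ?_)]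
    · calc _ ≤ ∑ d ∈ Finset.Icc 1 k, (k : ℝ) ^ k := by
            refine Finset.sum_le_sum fun d hd => ?_
            rw [Finset.sum_congr rfl (g := fun _ => (1 : ℝ) / P ^ d)
              fun t ht => by rw [(Finset.mem_filter.1 ht).2], Finset.sum_const, nsmul_eq_mul,
              mul_one_div, div_le_iff₀ (by positivity)]
            have h := card_image_card_eq_le k d (Finset.mem_Icc.1 hd).2 X
            calc _ ≤ ((k ^ k * X.card ^ d : ℕ) : ℝ) := by
                  exact Nat.cast_le.2 h
              _ ≤ _ := by
                  push_cast
                  gcongr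
        _ = _ := by simp [mul_comm]
    · rw [Finset.mem_Icc]
      refine ⟨Finset.card_pos.2 ⟨t ⟨0, hk⟩, Finset.mem_image_of_mem t (Finset.mem_univ _)⟩,
        Finset.card_image_le.trans (by simp)⟩
  rw [h1]
  push_cast
  calc _ ≤ ∑ t ∈ W, (k : ℝ) ^ k * (2 * (2 * P) ^ k * (2 * T + 1))
          * (1 / P ^ (Finset.univ.image t).card) := Finset.sum_le_sum h2
    _ = (k : ℝ) ^ k * (2 * (2 * P) ^ k * (2 * T + 1))
          * ∑ t ∈ W, 1 / (P : ℝ) ^ (Finset.univ.image t).card := by rw [Finset.mul_sum]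
    _ ≤ (k : ℝ) ^ k * (2 * (2 * P) ^ k * (2 * (k * (2 * P) ^ (2 * k) / (P * q)) + 1))
          * (k ^ k * k) := by gcongr
    _ = _ := by ring

/-- The constant in the energy bound for inverses of primes. -/
noncomputable def energyConst (k : ℕ) : ℝ := 6 * k ^ (2 * k + 2) * 8 ^ k

lemma sqrt_mul_tupleEnergy_div_le {q P k : ℕ} [Fact q.Prime] (hP : 0 < P) (X : Finset ℕ)
    (hX : ∀ p ∈ X, p.Prime ∧ P ≤ p ∧ p ≤ 2 * P ∧ p < q) (hXP : X.card ≤ P) (hkP : k + 1 < P)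
    {c : ZMod q} (hc : c ≠ 0) {w : ℝ} (h1 : q * Real.exp w ≤ (P : ℝ) ^ (2 * (k + 1)))
    (h2 : (P : ℝ) ^ (2 * k) * Real.exp w ≤ q) :
    √q * tupleEnergy X (fun p => c * (p : ZMod q)⁻¹) (k + 1) / (P : ℝ) ^ (2 * (k + 1))
      ≤ energyConst (k + 1) * (2 * Real.exp (-(w / 2))) := by
  have hq : 0 < (q : ℝ) := by exact_mod_cast (Fact.out : q.Prime).pos
  have hP' : (0 : ℝ) < P := by exact_mod_cast hP
  have hJ := tupleEnergy_inv_le hP X hX hXP hkP (by omega) hc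
  set J : ℝ := (tupleEnergy X (fun p => c * (p : ZMod q)⁻¹) (k + 1) : ℝ)
  obtain ⟨x, hx⟩ : ∃ x : ℝ, x = (P : ℝ) ^ (k + 1) := ⟨_, rfl⟩
  obtain ⟨y, hy⟩ : ∃ y : ℝ, y = (P : ℝ) ^ k := ⟨_, rfl⟩
  obtain ⟨s, hs⟩ : ∃ s : ℝ, s = √q := ⟨_, rfl⟩
  obtain ⟨e, he⟩ : ∃ e : ℝ, e = Real.exp (w / 2) := ⟨_, rfl⟩
  have hx0 : 0 < x := by rw [hx]; positivity
  have hy0 : 0 < y := by rw [hy]; positivity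
  have hs0 : 0 < s := by rw [hs]; positivity
  have he0 : 0 < e := by rw [he]; positivity
  have hsq : (q : ℝ) = s ^ 2 := by rw [hs, Real.sq_sqrt hq.le]
  have hee : Real.exp w = e ^ 2 := by rw [he, ← Real.exp_nat_mul]; congr 1; push_cast; ring
  have hxx : (P : ℝ) ^ (2 * (k + 1)) = x ^ 2 := by rw [hx]; ring
  have hyy : (P : ℝ) ^ (2 * k) = y ^ 2 := by rw [hy]; ring
  have hxy : x = P * y := by rw [hx, hy]; ring
  rw [hsq, hee, hxx, ← mul_pow] at h1
  rw [hsq, hee, hyy, ← mul_pow] at h2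
  have h3 : s * e ≤ x := (sq_le_sq₀ (by positivity) hx0.le).1 h1
  have h4 : y * e ≤ s := (sq_le_sq₀ (by positivity) hs0.le).1 h2
  set m : ℝ := ((k + 1 : ℕ) : ℝ) with hm
  have hm1 : 1 ≤ m := by rw [hm]; push_cast; linarith [Nat.cast_nonneg (α := ℝ) k]
  have h5 : J ≤ energyConst (k + 1) * (x * (x * y / s ^ 2 + 1)) := by
    refine hJ.trans ?_
    have e1 : (2 * (P : ℝ)) ^ (k + 1) = 2 ^ (k + 1) * x := by rw [hx]; ring
    have e2 : (2 * (P : ℝ)) ^ (2 * (k + 1)) / (P * q) = 4 ^ (k + 1) * (x * y / s ^ 2) := by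
      rw [mul_pow, hxx, hsq, pow_mul]
      rw [hxy]
      field_simp
      norm_num
    have e3 : m * (2 * (P : ℝ)) ^ (2 * (k + 1)) / (P * q) = m * (4 ^ (k + 1) * (x * y / s ^ 2)) := by
      rw [mul_div_assoc, e2]
    rw [e1, e3]
    have h6 : 2 * (m * (4 ^ (k + 1) * (x * y / s ^ 2))) + 1
        ≤ 3 * m * 4 ^ (k + 1) * (x * y / s ^ 2 + 1) := by
      have h7 : (1 : ℝ) ≤ m * 4 ^ (k + 1) := one_le_mul_of_one_le_of_one_le hm1
        (one_le_pow₀ (by norm_num))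
      have h8 : 0 ≤ m * 4 ^ (k + 1) * (x * y / s ^ 2) := by positivity
      nlinarith
    calc _ ≤ m ^ (k + 1) * (m ^ (k + 1) * m * (2 * (2 ^ (k + 1) * x)))
          * (3 * m * 4 ^ (k + 1) * (x * y / s ^ 2 + 1)) := by gcongr
      _ = _ := by
        rw [energyConst, show (8 : ℝ) = 2 * 4 by norm_num, mul_pow]
        ring
  have hE : 0 ≤ energyConst (k + 1) := by rw [energyConst]; positivity
  calc √q * J / (P : ℝ) ^ (2 * (k + 1))
      ≤ s * (energyConst (k + 1) * (x * (x * y / s ^ 2 + 1))) / x ^ 2 := by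
        rw [hxx, ← hs]; gcongr
    _ = energyConst (k + 1) * (y / s + s / x) := by field_simp
    _ ≤ energyConst (k + 1) * (1 / e + 1 / e) := by
        gcongr ?_ * (?_ + ?_)
        · rwa [div_le_div_iff₀ hs0 he0, one_mul]
        · rwa [div_le_div_iff₀ hx0 he0, one_mul]
    _ = _ := by rw [he, Real.exp_neg]; ring

/-- The weighted bilinear sum over inverses of primes from two dyadic blocks. -/
noncomputable def primePairSum (q : ℕ) [NeZero q] (i j : ℕ) (c : ZMod q) : ℂ :=
  ∑ p ∈ dyadicPrimes i, ∑ r ∈ dyadicPrimes j,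
    ZMod.stdAddChar (c * ((p : ZMod q)⁻¹ * (r : ZMod q)⁻¹)) / (p * r)

lemma norm_primePairSum_pow_le {q i j k l : ℕ} [Fact q.Prime] (hi : 2 ^ (i + 1) ≤ q)
    (hj : 2 ^ (j + 1) ≤ q) (hk : k + 1 < 2 ^ i) (hl : l + 1 < 2 ^ j) {w : ℝ}
    (h1 : q * Real.exp w ≤ (2 ^ i : ℝ) ^ (2 * (k + 1)))
    (h2 : (2 ^ i : ℝ) ^ (2 * k) * Real.exp w ≤ q)
    (h3 : q ≤ (2 ^ j : ℝ) ^ (2 * (l + 1)))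
    (h4 : (2 ^ j : ℝ) ^ (2 * l) ≤ q) {c : ZMod q} (hc : c ≠ 0) :
    (‖primePairSum q i j c‖ ^ ((k + 1) * (l + 1))) ^ 2
      ≤ energyConst (k + 1) * energyConst (l + 1) * (4 * Real.exp (-(w / 2))) := by
  have hmem : ∀ n : ℕ, 2 ^ (n + 1) ≤ q → ∀ p ∈ dyadicPrimes n,
      p.Prime ∧ 2 ^ n ≤ p ∧ p ≤ 2 * 2 ^ n ∧ p < q := by
    intro n hn p hp
    rw [mem_dyadicPrimes] at hp
    have := pow_succ 2 n
    exact ⟨hp.2, hp.1.1, by omega, by omega⟩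
  have hq : 0 < (q : ℝ) := by exact_mod_cast (Fact.out : q.Prime).pos
  have e1 := sqrt_mul_tupleEnergy_div_le (by positivity) (dyadicPrimes i) (hmem i hi)
    (card_dyadicPrimes_le i) hk hc (w := w) (by exact_mod_cast h1) (by exact_mod_cast h2)
  have e2 := sqrt_mul_tupleEnergy_div_le (by positivity) (dyadicPrimes j) (hmem j hj)
    (card_dyadicPrimes_le j) hl (c := (1 : ZMod q)) one_ne_zero (w := 0)
    (by rw [Real.exp_zero, mul_one]; exact_mod_cast h3)
    (by rw [Real.exp_zero, mul_one]; exact_mod_cast h4)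
  have hw : ∀ n : ℕ, ∀ p : ℕ, ‖(if p ∈ dyadicPrimes n then (2 ^ n / p : ℂ) else 0)‖ ≤ 1 := by
    intro n p
    split_ifs with hp
    · rw [mem_dyadicPrimes] at hp
      rw [norm_div, norm_pow, RCLike.norm_natCast, RCLike.norm_ofNat]
      refine div_le_one_of_le₀ ?_ (Nat.cast_nonneg _)
      exact_mod_cast hp.1.1
    · simp
  have main := norm_bilinear_pow_le (dyadicPrimes i) (dyadicPrimes j)
    (fun p => c * (p : ZMod q)⁻¹) (fun p => 1 * (p : ZMod q)⁻¹) _ _ (hw i) (hw j) k l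
  have hS : ∑ r ∈ dyadicPrimes j, (if r ∈ dyadicPrimes j then (2 ^ j / r : ℂ) else 0) *
      ∑ p ∈ dyadicPrimes i, (if p ∈ dyadicPrimes i then (2 ^ i / p : ℂ) else 0) *
        ZMod.stdAddChar (c * (p : ZMod q)⁻¹ * (1 * (r : ZMod q)⁻¹))
      = 2 ^ i * 2 ^ j * primePairSum q i j c := by
    rw [primePairSum, Finset.sum_comm, Finset.mul_sum]
    refine Finset.sum_congr rfl fun r hr => ?_
    rw [if_pos hr, Finset.mul_sum, Finset.mul_sum]
    refine Finset.sum_congr rfl fun p hp => ?_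
    rw [if_pos hp, one_mul, mul_assoc]
    ring
  rw [hS, norm_mul, norm_mul, norm_pow, norm_pow, RCLike.norm_ofNat] at main
  set V := ‖primePairSum q i j c‖
  set J₁ : ℝ := (tupleEnergy (dyadicPrimes i) (fun p => c * (p : ZMod q)⁻¹) (k + 1) : ℝ)
  set J₂ : ℝ := (tupleEnergy (dyadicPrimes j) (fun p => 1 * (p : ZMod q)⁻¹) (l + 1) : ℝ)
  have hc1 : ((dyadicPrimes i).card : ℝ) ≤ 2 ^ i := by exact_mod_cast card_dyadicPrimes_le i
  have hc2 : ((dyadicPrimes j).card : ℝ) ≤ 2 ^ j := by exact_mod_cast card_dyadicPrimes_le j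
  push_cast at e1 e2
  have hP : (0 : ℝ) < 2 ^ i := by positivity
  have hR : (0 : ℝ) < 2 ^ j := by positivity
  generalize (2 ^ i : ℝ) = P at *
  generalize (2 ^ j : ℝ) = R at *
  have hV : (V ^ ((k + 1) * (l + 1))) ^ 2
      ≤ (√q * J₁ / P ^ (2 * (k + 1))) * (√q * J₂ / R ^ (2 * (l + 1))) := by
    have hJ : (0 : ℝ) ≤ q * J₁ * J₂ := by positivity
    have m2 : ((P * R * V) ^ ((k + 1) * (l + 1))) ^ 2
        ≤ (R ^ (k * (l + 1)) * P ^ ((k + 1) * l)) ^ 2 * (q * J₁ * J₂) :=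
      main.trans (by gcongr)
    have hA : 0 < (R ^ (k * (l + 1)) * P ^ ((k + 1) * l)) ^ 2 := by positivity
    rw [div_mul_div_comm, le_div_iff₀ (by positivity)]
    refine le_of_mul_le_mul_left (le_trans (le_of_eq ?_) (m2.trans (le_of_eq ?_))) hA
    · ring
    · rw [mul_mul_mul_comm, Real.mul_self_sqrt hq.le, mul_assoc (q : ℝ)]
  calc _ ≤ _ := hV
    _ ≤ (energyConst (k + 1) * (2 * Real.exp (-(w / 2))))
        * (energyConst (l + 1) * (2 * Real.exp (-(0 / 2)))) := by
      gcongr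
      exact le_trans (by positivity) e1
    _ = _ := by
      simp only [zero_div, neg_zero, Real.exp_zero]
      ring

lemma energyConst_le {k : ℕ} {ℓ : ℝ} (hℓ : 2 ≤ ℓ) (hk : (k + 1 : ℝ) ≤ Real.exp ℓ) :
    energyConst (k + 1) ≤ Real.exp (8 * (k + 1) * ℓ) := by
  have h6 : (6 : ℝ) ≤ Real.exp 2 := by
    have := Real.exp_one_gt_d9
    have h : Real.exp 2 = Real.exp 1 * Real.exp 1 := by rw [← Real.exp_add]; norm_num
    rw [h]; nlinarith
  have h8 : (8 : ℝ) ≤ Real.exp 3 := by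
    have := Real.exp_one_gt_d9
    have h : Real.exp 3 = Real.exp 2 * Real.exp 1 := by rw [← Real.exp_add]; norm_num
    rw [h]; nlinarith
  have hk0 : (0 : ℝ) ≤ k := Nat.cast_nonneg k
  rw [energyConst]
  push_cast
  calc 6 * ((k : ℝ) + 1) ^ (2 * (k + 1) + 2) * 8 ^ (k + 1)
      ≤ Real.exp 2 * Real.exp ℓ ^ (2 * (k + 1) + 2) * Real.exp 3 ^ (k + 1) := by gcongr
    _ = Real.exp (2 + (2 * (k + 1) + 2) * ℓ + (k + 1) * 3) := by
      rw [← Real.exp_nat_mul, ← Real.exp_nat_mul, ← Real.exp_add, ← Real.exp_add]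
      congr 1
      push_cast
      ring
    _ ≤ _ := by
      refine Real.exp_le_exp.2 ?_
      nlinarith [mul_nonneg hk0 (sub_nonneg.2 hℓ)]

lemma exists_moment {L Λ : ℝ} (hΛ : 2 ≤ Λ) (hL : Λ ^ 3 = L) {j : ℕ} (hj : Λ ^ 2 ≤ j) :
    ∃ k : ℕ, (k + 1 : ℝ) ≤ 2 * Λ ∧ L ≤ 2 * (k + 1) * j * Real.log 2 ∧
      2 * k * j * Real.log 2 ≤ L ∧ k + 1 < 2 ^ j := by
  have hl2 := Real.log_two_gt_d9
  have hj0 : 0 < (j : ℝ) := lt_of_lt_of_le (by positivity) hj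
  have hd : 0 < 2 * j * Real.log 2 := by positivity
  have hLpos : 0 < L := by rw [← hL]; positivity
  set x := L / (2 * j * Real.log 2) with hx
  have hx0 : 0 < x := by positivity
  obtain ⟨k, hk⟩ : ∃ k, ⌈x⌉₊ = k + 1 := Nat.exists_eq_succ_of_ne_zero (Nat.ceil_pos.2 hx0).ne'
  have h1 : x ≤ k + 1 := by have := Nat.le_ceil x; rw [hk] at this; exact_mod_cast this
  have h2 : (k : ℝ) ≤ x := by
    have : k < ⌈x⌉₊ := by omega
    exact (Nat.lt_ceil.1 this).le
  have hxL : x * (2 * j * Real.log 2) = L := div_mul_cancel₀ _ hd.ne'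
  have hxΛ : x ≤ Λ := by
    rw [hx, div_le_iff₀ hd, ← hL]
    have : Λ ^ 2 * 1 ≤ j * (2 * Real.log 2) := mul_le_mul hj (by linarith) (by norm_num) hj0.le
    calc Λ ^ 3 = Λ * (Λ ^ 2 * 1) := by ring
      _ ≤ Λ * (j * (2 * Real.log 2)) := by gcongr
      _ = _ := by ring
  refine ⟨k, by linarith, ?_, ?_, ?_⟩
  · nlinarith
  · nlinarith
  · have h3 : j < 2 ^ j := Nat.lt_two_pow_self
    have h4 : (k + 1 : ℝ) ≤ j := by nlinarith
    have h5 : k + 1 ≤ j := by exact_mod_cast h4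
    omega

lemma norm_primePairSum_le {q i j : ℕ} [Fact q.Prime] {L Λ ℓ : ℝ} (hLq : Real.exp L = q)
    (hL : Λ ^ 3 = L) (hℓL : Real.exp ℓ = L) (hΛ : 2 ≤ Λ) (hℓ : 2 ≤ ℓ) (hlarge : 96 * Λ * ℓ ≤ L)
    (hi : Λ ^ 2 ≤ i) (hj : Λ ^ 2 ≤ j) (hiq : 2 ^ (i + 1) ≤ q) (hjq : 2 ^ (j + 1) ≤ q)
    (hlucky : ∀ k : ℕ, 1 ≤ k → k ≤ 2 * Λ → 192 * k * Λ * ℓ ≤ |2 * k * i * Real.log 2 - L|)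
    {c : ZMod q} (hc : c ≠ 0) :
    ‖primePairSum q i j c‖ ≤ Real.exp (-(3 * ℓ)) := by
  obtain ⟨k, hk1, hk2, hk3, hk4⟩ := exists_moment hΛ hL hi
  obtain ⟨l, hl1, hl2, hl3, hl4⟩ := exists_moment hΛ hL hj
  have hpow : ∀ n m : ℕ, (2 ^ n : ℝ) ^ (2 * m) = Real.exp (2 * m * n * Real.log 2) := by
    intro n m
    rw [← pow_mul, ← Real.exp_log (show (0 : ℝ) < 2 ^ (n * (2 * m)) by positivity), Real.log_pow]
    congr 1; push_cast; ring
  set w := 96 * (k + 1 : ℝ) * Λ * ℓ with hw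
  have hΛℓ : 0 < Λ * ℓ := by positivity
  have hk0 : (0 : ℝ) ≤ k := Nat.cast_nonneg k
  have hl0 : (0 : ℝ) ≤ l := Nat.cast_nonneg l
  have hw1 : L + w ≤ 2 * (k + 1) * i * Real.log 2 := by
    have := hlucky (k + 1) (by omega) (by exact_mod_cast hk1)
    push_cast at this
    rw [abs_of_nonneg (by linarith)] at this
    nlinarith
  have hw2 : 2 * k * i * Real.log 2 + w ≤ L := by
    rcases Nat.eq_zero_or_pos k with h | h
    · subst h
      rw [hw]; push_cast; linarith
    · have := hlucky k h (by linarith)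
      rw [abs_of_nonpos (by linarith)] at this
      have h1 : (1 : ℝ) ≤ k := by exact_mod_cast h
      nlinarith
  have hexpΛ : 2 * Λ ≤ Real.exp ℓ := by rw [hℓL, ← hL]; nlinarith [mul_pos (by linarith : (0:ℝ) < Λ) (by linarith : (0:ℝ) < Λ), sq_nonneg (Λ - 2)]
  have main := norm_primePairSum_pow_le hiq hjq hk4 hl4 (w := w) (c := c)
    (by rw [hpow, ← hLq, ← Real.exp_add]; exact Real.exp_le_exp.2 (by push_cast; linarith))
    (by rw [hpow, ← hLq, ← Real.exp_add]; exact Real.exp_le_exp.2 (by linarith))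
    (by rw [hpow, ← hLq]; exact Real.exp_le_exp.2 (by push_cast; linarith))
    (by rw [hpow, ← hLq]; exact Real.exp_le_exp.2 (by linarith)) hc
  have hE1 := energyConst_le hℓ (hk1.trans hexpΛ)
  have hE2 := energyConst_le hℓ (hl1.trans hexpΛ)
  have h4 : (4 : ℝ) ≤ Real.exp 2 := by
    have := Real.exp_one_gt_d9
    have h : Real.exp 2 = Real.exp 1 * Real.exp 1 := by rw [← Real.exp_add]; norm_num
    rw [h]; nlinarith
  have hfin : (‖primePairSum q i j c‖ ^ ((k + 1) * (l + 1))) ^ 2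
      ≤ (Real.exp (-(3 * ℓ)) ^ ((k + 1) * (l + 1))) ^ 2 := by
    refine main.trans ?_
    have hE0 : 0 ≤ energyConst (l + 1) := by rw [energyConst]; positivity
    calc _ ≤ Real.exp (8 * (k + 1) * ℓ) * Real.exp (8 * (l + 1) * ℓ)
          * (Real.exp 2 * Real.exp (-(w / 2))) := by gcongr
      _ = Real.exp (8 * (k + 1) * ℓ + 8 * (l + 1) * ℓ + (2 + -(w / 2))) := by
        simp only [Real.exp_add]
      _ ≤ Real.exp ((((k + 1) * (l + 1) * 2 : ℕ) : ℝ) * (-(3 * ℓ))) := by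
        refine Real.exp_le_exp.2 ?_
        push_cast
        have a1 : (k + 1 : ℝ) * ℓ * (l + 1) ≤ (k + 1) * ℓ * (2 * Λ) := by gcongr
        have a2 : 0 ≤ (k : ℝ) * l * ℓ := by positivity
        have a3 : 0 ≤ (k : ℝ) * ℓ := by positivity
        have a4 : 0 ≤ (l : ℝ) * ℓ := by positivity
        rw [hw]
        nlinarith
      _ = _ := by rw [← pow_mul, Real.exp_nat_mul]
  have h5 := (sq_le_sq₀ (by positivity) (by positivity)).1 hfin
  exact (pow_le_pow_iff_left₀ (norm_nonneg _) (Real.exp_pos _).le (by positivity)).1 h5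

lemma sum_inv_le_of_forall_exists {ι : Type*} (E : Finset ℕ) (T : Finset ι) (f : ι → ℕ)
    (h : ∀ n ∈ E, ∃ t ∈ T, f t = n) : ∑ n ∈ E, (1 : ℝ) / n ≤ ∑ t ∈ T, (1 : ℝ) / f t := by
  rcases E.eq_empty_or_nonempty with rfl | ⟨n₀, hn₀⟩
  · simp only [Finset.sum_empty]
    positivity
  have : Nonempty ι := ⟨(h n₀ hn₀).choose⟩
  choose! g hg using h
  have h1 : ∑ n ∈ E, (1 : ℝ) / n = ∑ t ∈ E.image g, (1 : ℝ) / f t := by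
    rw [Finset.sum_image fun a ha b hb hab => by rw [← (hg a ha).2, hab, (hg b hb).2]]
    exact Finset.sum_congr rfl fun n hn => by rw [(hg n hn).2]
  rw [h1]
  refine Finset.sum_le_sum_of_subset_of_nonneg ?_ fun _ _ _ => by positivity
  intro t ht
  obtain ⟨n, hn, rfl⟩ := Finset.mem_image.1 ht
  exact (hg n hn).1

lemma sum_inv_le_sum_mul {ι : Type*} (E : Finset ℕ) (I : Finset ι) (A B : ι → Finset ℕ)
    (h : ∀ n ∈ E, ∃ i ∈ I, ∃ a ∈ A i, ∃ b ∈ B i, a * b = n) :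
    ∑ n ∈ E, (1 : ℝ) / n ≤ ∑ i ∈ I, (∑ a ∈ A i, (1 : ℝ) / a) * ∑ b ∈ B i, (1 : ℝ) / b := by
  refine (sum_inv_le_of_forall_exists E (I.sigma fun i => A i ×ˢ B i)
    (fun t => t.2.1 * t.2.2) fun n hn => ?_).trans (le_of_eq ?_)
  · obtain ⟨i, hi, a, ha, b, hb, rfl⟩ := h n hn
    exact ⟨⟨i, a, b⟩, by simp [hi, ha, hb], rfl⟩
  · rw [Finset.sum_sigma]
    refine Finset.sum_congr rfl fun i _ => ?_
    rw [Finset.sum_product, Finset.sum_mul_sum]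
    simp only [Nat.cast_mul, one_div, mul_inv]

lemma exists_max_prime_factor {n J J₀ : ℕ} (hn : n ∈ Nat.smoothNumbers (2 ^ J))
    (hn₀ : n ∉ Nat.smoothNumbers (2 ^ J₀)) :
    ∃ i, J₀ ≤ i ∧ i < J ∧ ∃ p ∈ dyadicPrimes i, ∃ m ∈ Nat.smoothNumbers (2 ^ (i + 1)),
      p * m = n := by
  have hne := Nat.ne_zero_of_mem_smoothNumbers hn
  rw [Nat.mem_smoothNumbers'] at hn hn₀
  push Not at hn₀
  obtain ⟨r, hr, hrn, hrJ⟩ := hn₀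
  obtain ⟨p, hp, hmax⟩ := n.primeFactors.exists_max_image id ⟨r, Nat.mem_primeFactors.2 ⟨hr, hrn, hne⟩⟩
  have hpn := Nat.mem_primeFactors.1 hp
  have hrp : r ≤ p := hmax r (Nat.mem_primeFactors.2 ⟨hr, hrn, hne⟩)
  have hp0 : p ≠ 0 := hpn.1.ne_zero
  have h1 : 2 ^ Nat.log 2 p ≤ p := Nat.pow_log_le_self 2 hp0
  have h2 : p < 2 ^ (Nat.log 2 p + 1) := Nat.lt_pow_succ_log_self (by norm_num) p
  refine ⟨Nat.log 2 p, ?_, ?_, p, ?_, n / p, ?_, Nat.mul_div_cancel' hpn.2.1⟩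
  · by_contra! h
    have : 2 ^ (Nat.log 2 p + 1) ≤ 2 ^ J₀ := Nat.pow_le_pow_right (by norm_num) h
    omega
  · exact (Nat.pow_lt_pow_iff_right (by norm_num)).1 (h1.trans_lt (hn p hpn.1 hpn.2.1))
  · exact mem_dyadicPrimes.2 ⟨⟨h1, h2⟩, hpn.1⟩
  · rw [Nat.mem_smoothNumbers']
    intro s hs hsn
    have : s ≤ p := hmax s (Nat.mem_primeFactors.2
      ⟨hs, hsn.trans (Nat.div_dvd_of_dvd hpn.2.1), hne⟩)
    omega

lemma mul_mul_injective_of_dyadic {i j i' j' m m' p p' r r' : ℕ} (hp : p ∈ dyadicPrimes i)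
    (hp' : p' ∈ dyadicPrimes i') (hr : r ∈ dyadicPrimes j) (hr' : r' ∈ dyadicPrimes j')
    (hji : j < i) (hji' : j' < i') (hm : m ∈ Nat.smoothNumbers (2 ^ j))
    (hm' : m' ∈ Nat.smoothNumbers (2 ^ j')) (h : p * r * m = p' * r' * m') :
    i = i' ∧ j = j' ∧ m = m' ∧ p = p' ∧ r = r' := by
  have hcls : ∀ {a b x : ℕ}, x ∈ dyadicPrimes a → x ∈ dyadicPrimes b → a = b := by
    intro a b x ha hb
    rw [mem_dyadicPrimes] at ha hb
    have h1 : a < b + 1 := (Nat.pow_lt_pow_iff_right (by norm_num)).1 (ha.1.1.trans_lt hb.1.2)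
    have h2 : b < a + 1 := (Nat.pow_lt_pow_iff_right (by norm_num)).1 (hb.1.1.trans_lt ha.1.2)
    omega
  have key : ∀ {i j i' j' m m' p p' r r' : ℕ}, p ∈ dyadicPrimes i → p' ∈ dyadicPrimes i' →
      r' ∈ dyadicPrimes j' → j' < i' → m' ∈ Nat.smoothNumbers (2 ^ j') →
      p * r * m = p' * r' * m' → p ≤ p' := by
    intro i j i' j' m m' p p' r r' hp hp' hr' hji' hm' h
    rw [mem_dyadicPrimes] at hp hp' hr'
    have h1 : 2 ^ (j' + 1) ≤ 2 ^ i' := Nat.pow_le_pow_right (by norm_num) hji'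
    have h2 : 2 ^ j' ≤ 2 ^ (j' + 1) := Nat.pow_le_pow_right (by norm_num) (Nat.le_succ _)
    have hd : p ∣ p' * r' * m' := by rw [← h, mul_assoc]; exact dvd_mul_right _ _
    rw [hp.2.dvd_mul, hp.2.dvd_mul, Nat.prime_dvd_prime_iff_eq hp.2 hp'.2,
      Nat.prime_dvd_prime_iff_eq hp.2 hr'.2] at hd
    rcases hd with (hd | hd) | hd
    · omega
    · omega
    · have := Nat.mem_smoothNumbers'.1 hm' p hp.2 hd
      omega
  have key2 : ∀ {j j' m m' r r' : ℕ}, r ∈ dyadicPrimes j → r' ∈ dyadicPrimes j' →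
      m' ∈ Nat.smoothNumbers (2 ^ j') → r * m = r' * m' → r ≤ r' := by
    intro j j' m m' r r' hr hr' hm' h
    rw [mem_dyadicPrimes] at hr hr'
    have hd : r ∣ r' * m' := by rw [← h]; exact dvd_mul_right _ _
    rw [hr.2.dvd_mul, Nat.prime_dvd_prime_iff_eq hr.2 hr'.2] at hd
    rcases hd with hd | hd
    · omega
    · have := Nat.mem_smoothNumbers'.1 hm' r hr.2 hd
      omega
  have hpp : p = p' := le_antisymm (key (j := j) hp hp' hr' hji' hm' h)
    (key (j := j') hp' hp hr hji hm h.symm)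
  subst hpp
  have hp0 : 0 < p := (mem_dyadicPrimes.1 hp).2.pos
  rw [mul_assoc, mul_assoc] at h
  have h := Nat.eq_of_mul_eq_mul_left hp0 h
  have hrr : r = r' := le_antisymm (key2 hr hr' hm' h) (key2 hr' hr hm h.symm)
  subst hrr
  exact ⟨hcls hp hp', hcls hr hr',
    Nat.eq_of_mul_eq_mul_left (mem_dyadicPrimes.1 hr).2.pos h, rfl, rfl⟩

/-- The `2 ^ J`-smooth numbers below `q`. -/
noncomputable def smoothBelow (q J : ℕ) : Finset ℕ :=
  (Finset.Ico 1 q).filter fun m => m ∈ Nat.smoothNumbers (2 ^ J)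

lemma mem_smoothBelow {q J m : ℕ} :
    m ∈ smoothBelow q J ↔ m < q ∧ m ∈ Nat.smoothNumbers (2 ^ J) := by
  rw [smoothBelow, Finset.mem_filter, Finset.mem_Ico]
  refine ⟨fun h => ⟨h.1.2, h.2⟩, fun h => ⟨⟨?_, h.1⟩, h.2⟩⟩
  exact Nat.one_le_iff_ne_zero.2 (Nat.ne_zero_of_mem_smoothNumbers h.2)

lemma sum_inv_smoothBelow_le (q : ℕ) {J : ℕ} (hJ : 1 ≤ J) :
    ∑ m ∈ smoothBelow q J, (1 : ℝ) / m ≤ Real.exp 7 * J :=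
  sum_inv_smoothNumbers_le J hJ _ fun _ hm => (mem_smoothBelow.1 hm).2

/-- Indices `((i, j), m)` such that `p * r * m` is counted for all primes `p`, `r` in the
`i`-th and `j`-th dyadic blocks. -/
noncomputable def goodIndices (q N J₀ : ℕ) (bad : Finset ℕ) : Finset ((ℕ × ℕ) × ℕ) :=
  ((Finset.range N ×ˢ Finset.range N) ×ˢ Finset.Ico 1 q).filter fun t =>
    t.1.1 ∉ bad ∧ J₀ ≤ t.1.2 ∧ t.1.2 < t.1.1 ∧ t.2 ∈ Nat.smoothNumbers (2 ^ t.1.2) ∧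
      4 * 2 ^ (t.1.1 + t.1.2) * t.2 ≤ q

lemma mem_goodIndices {q N J₀ : ℕ} {bad : Finset ℕ} {t : (ℕ × ℕ) × ℕ} :
    t ∈ goodIndices q N J₀ bad ↔ (t.1.1 < N ∧ t.1.2 < N) ∧ (1 ≤ t.2 ∧ t.2 < q) ∧
      t.1.1 ∉ bad ∧ J₀ ≤ t.1.2 ∧ t.1.2 < t.1.1 ∧ t.2 ∈ Nat.smoothNumbers (2 ^ t.1.2) ∧
      4 * 2 ^ (t.1.1 + t.1.2) * t.2 ≤ q := by
  simp [goodIndices, and_assoc]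

/-- The numbers `p * r * m` covered by the good indices. -/
noncomputable def goodNumbers (q N J₀ : ℕ) (bad : Finset ℕ) : Finset ℕ :=
  ((goodIndices q N J₀ bad).sigma fun t => dyadicPrimes t.1.1 ×ˢ dyadicPrimes t.1.2).image
    fun x => x.2.1 * x.2.2 * x.1.2

lemma sum_goodNumbers {q N J₀ : ℕ} {bad : Finset ℕ} (F : ℕ → ℂ) :
    ∑ n ∈ goodNumbers q N J₀ bad, F n = ∑ t ∈ goodIndices q N J₀ bad,
      ∑ p ∈ dyadicPrimes t.1.1, ∑ r ∈ dyadicPrimes t.1.2, F (p * r * t.2) := by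
  rw [goodNumbers, Finset.sum_image, Finset.sum_sigma]
  · exact Finset.sum_congr rfl fun t _ => Finset.sum_product _ _ _
  · rintro ⟨⟨⟨i, j⟩, m⟩, p, r⟩ hx ⟨⟨⟨i', j'⟩, m'⟩, p', r'⟩ hx' h
    simp only [Finset.coe_sigma, Set.mem_sigma_iff, Finset.mem_coe, mem_goodIndices,
      Finset.mem_product] at hx hx' h
    obtain ⟨rfl, rfl, rfl, rfl, rfl⟩ := mul_mul_injective_of_dyadic hx.2.1 hx'.2.1 hx.2.2 hx'.2.2
      hx.1.2.2.2.2.1 hx'.1.2.2.2.2.1 hx.1.2.2.2.2.2.1 hx'.1.2.2.2.2.2.1 h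
    rfl

lemma goodNumbers_subset {q N J₀ : ℕ} {bad : Finset ℕ} :
    goodNumbers q N J₀ bad ⊆ Finset.Ico 1 q := by
  intro n hn
  obtain ⟨⟨⟨⟨i, j⟩, m⟩, p, r⟩, hx, rfl⟩ := Finset.mem_image.1 hn
  simp only [Finset.mem_sigma, mem_goodIndices, Finset.mem_product, mem_dyadicPrimes] at hx ⊢
  obtain ⟨⟨-, ⟨hm, -⟩, -, -, -, -, hle⟩, hp, hr⟩ := hx
  rw [Finset.mem_Ico]
  have h1 : p * r < 2 ^ (i + 1) * 2 ^ (j + 1) :=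
    Nat.mul_lt_mul'' hp.1.2 hr.1.2
  refine ⟨Nat.mul_pos (Nat.mul_pos hp.2.pos hr.2.pos) hm, ?_⟩
  calc p * r * m < 2 ^ (i + 1) * 2 ^ (j + 1) * m := Nat.mul_lt_mul_of_pos_right h1 hm
    _ = 4 * 2 ^ (i + j) * m := by ring
    _ ≤ q := hle

lemma sum_inv_image₂_mul_le (A B : Finset ℕ) :
    ∑ n ∈ Finset.image₂ (· * ·) A B, (1 : ℝ) / n
      ≤ (∑ a ∈ A, (1 : ℝ) / a) * ∑ b ∈ B, (1 : ℝ) / b := by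
  refine (sum_inv_le_sum_mul _ {()} (fun _ => A) (fun _ => B) fun n hn => ?_).trans (by simp)
  obtain ⟨a, ha, b, hb, rfl⟩ := Finset.mem_image₂.1 hn
  exact ⟨(), by simp, a, ha, b, hb, rfl⟩

lemma sum_inv_dyadicPrimes_le' (j : ℕ) : ∑ p ∈ dyadicPrimes j, (1 : ℝ) / p ≤ 4 / j := by
  rcases Nat.eq_zero_or_pos j with rfl | hj
  · refine le_of_eq ?_
    rw [Finset.sum_eq_zero]
    · simp
    · intro p hp
      rw [mem_dyadicPrimes] at hp
      have := hp.2.two_le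
      omega
  · exact sum_inv_dyadicPrimes_le j hj

lemma four_div_mul_succ_le (i : ℕ) : (4 / i : ℝ) * (i + 1) ≤ 8 := by
  rcases Nat.eq_zero_or_pos i with rfl | hi
  · simp
  · have : (1 : ℝ) ≤ i := by exact_mod_cast hi
    rw [div_mul_eq_mul_div, div_le_iff₀ (by linarith)]
    linarith

lemma sum_inv_le_of_div_four_lt {q : ℕ} (E : Finset ℕ) (hE : E ⊆ Finset.Ico 1 q)
    (h : ∀ n ∈ E, q < 4 * n) : ∑ n ∈ E, (1 : ℝ) / n ≤ 4 := by
  rcases Nat.eq_zero_or_pos q with rfl | hq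
  · have : E = ∅ := Finset.subset_empty.1 (by simpa using hE)
    simp [this]
  have hq' : (0 : ℝ) < q := by exact_mod_cast hq
  calc ∑ n ∈ E, (1 : ℝ) / n ≤ ∑ n ∈ E, 4 / (q : ℝ) := by
        refine Finset.sum_le_sum fun n hn => ?_
        have h1 : (q : ℝ) < 4 * n := by exact_mod_cast h n hn
        rw [div_le_div_iff₀ (by linarith) hq']
        linarith
    _ = E.card * (4 / (q : ℝ)) := by rw [Finset.sum_const, nsmul_eq_mul]
    _ ≤ q * (4 / (q : ℝ)) := by
        gcongr
        exact (Finset.card_le_card hE).trans (by simp)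
    _ = 4 := by field_simp

lemma sum_inv_le_add (E : Finset ℕ) (P : ℕ → Prop) {a b : ℝ}
    (ha : ∀ E' ⊆ E, (∀ n ∈ E', P n) → ∑ n ∈ E', (1 : ℝ) / n ≤ a)
    (hb : ∀ E' ⊆ E, (∀ n ∈ E', ¬ P n) → ∑ n ∈ E', (1 : ℝ) / n ≤ b) :
    ∑ n ∈ E, (1 : ℝ) / n ≤ a + b := by
  rw [← Finset.sum_filter_add_sum_filter_not E P]
  exact add_le_add (ha _ (Finset.filter_subset _ _) fun n hn => (Finset.mem_filter.1 hn).2)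
    (hb _ (Finset.filter_subset _ _) fun n hn => (Finset.mem_filter.1 hn).2)

/-- The numbers below `q` that are not covered by the good indices have a small logarithmic mass. -/
lemma sum_inv_not_goodNumbers_le {q N J₀ : ℕ} {bad : Finset ℕ} (hqN : q ≤ 2 ^ N) (hJ₀ : 1 ≤ J₀)
    {H : ℝ} (hH : ∑ i ∈ Finset.range N, (1 : ℝ) / i ≤ H) :
    ∑ n ∈ Finset.Ico 1 q \ goodNumbers q N J₀ bad, (1 : ℝ) / n
      ≤ 1 + (4 + (8 * Real.exp 7 * bad.card + (4 * Real.exp 7 * (H * J₀)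
        + (32 * Real.exp 7 * H + 128 * Real.exp 7 * H ^ 2)))) := by
  set E := Finset.Ico 1 q \ goodNumbers q N J₀ bad with hE
  have hE1 : ∀ n ∈ E, 1 ≤ n ∧ n < q := fun n hn => Finset.mem_Ico.1 (Finset.mem_sdiff.1 hn).1
  have hD := sum_inv_dyadicPrimes_le'
  have hS : ∀ i, ∑ m ∈ smoothBelow q (i + 1), (1 : ℝ) / m ≤ Real.exp 7 * (i + 1) := fun i => by
    have := sum_inv_smoothBelow_le q (J := i + 1) (by omega)
    push_cast at this
    exact this
  have hDn : ∀ i, 0 ≤ ∑ p ∈ dyadicPrimes i, (1 : ℝ) / p := fun i => by positivity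
  have hH0 : 0 ≤ ∑ i ∈ Finset.range N, (1 : ℝ) / i := by positivity
  have hIco : ∀ f : ℕ → ℝ, (∀ i, 0 ≤ f i) →
      ∑ i ∈ Finset.Ico J₀ N, f i ≤ ∑ i ∈ Finset.range N, f i := fun f hf =>
    Finset.sum_le_sum_of_subset_of_nonneg
      (fun i hi => Finset.mem_range.2 (Finset.mem_Ico.1 hi).2) fun i _ _ => hf i
  refine sum_inv_le_add E (fun n => n = 1) (fun A hA hAP => ?_) fun E₁ hE₁ hn1 => ?_
  · refine (Finset.sum_le_sum_of_subset_of_nonneg (t := {1}) ?_ fun _ _ _ => by positivity).trans ?_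
    · intro n hn; simpa using hAP n hn
    · simp
  refine sum_inv_le_add E₁ (fun n => q < 4 * n) (fun A hA hAP => ?_) fun E₂ hE₂ hn2 => ?_
  · exact sum_inv_le_of_div_four_lt _ (hA.trans (hE₁.trans Finset.sdiff_subset)) hAP
  refine sum_inv_le_add E₂ (fun n => ∃ i ∈ bad, ∃ p ∈ dyadicPrimes i,
    ∃ m ∈ smoothBelow q (i + 1), p * m = n) (fun A hA hAP => ?_) fun E₃ hE₃ hn3 => ?_
  · refine (sum_inv_le_sum_mul _ _ _ _ hAP).trans ?_
    calc _ ≤ ∑ i ∈ bad, 8 * Real.exp 7 := by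
          refine Finset.sum_le_sum fun i _ => ?_
          calc _ ≤ 4 / (i : ℝ) * (Real.exp 7 * (i + 1)) :=
                mul_le_mul (hD i) (hS i) (by positivity) (by positivity)
            _ = 4 / (i : ℝ) * (i + 1) * Real.exp 7 := by ring
            _ ≤ _ := by gcongr; exact four_div_mul_succ_le i
      _ = _ := by rw [Finset.sum_const, nsmul_eq_mul]; ring
  refine sum_inv_le_add E₃ (fun n => ∃ i ∈ Finset.range N, ∃ p ∈ dyadicPrimes i,
    ∃ m ∈ smoothBelow q J₀, p * m = n) (fun A hA hAP => ?_) fun E₄ hE₄ hn4 => ?_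
  · refine (sum_inv_le_sum_mul _ _ _ _ hAP).trans ?_
    calc _ ≤ ∑ i ∈ Finset.range N, 4 * Real.exp 7 * J₀ * (1 / (i : ℝ)) := by
          refine Finset.sum_le_sum fun i _ => ?_
          calc _ ≤ 4 / (i : ℝ) * (Real.exp 7 * J₀) :=
                mul_le_mul (hD i) (sum_inv_smoothBelow_le q hJ₀) (by positivity) (by positivity)
            _ = _ := by ring
      _ = 4 * Real.exp 7 * J₀ * ∑ i ∈ Finset.range N, 1 / (i : ℝ) := by rw [Finset.mul_sum]
      _ ≤ 4 * Real.exp 7 * J₀ * H := by gcongr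
      _ = _ := by ring
  refine sum_inv_le_add E₄ (fun n => ∃ i ∈ Finset.Ico J₀ N,
    ∃ a ∈ Finset.image₂ (· * ·) (dyadicPrimes i) (dyadicPrimes i),
      ∃ m ∈ smoothBelow q (i + 1), a * m = n) (fun A hA hAP => ?_) fun E₅ hE₅ hn5 => ?_
  · refine (sum_inv_le_sum_mul _ _ _ _ hAP).trans ?_
    calc _ ≤ ∑ i ∈ Finset.Ico J₀ N, 32 * Real.exp 7 * (1 / (i : ℝ)) := by
          refine Finset.sum_le_sum fun i _ => ?_
          calc _ ≤ 4 / (i : ℝ) * (4 / i) * (Real.exp 7 * (i + 1)) :=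
                mul_le_mul ((sum_inv_image₂_mul_le _ _).trans (mul_le_mul (hD i) (hD i) (hDn i)
                  (by positivity))) (hS i) (by positivity) (by positivity)
            _ = 4 / (i : ℝ) * (i + 1) * (4 / i * Real.exp 7) := by ring
            _ ≤ 8 * (4 / i * Real.exp 7) := by gcongr; exact four_div_mul_succ_le i
            _ = _ := by ring
      _ ≤ ∑ i ∈ Finset.range N, 32 * Real.exp 7 * (1 / (i : ℝ)) :=
          hIco _ fun i => by positivity
      _ = 32 * Real.exp 7 * ∑ i ∈ Finset.range N, 1 / (i : ℝ) := by rw [Finset.mul_sum]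
      _ ≤ _ := by gcongr
  refine (sum_inv_le_sum_mul _ (Finset.range N ×ˢ Finset.Ico J₀ N)
    (fun x => Finset.image₂ (· * ·) (dyadicPrimes x.1)
      (Finset.image₂ (· * ·) (dyadicPrimes x.2) (dyadicPrimes x.2)))
    (fun x => smoothBelow q (x.2 + 1)) fun n hn => ?_).trans ?_
  · have h4 := hE₅ hn
    have h3 := hE₄ h4
    have h2 := hE₃ h3
    have h1 := hE₂ h2
    have hnE := hE₁ h1
    have hn1 := hn1 n h1
    have hn2 := hn2 n h2
    have hn3 := hn3 n h3
    have hn4 := hn4 n h4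
    have hn5 := hn5 n hn
    have hnq := hE1 n hnE
    have hgood := (Finset.mem_sdiff.1 hnE).2
    have hdvd : ∀ {a b : ℕ}, a * b = n → b < q := by
      intro a b hab
      exact (Nat.le_of_dvd (by omega) ⟨a, by rw [← hab, mul_comm]⟩).trans_lt hnq.2
    have hnN : n ∈ Nat.smoothNumbers (2 ^ N) := by
      rw [Nat.mem_smoothNumbers']
      intro p _ hp
      have := Nat.le_of_dvd (by omega) hp
      omega
    have hn0 : n ∉ Nat.smoothNumbers (2 ^ 0) := by
      simp only [pow_zero, Nat.smoothNumbers_one, Set.mem_singleton_iff]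
      exact hn1
    obtain ⟨i, -, hiN, p, hp, m, hm, hpm⟩ := exists_max_prime_factor hnN hn0
    have hi : i ∉ bad := fun hi => hn3 ⟨i, hi, p, hp, m, mem_smoothBelow.2 ⟨hdvd hpm, hm⟩, hpm⟩
    have hm₀ : m ∉ Nat.smoothNumbers (2 ^ J₀) := fun h =>
      hn4 ⟨i, Finset.mem_range.2 hiN, p, hp, m, mem_smoothBelow.2 ⟨hdvd hpm, h⟩, hpm⟩
    obtain ⟨j, hj₀, hji, r, hr, m₂, hm₂, hrm⟩ := exists_max_prime_factor hm hm₀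
    have hprm : p * r * m₂ = n := by rw [mul_assoc, hrm, hpm]
    have hij : j ≠ i := by
      rintro rfl
      exact hn5 ⟨j, Finset.mem_Ico.2 ⟨hj₀, hiN⟩, p * r, Finset.mem_image₂_of_mem hp hr, m₂,
        mem_smoothBelow.2 ⟨hdvd hprm, hm₂⟩, hprm⟩
    have hji' : j < i := by omega
    have hm₂j : m₂ ∉ Nat.smoothNumbers (2 ^ j) := by
      intro h
      refine hgood (Finset.mem_image.2 ⟨⟨⟨⟨i, j⟩, m₂⟩, p, r⟩, ?_, hprm⟩)
      simp only [Finset.mem_sigma, Finset.mem_product, mem_goodIndices]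
      refine ⟨⟨⟨hiN, by omega⟩, ⟨?_, hdvd hprm⟩, hi, hj₀, hji', h, ?_⟩, hp, hr⟩
      · exact Nat.one_le_iff_ne_zero.2 (Nat.ne_zero_of_mem_smoothNumbers h)
      · have h1 : 2 ^ i * 2 ^ j * m₂ ≤ p * r * m₂ := Nat.mul_le_mul_right _
          (Nat.mul_le_mul (mem_dyadicPrimes.1 hp).1.1 (mem_dyadicPrimes.1 hr).1.1)
        rw [pow_add, mul_assoc]
        omega
    obtain ⟨j', hj', hjj', s, hs, m₃, hm₃, hsm⟩ := exists_max_prime_factor hm₂ hm₂j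
    obtain rfl : j' = j := by omega
    have h2 : p * (r * s) * m₃ = n := by rw [← hprm, ← hsm]; ring
    exact ⟨(i, j'), Finset.mem_product.2 ⟨Finset.mem_range.2 hiN, Finset.mem_Ico.2 ⟨hj₀, by omega⟩⟩,
      p * (r * s), Finset.mem_image₂_of_mem hp (Finset.mem_image₂_of_mem hr hs), m₃,
      mem_smoothBelow.2 ⟨hdvd h2, hm₃⟩, h2⟩
  · calc _ ≤ ∑ x ∈ Finset.range N ×ˢ Finset.Ico J₀ N,
            128 * Real.exp 7 * (1 / (x.1 : ℝ) * (1 / (x.2 : ℝ))) := by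
          refine Finset.sum_le_sum fun x _ => ?_
          calc _ ≤ 4 / (x.1 : ℝ) * (4 / x.2 * (4 / x.2)) * (Real.exp 7 * (x.2 + 1)) := by
                refine mul_le_mul ((sum_inv_image₂_mul_le _ _).trans
                  (mul_le_mul (hD _) ((sum_inv_image₂_mul_le _ _).trans
                    (mul_le_mul (hD _) (hD _) (hDn _) (by positivity))) (by positivity)
                      (by positivity))) (hS _) (by positivity) (by positivity)
            _ = 4 / (x.2 : ℝ) * (x.2 + 1) * (16 / x.1 * (1 / x.2) * Real.exp 7) := by ring
            _ ≤ 8 * (16 / x.1 * (1 / x.2) * Real.exp 7) := by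
                gcongr; exact four_div_mul_succ_le x.2
            _ = _ := by ring
      _ = 128 * Real.exp 7 * ((∑ i ∈ Finset.range N, 1 / (i : ℝ))
            * ∑ j ∈ Finset.Ico J₀ N, 1 / (j : ℝ)) := by
          rw [← Finset.mul_sum, Finset.sum_mul_sum, ← Finset.sum_product']
      _ ≤ 128 * Real.exp 7 * (H * H) := by
          gcongr
          · exact hH0.trans hH
          · exact (hIco _ fun i => by positivity).trans hH
      _ = _ := by ring

lemma sum_inv_range_le (N : ℕ) : ∑ i ∈ Finset.range N, (1:ℝ) / i ≤ 1 + Real.log N := by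
  rcases Nat.eq_zero_or_pos N with rfl | hN
  · simp
  have h := harmonic_le_one_add_log (N - 1)
  have h1 : ((harmonic (N - 1) : ℚ) : ℝ) = ∑ i ∈ Finset.range N, (1:ℝ) / i := by
    obtain ⟨M, rfl⟩ : ∃ M, N = M + 1 := ⟨N - 1, by omega⟩
    rw [Finset.sum_range_succ']
    simp [harmonic]
  rw [← h1]
  refine h.trans ?_
  rcases Nat.eq_zero_or_pos (N - 1) with h0 | h0
  · rw [h0]
    have : 0 ≤ Real.log N := Real.log_natCast_nonneg N
    simpa using this
  · gcongr
    omega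

lemma sum_inv_Ico_le (N : ℕ) : ∑ i ∈ Finset.Ico 1 N, (1:ℝ) / i ≤ 1 + Real.log N := by
  refine le_trans ?_ (sum_inv_range_le N)
  refine Finset.sum_le_sum_of_subset_of_nonneg ?_ fun i _ _ => by positivity
  intro i hi
  simp only [Finset.mem_Ico, Finset.mem_range] at hi ⊢
  omega

lemma card_le_of_sub_le {S : Finset ℕ} {D : ℝ} (hD : 0 ≤ D)
    (h : ∀ i ∈ S, ∀ j ∈ S, (j:ℝ) - i ≤ D) : (S.card : ℝ) ≤ D + 1 := by
  rcases S.eq_empty_or_nonempty with rfl | hS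
  · simp; linarith
  have hsub : S ⊆ Finset.Icc (S.min' hS) (S.max' hS) := fun i hi =>
    Finset.mem_Icc.2 ⟨S.min'_le i hi, S.le_max' i hi⟩
  have h1 := Finset.card_le_card hsub
  rw [Nat.card_Icc] at h1
  have h2 := S.min'_le _ (S.max'_mem hS)
  have h3 := h _ (S.min'_mem hS) _ (S.max'_mem hS)
  have h4 : (S.card : ℝ) + S.min' hS ≤ S.max' hS + 1 := by
    exact_mod_cast (by omega : S.card + S.min' hS ≤ S.max' hS + 1)
  linarith

/-- The dyadic indices excluded from the energy estimate. -/
noncomputable def unluckyIndices (N : ℕ) (L Λ ℓ : ℝ) : Finset ℕ :=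
  (Finset.Icc 1 ⌊2 * Λ⌋₊).biUnion fun k =>
    (Finset.range N).filter fun i : ℕ => |2 * k * i * Real.log 2 - L| < 192 * k * Λ * ℓ

lemma card_unluckyIndices_le (N : ℕ) {L Λ ℓ : ℝ} (hΛ : 2 ≤ Λ) (hℓ : 2 ≤ ℓ) :
    ((unluckyIndices N L Λ ℓ).card : ℝ) ≤ 600 * (Λ ^ 2 * ℓ) := by
  have hpos : 0 ≤ Λ * ℓ := by positivity
  have key : ∀ k ∈ Finset.Icc 1 ⌊2 * Λ⌋₊, (((Finset.range N).filter fun i : ℕ =>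
      |2 * k * i * Real.log 2 - L| < 192 * k * Λ * ℓ).card : ℝ) ≤ 278 * (Λ * ℓ) + 1 := by
    intro k hk
    have hk1 : (1:ℝ) ≤ k := by exact_mod_cast (Finset.mem_Icc.1 hk).1
    refine card_le_of_sub_le (by positivity) fun i hi j hj => ?_
    have hi' := abs_lt.1 (Finset.mem_filter.1 hi).2
    have hj' := abs_lt.1 (Finset.mem_filter.1 hj).2
    by_contra! hcon
    have hlog : 0.6931 < Real.log 2 := by
      have := Real.log_two_gt_d9; norm_num at this ⊢; linarith
    have h1 : (k:ℝ) * (2 * ((j:ℝ) - i) * Real.log 2) < k * (384 * (Λ * ℓ)) := by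
      nlinarith [hi'.1, hj'.2]
    have h2 := lt_of_mul_lt_mul_left h1 (by linarith)
    have h3 : 278 * (Λ * ℓ) * 0.6931 ≤ ((j:ℝ) - i) * Real.log 2 := by
      apply mul_le_mul hcon.le hlog.le (by norm_num) (by linarith)
    norm_num at h3
    nlinarith
  have h1 : ((unluckyIndices N L Λ ℓ).card : ℝ) ≤
      ∑ k ∈ Finset.Icc 1 ⌊2 * Λ⌋₊, (278 * (Λ * ℓ) + 1) := by
    refine le_trans ?_ (Finset.sum_le_sum key)
    rw [← Nat.cast_sum]
    exact Nat.cast_le.2 Finset.card_biUnion_le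
  rw [Finset.sum_const, Nat.card_Icc, nsmul_eq_mul] at h1
  have h2 : ((⌊2 * Λ⌋₊ + 1 - 1 : ℕ) : ℝ) ≤ 2 * Λ := by
    rw [Nat.add_sub_cancel]; exact Nat.floor_le (by linarith)
  have h3 : ((⌊2 * Λ⌋₊ + 1 - 1 : ℕ) : ℝ) * (278 * (Λ * ℓ) + 1) ≤ 2 * Λ * (278 * (Λ * ℓ) + 1) :=
    mul_le_mul_of_nonneg_right h2 (by positivity)
  have h4 : Λ * 4 ≤ Λ * (Λ * ℓ) := by gcongr; nlinarith
  nlinarith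

lemma norm_sum_goodNumbers_le {q N J₀ : ℕ} [Fact q.Prime] {L Λ ℓ : ℝ}
    (hLq : Real.exp L = q) (hL : Λ ^ 3 = L) (hℓL : Real.exp ℓ = L) (hΛ : 2 ≤ Λ) (hℓ : 2 ≤ ℓ)
    (hlarge : 96 * Λ * ℓ ≤ L) (hN : (N:ℝ) ≤ 3 * L) (hJ₀ : Λ ^ 2 ≤ J₀) {h : ZMod q} (hh : h ≠ 0) :
    ‖∑ n ∈ goodNumbers q N J₀ (unluckyIndices N L Λ ℓ),
      (ZMod.stdAddChar (h * (n : ZMod q)⁻¹) : ℂ) / n‖ ≤ 18 := by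
  have hL8 : 8 ≤ L := by nlinarith [pow_le_pow_left₀ (by norm_num) hΛ 3]
  have hlogq : Real.log q = L := by rw [← hLq, Real.log_exp]
  rw [sum_goodNumbers]
  have key : ∀ t ∈ goodIndices q N J₀ (unluckyIndices N L Λ ℓ),
      ‖∑ p ∈ dyadicPrimes t.1.1, ∑ r ∈ dyadicPrimes t.1.2,
        (ZMod.stdAddChar (h * ((p * r * t.2 : ℕ) : ZMod q)⁻¹) : ℂ) / ((p * r * t.2 : ℕ) : ℂ)‖ ≤
      Real.exp (-(3 * ℓ)) * (1 / (t.2 : ℝ)) := by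
    rintro ⟨⟨i, j⟩, m⟩ ht
    rw [mem_goodIndices] at ht
    obtain ⟨⟨hiN, hjN⟩, ⟨hm1, hmq⟩, hbad, hJj, hji, -, hsz⟩ := ht
    dsimp only at *
    have hm0 : (m : ZMod q) ≠ 0 := by
      rw [Ne, ZMod.natCast_eq_zero_iff]
      intro hd
      exact absurd (Nat.le_of_dvd (by omega) hd) (by omega)
    have heq : ∑ p ∈ dyadicPrimes i, ∑ r ∈ dyadicPrimes j,
        (ZMod.stdAddChar (h * ((p * r * m : ℕ) : ZMod q)⁻¹) : ℂ) / ((p * r * m : ℕ) : ℂ) =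
        primePairSum q i j (h * (m : ZMod q)⁻¹) * (1 / (m : ℂ)) := by
      rw [primePairSum, Finset.sum_mul]
      refine Finset.sum_congr rfl fun p _ => ?_
      rw [Finset.sum_mul]
      refine Finset.sum_congr rfl fun r _ => ?_
      have : h * ((p * r * m : ℕ) : ZMod q)⁻¹ =
          h * (m : ZMod q)⁻¹ * ((p : ZMod q)⁻¹ * (r : ZMod q)⁻¹) := by
        push_cast
        rw [mul_inv, mul_inv]; ring
      rw [this]
      push_cast
      rw [div_mul_div_comm, mul_one]
    rw [heq, norm_mul]
    have hn : ‖(1 / (m:ℂ))‖ = 1 / (m:ℝ) := by simp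
    rw [hn]
    refine mul_le_mul_of_nonneg_right ?_ (by positivity)
    have hij : (j : ℝ) ≤ i := by exact_mod_cast hji.le
    have hJj' : (J₀ : ℝ) ≤ j := by exact_mod_cast hJj
    have hpi : 1 ≤ 2 ^ i := Nat.one_le_two_pow
    have hpj : 1 ≤ 2 ^ j := Nat.one_le_two_pow
    have hsz' : 4 * (2 ^ i * 2 ^ j) ≤ q := by
      rw [pow_add] at hsz
      exact le_trans (Nat.le_mul_of_pos_right _ (by omega)) hsz
    refine norm_primePairSum_le hLq hL hℓL hΛ hℓ hlarge (by linarith) (by linarith) ?_ ?_ ?_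
      (mul_ne_zero hh (inv_ne_zero hm0))
    · rw [pow_succ]; nlinarith
    · rw [pow_succ]; nlinarith
    · intro k hk1 hk2
      by_contra! hcon
      refine hbad (Finset.mem_biUnion.2 ⟨k, Finset.mem_Icc.2 ⟨hk1, Nat.le_floor hk2⟩, ?_⟩)
      exact Finset.mem_filter.2 ⟨Finset.mem_range.2 hiN, hcon⟩
  refine (norm_sum_le _ _).trans ((Finset.sum_le_sum key).trans ?_)
  have hsub : goodIndices q N J₀ (unluckyIndices N L Λ ℓ) ⊆
      (Finset.range N ×ˢ Finset.range N) ×ˢ Finset.Ico 1 q := by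
    rintro ⟨⟨i, j⟩, m⟩ ht
    rw [mem_goodIndices] at ht
    simp only [Finset.mem_product, Finset.mem_range, Finset.mem_Ico]
    exact ⟨ht.1, ht.2.1⟩
  refine (Finset.sum_le_sum_of_subset_of_nonneg hsub fun t _ _ => by positivity).trans ?_
  rw [Finset.sum_product]
  simp only [← Finset.mul_sum]
  rw [Finset.sum_const, Finset.card_product, Finset.card_range, nsmul_eq_mul]
  have h1 := sum_inv_Ico_le q
  rw [hlogq] at h1
  have h2 : Real.exp (-(3 * ℓ)) = (L ^ 3)⁻¹ := by
    rw [Real.exp_neg, ← hℓL, ← Real.exp_nat_mul]; norm_num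
  rw [h2]
  have h3 : (((N * N : ℕ)) : ℝ) ≤ 9 * L ^ 2 := by push_cast; nlinarith [Nat.cast_nonneg (α := ℝ) N]
  calc (L ^ 3)⁻¹ * (((N * N : ℕ) : ℝ) * ∑ i ∈ Finset.Ico 1 q, 1 / (i:ℝ))
      ≤ (L ^ 3)⁻¹ * ((9 * L ^ 2) * (2 * L)) := by
        gcongr
        linarith
    _ = 18 := by field_simp; norm_num

lemma error_terms_le {L Λ ℓ E J B : ℝ} (hL : Λ ^ 3 = L) (hΛ : 2 ≤ Λ) (hℓ : 2 ≤ ℓ)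
    (hlarge : 96 * Λ * ℓ ≤ L) (hE0 : 0 < E) (hJ : J ≤ 2 * Λ ^ 2) (hcard : B ≤ 600 * (Λ ^ 2 * ℓ)) :
    18 + (1 + (4 + (8 * E * B + (4 * E * ((2 * ℓ + 2) * J) +
      (32 * E * (2 * ℓ + 2) + 128 * E * (2 * ℓ + 2) ^ 2))))) ≤
      (23 + 6500 * E) * (Λ ^ 2 * ℓ) := by
  have hℓΛ : 96 * ℓ ≤ Λ ^ 2 := by
    have : Λ * (96 * ℓ) ≤ Λ * Λ ^ 2 := by rw [← hL] at hlarge; nlinarith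
    exact le_of_mul_le_mul_left this (by linarith)
  set X := Λ ^ 2 * ℓ with hX
  have hX1 : 1 ≤ X := by nlinarith
  have e1 : (2 * ℓ + 2) ≤ 3 * ℓ := by linarith
  have e2 : (2 * ℓ + 2) * J ≤ 6 * X := by
    have : (2 * ℓ + 2) * J ≤ (3 * ℓ) * (2 * Λ ^ 2) :=
      (mul_le_mul_of_nonneg_left hJ (by linarith)).trans (by gcongr)
    rw [hX]; linarith
  have e3 : (2 * ℓ + 2) ≤ X := by rw [hX]; nlinarith
  have e4 : (2 * ℓ + 2) ^ 2 ≤ X := by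
    have : (2 * ℓ + 2) ^ 2 ≤ (3 * ℓ) ^ 2 := by gcongr
    rw [hX]; nlinarith
  have f1 : 8 * E * B ≤ 8 * E * (600 * X) := by gcongr
  have f2 : 4 * E * ((2 * ℓ + 2) * J) ≤ 4 * E * (6 * X) := by gcongr
  have f3 : 32 * E * (2 * ℓ + 2) ≤ 32 * E * X := by gcongr
  have f4 : 128 * E * (2 * ℓ + 2) ^ 2 ≤ 128 * E * X := by gcongr
  have f5 : 0 ≤ E * X := by positivity
  linarith

lemma norm_sum_stdAddChar_inv_le_of_large {q : ℕ} [Fact q.Prime] {L Λ ℓ : ℝ}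
    (hLq : Real.exp L = q) (hL : Λ ^ 3 = L) (hℓL : Real.exp ℓ = L) (hΛ : 2 ≤ Λ) (hℓ : 2 ≤ ℓ)
    (hlarge : 96 * Λ * ℓ ≤ L) {h : ZMod q} (hh : h ≠ 0) :
    ‖∑ n ∈ Finset.Ico 1 q, (ZMod.stdAddChar (h * (n : ZMod q)⁻¹) : ℂ) / n‖ ≤
      (23 + 6500 * Real.exp 7) * (Λ ^ 2 * ℓ) := by
  have hL8 : 8 ≤ L := by nlinarith [pow_le_pow_left₀ (by norm_num) hΛ 3]
  have hlogq : Real.log q = L := by rw [← hLq, Real.log_exp]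
  have hlogL : Real.log L = ℓ := by rw [← hℓL, Real.log_exp]
  have hq1 : 1 < q := (Fact.out : q.Prime).one_lt
  obtain ⟨N, hqN, hN, hN0⟩ : ∃ N : ℕ, q ≤ 2 ^ N ∧ (N:ℝ) ≤ 3 * L ∧ (0:ℝ) < N := by
    refine ⟨Nat.log 2 q + 1, (Nat.lt_pow_succ_log_self (by norm_num) q).le, ?_, by positivity⟩
    have h1 : (2:ℝ) ^ (Nat.log 2 q) ≤ q := by
      exact_mod_cast Nat.pow_log_le_self 2 (by omega)
    have h2 := Real.log_le_log (by positivity) h1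
    rw [Real.log_pow, hlogq] at h2
    have h3 := Real.log_two_gt_d9
    push_cast
    nlinarith [Nat.cast_nonneg (α := ℝ) (Nat.log 2 q)]
  obtain ⟨J₀, hJ₀, hJ₀', hJ1⟩ : ∃ J₀ : ℕ, Λ ^ 2 ≤ J₀ ∧ (J₀:ℝ) ≤ 2 * Λ ^ 2 ∧ 1 ≤ J₀ := by
    refine ⟨⌈Λ ^ 2⌉₊, Nat.le_ceil _, ?_, Nat.one_le_ceil_iff.2 (by positivity)⟩
    have := Nat.ceil_lt_add_one (a := Λ ^ 2) (by positivity)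
    nlinarith
  have hH : ∑ i ∈ Finset.range N, (1:ℝ) / i ≤ 2 * ℓ + 2 := by
    refine (sum_inv_range_le N).trans ?_
    have h1 := Real.log_le_log hN0 hN
    rw [Real.log_mul (by norm_num) (by positivity), hlogL] at h1
    have h3 : Real.log 3 ≤ 3 - 1 := Real.log_le_sub_one_of_pos (by norm_num)
    linarith
  have hgood := norm_sum_goodNumbers_le hLq hL hℓL hΛ hℓ hlarge hN hJ₀ hh
  have hcard := card_unluckyIndices_le N (L := L) hΛ hℓ
  generalize unluckyIndices N L Λ ℓ = bad at hgood hcard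
  have hnot := sum_inv_not_goodNumbers_le (bad := bad) hqN hJ1 hH
  rw [← Finset.sum_sdiff (goodNumbers_subset (q := q) (N := N) (J₀ := J₀) (bad := bad))]
  rw [add_comm]
  refine (norm_add_le _ _).trans ?_
  have hrest : ‖∑ n ∈ Finset.Ico 1 q \ goodNumbers q N J₀ bad,
      (ZMod.stdAddChar (h * (n : ZMod q)⁻¹) : ℂ) / n‖ ≤
      ∑ n ∈ Finset.Ico 1 q \ goodNumbers q N J₀ bad, (1:ℝ) / n := by
    refine (norm_sum_le _ _).trans (Finset.sum_le_sum fun n _ => ?_)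
    rw [norm_div, AddChar.norm_apply, Complex.norm_natCast]
  exact (add_le_add hgood (hrest.trans hnot)).trans
    (error_terms_le hL hΛ hℓ hlarge (Real.exp_pos 7) hJ₀' hcard)

lemma exp_one_le_log {q : ℕ} (hq : 17 ≤ q) : Real.exp 1 ≤ Real.log q := by
  have h1 : Real.log ((2:ℝ) ^ 4) ≤ Real.log q := by
    apply Real.log_le_log (by norm_num)
    exact_mod_cast (by omega : 2 ^ 4 ≤ q)
  rw [Real.log_pow] at h1
  have h2 := Real.log_two_gt_d9
  have h3 := Real.exp_one_lt_d9
  push_cast at h1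
  linarith

lemma one_le_log_log {q : ℕ} (hq : 17 ≤ q) : 1 ≤ Real.log (Real.log q) := by
  have h := exp_one_le_log hq
  exact (Real.le_log_iff_exp_le (lt_of_lt_of_le (Real.exp_pos 1) h)).2 h

/-- Exponential sums over inverses with harmonic weights have size `O((log q)^{2/3} log log q)`. -/
lemma exists_norm_sum_stdAddChar_inv_le : ∃ C : ℝ, 0 ≤ C ∧ ∀ q : ℕ, ∀ [Fact q.Prime], 17 ≤ q →
    ∀ h : ZMod q, h ≠ 0 →
    ‖∑ n ∈ Finset.Ico 1 q, (ZMod.stdAddChar (h * (n : ZMod q)⁻¹) : ℂ) / n‖ ≤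
      C * (Real.log q ^ ((2:ℝ) / 3) * Real.log (Real.log q)) := by
  refine ⟨23 + 6500 * Real.exp 7, by positivity, fun q _ hq h hh => ?_⟩
  have hL1 := exp_one_le_log hq
  have hℓ1 := one_le_log_log hq
  have hq0 : (0:ℝ) < q := by positivity
  set L := Real.log q with hLdef
  have hL2 : 2 < L := by linarith [Real.exp_one_gt_d9]
  set ℓ := Real.log L with hℓdef
  set Λ := L ^ ((1:ℝ) / 3) with hΛdef
  have hΛ2 : L ^ ((2:ℝ) / 3) = Λ ^ 2 := by
    rw [hΛdef, ← Real.rpow_natCast, ← Real.rpow_mul (by linarith)]; norm_num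
  have hΛ3 : Λ ^ 3 = L := by
    rw [hΛdef, ← Real.rpow_natCast, ← Real.rpow_mul (by linarith)]; norm_num
  have hΛ1 : 1 ≤ Λ := Real.one_le_rpow (by linarith) (by norm_num)
  rw [hΛ2]
  clear_value Λ
  clear hΛdef hΛ2
  have hLq : Real.exp L = q := Real.exp_log hq0
  have hℓL : Real.exp ℓ = L := Real.exp_log (by linarith)
  rcases le_total 288 Λ with hΛ | hΛ
  · have hℓΛ : ℓ ≤ 3 * Λ := by
      rw [hℓdef, ← hΛ3, Real.log_pow]
      have := Real.log_le_sub_one_of_pos (by linarith : 0 < Λ)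
      push_cast; linarith
    refine norm_sum_stdAddChar_inv_le_of_large hLq hΛ3 hℓL (by linarith) ?_ ?_ hh
    · rw [hℓdef, Real.le_log_iff_exp_le (by linarith)]
      have h1 : Real.exp 2 = Real.exp 1 * Real.exp 1 := by rw [← Real.exp_add]; norm_num
      have h2 := Real.exp_one_lt_d9
      have h3 : Real.exp 2 ≤ 9 := by
        rw [h1]; nlinarith [Real.exp_pos 1]
      nlinarith [pow_le_pow_left₀ (by norm_num) hΛ 3]
    · have : Λ * (96 * ℓ) ≤ Λ * Λ ^ 2 := by
        refine mul_le_mul_of_nonneg_left ?_ (by linarith)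
        nlinarith
      rw [← hΛ3]; nlinarith
  · have h1 : ‖∑ n ∈ Finset.Ico 1 q, (ZMod.stdAddChar (h * (n : ZMod q)⁻¹) : ℂ) / n‖ ≤ 1 + L := by
      refine le_trans ?_ (sum_inv_Ico_le q)
      refine (norm_sum_le _ _).trans (Finset.sum_le_sum fun n _ => ?_)
      rw [norm_div, AddChar.norm_apply, Complex.norm_natCast]
    have h2 : 1 ≤ Λ ^ 2 := one_le_pow₀ hΛ1
    have h3 : L ≤ 288 * Λ ^ 2 := by rw [← hΛ3]; nlinarith
    have h4 : Λ ^ 2 ≤ Λ ^ 2 * ℓ := le_mul_of_one_le_right (by positivity) hℓ1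
    have h5 : (1:ℝ) ≤ Real.exp 7 := Real.one_le_exp (by norm_num)
    have h6 : 1 * (Λ ^ 2 * ℓ) ≤ Real.exp 7 * (Λ ^ 2 * ℓ) := by gcongr
    nlinarith

/-- The sawtooth function on `ℤ/q`. -/
noncomputable def sawMod (q : ℕ) (a : ZMod q) : ℝ := saw ((a.val : ℝ) / q)

lemma sawMod_zero (q : ℕ) : sawMod q 0 = 0 := by simp [sawMod, saw]

lemma sawMod_of_ne {q : ℕ} [NeZero q] {a : ZMod q} (ha : a ≠ 0) :
    sawMod q a = (a.val : ℝ) / q - 1 / 2 := by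
  have hq : (0:ℝ) < q := by exact_mod_cast Nat.pos_of_ne_zero (NeZero.ne q)
  have h1 : Int.fract ((a.val : ℝ) / q) = (a.val : ℝ) / q := by
    rw [Int.fract_eq_self]
    refine ⟨by positivity, ?_⟩
    rw [div_lt_one hq]
    exact_mod_cast a.val_lt
  rw [sawMod, saw, h1, if_neg]
  have : 0 < a.val := by
    rw [Nat.pos_iff_ne_zero, Ne, ZMod.val_eq_zero]; exact ha
  positivity

lemma sawMod_neg {q : ℕ} [NeZero q] (a : ZMod q) : sawMod q (-a) = -sawMod q a := by
  rcases eq_or_ne a 0 with rfl | ha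
  · simp [sawMod_zero]
  have hq : (q:ℝ) ≠ 0 := by exact_mod_cast NeZero.ne q
  rw [sawMod_of_ne ha, sawMod_of_ne (neg_ne_zero.2 ha), ZMod.neg_val, if_neg ha,
    Nat.cast_sub a.val_lt.le, sub_div, div_self hq]
  ring

lemma sum_sawMod (q : ℕ) [NeZero q] : ∑ a : ZMod q, sawMod q a = 0 := by
  have h := Equiv.sum_comp (Equiv.neg (ZMod q)) (sawMod q)
  simp only [Equiv.neg_apply, sawMod_neg, Finset.sum_neg_distrib] at h
  linarith

lemma sawMod_add_one_sub {q : ℕ} [Fact q.Prime] (a : ZMod q) :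
    sawMod q (a + 1) - sawMod q a =
      1 / q - (if a = 0 then 1 / 2 else 0) - (if a = -1 then 1 / 2 else 0) := by
  have hq1 : 1 < q := (Fact.out : q.Prime).one_lt
  have hq : (q:ℝ) ≠ 0 := by exact_mod_cast NeZero.ne q
  have hval1 : (1 : ZMod q).val = 1 := ZMod.val_one q
  rcases eq_or_ne a (-1) with rfl | ha
  · rw [neg_add_cancel, sawMod_zero, sawMod_neg, sawMod_of_ne one_ne_zero, hval1]
    rw [if_neg (by simp), if_pos rfl]
    push_cast; ring
  · have h1 : a + 1 ≠ 0 := fun h => ha (eq_neg_of_add_eq_zero_left h)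
    have h2 : (a + 1).val = a.val + 1 := by
      have h3 : a.val + 1 < q := by
        refine lt_of_le_of_ne a.val_lt fun h4 => h1 ?_
        have : ((a.val + 1 : ℕ) : ZMod q) = 0 := by rw [h4]; simp
        simpa using this
      rw [ZMod.val_add_of_lt (by rw [hval1]; exact h3), hval1]
    rw [if_neg ha, sawMod_of_ne h1, h2]
    rcases eq_or_ne a 0 with rfl | h0
    · rw [sawMod_zero, if_pos rfl]; push_cast [ZMod.val_zero]; ring
    · rw [sawMod_of_ne h0, if_neg h0]; push_cast; ring

lemma sawMod_add_le {q : ℕ} [Fact q.Prime] (a : ZMod q) (t : ℕ) :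
    sawMod q (a + (t : ZMod q)) ≤ sawMod q a + t / q := by
  induction t with
  | zero => simp
  | succ t ih =>
    have h := sawMod_add_one_sub (a + (t : ZMod q))
    have h1 : (0:ℝ) ≤ if a + (t : ZMod q) = 0 then 1 / 2 else 0 := by split_ifs <;> norm_num
    have h2 : (0:ℝ) ≤ if a + (t : ZMod q) = -1 then 1 / 2 else 0 := by split_ifs <;> norm_num
    push_cast
    rw [← add_assoc, add_div]
    linarith

lemma sum_abs_sawMod_add_one_sub_le (q : ℕ) [Fact q.Prime] :
    ∑ a : ZMod q, |sawMod q (a + 1) - sawMod q a| ≤ 2 := by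
  have hq : (q:ℝ) ≠ 0 := by exact_mod_cast NeZero.ne q
  have key : ∀ a : ZMod q, |sawMod q (a + 1) - sawMod q a| ≤
      1 / q + (if a = 0 then 1 / 2 else 0) + (if a = -1 then 1 / 2 else 0) := by
    intro a
    rw [sawMod_add_one_sub, abs_le]
    have h1 : (0:ℝ) ≤ if a = 0 then 1 / 2 else 0 := by split_ifs <;> norm_num
    have h2 : (0:ℝ) ≤ if a = -1 then 1 / 2 else 0 := by split_ifs <;> norm_num
    have h3 : (0:ℝ) ≤ 1 / q := by positivity
    constructor <;> linarith
  refine (Finset.sum_le_sum fun a _ => key a).trans ?_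
  rw [Finset.sum_add_distrib, Finset.sum_add_distrib, Finset.sum_const, Finset.card_univ, ZMod.card,
    Finset.sum_ite_eq', Finset.sum_ite_eq', if_pos (Finset.mem_univ _), if_pos (Finset.mem_univ _),
    nsmul_eq_mul, mul_one_div_cancel hq]
  norm_num

/-- Lower bound for the distance of an additive character value from `1`. -/
lemma le_norm_stdAddChar_sub_one {q : ℕ} [NeZero q] (h : ZMod q) :
    4 * ((h.valMinAbs.natAbs : ℕ) : ℝ) / q ≤ ‖(ZMod.stdAddChar h : ℂ) - 1‖ := by
  have hq : (0:ℝ) < q := by exact_mod_cast Nat.pos_of_ne_zero (NeZero.ne q)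
  set m : ℤ := h.valMinAbs with hm
  have h1 : (ZMod.stdAddChar h : ℂ) = Complex.exp (I * ((2 * π * m / q : ℝ) : ℂ)) := by
    rw [← ZMod.coe_valMinAbs h, ZMod.stdAddChar_coe]
    congr 1
    push_cast; ring
  have hmq : |(m:ℝ)| ≤ q / 2 := by
    have := ZMod.natAbs_valMinAbs_le h
    rw [← hm] at this
    rw [← Int.cast_abs, Int.abs_eq_natAbs, Int.cast_natCast, le_div_iff₀ (by norm_num)]
    exact_mod_cast (by omega : m.natAbs * 2 ≤ q)
  have h2 : |π * m / q| = π * (|(m:ℝ)| / q) := by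
    rw [mul_div_assoc, abs_mul, abs_div, abs_of_pos Real.pi_pos, abs_of_pos hq]
  have h3 : |π * m / q| ≤ π / 2 := by
    rw [h2]
    have : |(m:ℝ)| / q ≤ 1 / 2 := by rw [div_le_iff₀ hq]; linarith
    nlinarith [Real.pi_pos]
  have h4 := Real.mul_abs_le_abs_sin h3
  rw [h1, Complex.norm_exp_I_mul_ofReal_sub_one, norm_mul, Real.norm_eq_abs, Real.norm_eq_abs]
  have h5 : 2 * π * m / q / 2 = π * m / q := by ring
  rw [h5]
  have h6 : ((m.natAbs : ℕ) : ℝ) = |(m:ℝ)| := by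
    rw [← Int.cast_abs, Int.abs_eq_natAbs, Int.cast_natCast]
  rw [h6]
  rw [h2] at h4
  have h7 : 2 / π * (π * (|(m:ℝ)| / q)) = 2 * |(m:ℝ)| / q := by
    field_simp
  rw [h7] at h4
  rw [abs_of_pos (by norm_num : (0:ℝ) < 2)]
  calc 4 * |(m:ℝ)| / q = 2 * (2 * |(m:ℝ)| / q) := by ring
    _ ≤ _ := by gcongr

/-- Fourier coefficients of the sawtooth. -/
noncomputable def sawFourier (q : ℕ) [NeZero q] (h : ZMod q) : ℂ :=
  (q : ℂ)⁻¹ * ∑ b : ZMod q, (sawMod q b : ℂ) * ZMod.stdAddChar (-(h * b))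

lemma sawFourier_zero (q : ℕ) [NeZero q] : sawFourier q 0 = 0 := by
  simp only [sawFourier, zero_mul, neg_zero, AddChar.map_zero_eq_one, mul_one]
  rw [← Complex.ofReal_sum, sum_sawMod]; simp

lemma sum_sawFourier (q : ℕ) [NeZero q] (a : ZMod q) :
    (sawMod q a : ℂ) = ∑ h : ZMod q, sawFourier q h * ZMod.stdAddChar (h * a) := by
  have hq : (q:ℂ) ≠ 0 := by exact_mod_cast NeZero.ne q
  simp only [sawFourier, Finset.mul_sum, Finset.sum_mul]
  rw [Finset.sum_comm]
  have key : ∀ b : ZMod q, ∑ h : ZMod q, (q:ℂ)⁻¹ * ((sawMod q b : ℂ) *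
      ZMod.stdAddChar (-(h * b))) * ZMod.stdAddChar (h * a) =
      if b = a then (sawMod q b : ℂ) else 0 := by
    intro b
    have h1 : ∀ h : ZMod q, (q:ℂ)⁻¹ * ((sawMod q b : ℂ) *
      ZMod.stdAddChar (-(h * b))) * ZMod.stdAddChar (h * a) =
      (q:ℂ)⁻¹ * (sawMod q b : ℂ) * ZMod.stdAddChar (h * (a - b)) := by
      intro h
      rw [mul_sub, sub_eq_neg_add, AddChar.map_add_eq_mul]; ring
    simp only [h1]
    rw [← Finset.mul_sum, AddChar.sum_mulShift _ (ZMod.isPrimitive_stdAddChar q), ZMod.card]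
    by_cases hab : b = a
    · rw [if_pos hab, if_pos (by rw [hab, sub_self])]
      field_simp
    · rw [if_neg hab, if_neg (by rw [sub_eq_zero]; exact fun h => hab h.symm)]
      simp
  simp only [key]
  simp

lemma norm_sawFourier_mul_le {q : ℕ} [Fact q.Prime] (h : ZMod q) :
    ‖(ZMod.stdAddChar h : ℂ) - 1‖ * ‖sawFourier q h‖ ≤ 2 / q := by
  have h1 : ((ZMod.stdAddChar h : ℂ) - 1) * sawFourier q h = (q : ℂ)⁻¹ *
      ∑ b : ZMod q, ((sawMod q (b + 1) - sawMod q b : ℝ) : ℂ) * ZMod.stdAddChar (-(h * b)) := by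
    have h2 : ∑ b : ZMod q, (sawMod q (b + 1) : ℂ) * ZMod.stdAddChar (-(h * b)) =
        ZMod.stdAddChar h * ∑ b : ZMod q, (sawMod q b : ℂ) * ZMod.stdAddChar (-(h * b)) := by
      rw [← Equiv.sum_comp (Equiv.addRight (1 : ZMod q))
        (fun b => (sawMod q b : ℂ) * ZMod.stdAddChar (-(h * b))), Finset.mul_sum]
      refine Finset.sum_congr rfl fun b _ => ?_
      rw [Equiv.coe_addRight, mul_left_comm, ← AddChar.map_add_eq_mul]
      congr 2
      ring
    simp only [Complex.ofReal_sub, sub_mul, Finset.sum_sub_distrib]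
    rw [h2, sawFourier]
    ring
  rw [← norm_mul, h1, norm_mul, norm_inv, Complex.norm_natCast, div_eq_inv_mul]
  refine mul_le_mul_of_nonneg_left ?_ (by positivity)
  refine (norm_sum_le _ _).trans ((Finset.sum_le_sum fun b _ => ?_).trans
    (sum_abs_sawMod_add_one_sub_le q))
  rw [norm_mul, AddChar.norm_apply, mul_one, Complex.norm_real, Real.norm_eq_abs]

lemma norm_stdAddChar_sub_one_mul_sum_le {q : ℕ} [NeZero q] (h : ZMod q) (T : ℕ) :
    ‖(ZMod.stdAddChar h : ℂ) - 1‖ * ‖∑ t ∈ Finset.range T, (ZMod.stdAddChar (h * (t : ZMod q)) : ℂ)‖ ≤ 2 := by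
  have h1 : ∀ t : ℕ, (ZMod.stdAddChar (h * (t : ZMod q)) : ℂ) = (ZMod.stdAddChar h : ℂ) ^ t := by
    intro t
    rw [← AddChar.map_nsmul_eq_pow, nsmul_eq_mul, mul_comm]
  simp only [h1]
  rw [← norm_mul, mul_comm, geom_sum_mul]
  refine (norm_sub_le _ _).trans ?_
  rw [norm_pow, AddChar.norm_apply]
  norm_num

/-- Fourier coefficients of the averaged sawtooth `a ↦ T⁻¹ ∑_{t < T} s(a + t)`. -/
noncomputable def avgFourier (q : ℕ) [NeZero q] (T : ℕ) (h : ZMod q) : ℂ :=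
  sawFourier q h * ((T : ℂ)⁻¹ * ∑ t ∈ Finset.range T, (ZMod.stdAddChar (h * (t : ZMod q)) : ℂ))

lemma sum_avgFourier (q : ℕ) [NeZero q] (T : ℕ) (a : ZMod q) :
    (T : ℂ)⁻¹ * ∑ t ∈ Finset.range T, (sawMod q (a + (t : ZMod q)) : ℂ) =
      ∑ h : ZMod q, avgFourier q T h * ZMod.stdAddChar (h * a) := by
  simp only [sum_sawFourier q, avgFourier]
  rw [Finset.sum_comm, Finset.mul_sum]
  refine Finset.sum_congr rfl fun h _ => ?_
  simp only [Finset.mul_sum, Finset.sum_mul]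
  refine Finset.sum_congr rfl fun t _ => ?_
  rw [mul_add, AddChar.map_add_eq_mul]; ring

lemma norm_avgFourier_le {q : ℕ} [Fact q.Prime] {T R : ℕ} (hR : (q:ℝ) / R ≤ T) (hT : 0 < T)
    (hR0 : 0 < R)
    {h : ZMod q} (hh : h ≠ 0) :
    ‖avgFourier q T h‖ ≤ min (1 / ((h.valMinAbs.natAbs : ℕ) : ℝ))
      (R / ((h.valMinAbs.natAbs : ℕ) : ℝ) ^ 2) := by
  have hq : (0:ℝ) < q := by exact_mod_cast Nat.pos_of_ne_zero (NeZero.ne q)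
  have hT' : (0:ℝ) < T := by exact_mod_cast hT
  have hR' : (0:ℝ) < R := by exact_mod_cast hR0
  set m := h.valMinAbs.natAbs with hm
  have hm0 : (0:ℝ) < m := by
    have : m ≠ 0 := by rw [hm, Int.natAbs_ne_zero, Ne, ZMod.valMinAbs_eq_zero]; exact hh
    exact_mod_cast Nat.pos_of_ne_zero this
  have h1 := le_norm_stdAddChar_sub_one h
  rw [← hm] at h1
  have h2 := norm_sawFourier_mul_le h
  have h3 := norm_stdAddChar_sub_one_mul_sum_le h T
  set D := ‖(ZMod.stdAddChar h : ℂ) - 1‖ with hD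
  have hsaw : ‖sawFourier q h‖ ≤ 1 / m := by
    have h4 : 4 * (m:ℝ) / q * ‖sawFourier q h‖ ≤ 2 / q :=
      (mul_le_mul_of_nonneg_right h1 (norm_nonneg _)).trans h2
    rw [le_div_iff₀ hm0]
    rw [div_mul_eq_mul_div, div_le_div_iff_of_pos_right hq] at h4
    nlinarith [norm_nonneg (sawFourier q h)]
  have hker1 : ‖((T : ℂ)⁻¹ * ∑ t ∈ Finset.range T, (ZMod.stdAddChar (h * (t : ZMod q)) : ℂ))‖ ≤ 1 := by
    rw [norm_mul, norm_inv, Complex.norm_natCast, inv_mul_le_iff₀ hT', mul_one]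
    refine (norm_sum_le _ _).trans ?_
    simp [AddChar.norm_apply]
  have hker2 : ‖((T : ℂ)⁻¹ * ∑ t ∈ Finset.range T, (ZMod.stdAddChar (h * (t : ZMod q)) : ℂ))‖ ≤ R / m := by
    rw [norm_mul, norm_inv, Complex.norm_natCast, inv_mul_le_iff₀ hT']
    set S := ‖∑ t ∈ Finset.range T, (ZMod.stdAddChar (h * (t : ZMod q)) : ℂ)‖
    have h4 : 4 * (m:ℝ) / q * S ≤ 2 :=
      (mul_le_mul_of_nonneg_right h1 (norm_nonneg _)).trans h3
    rw [div_mul_eq_mul_div, div_le_iff₀ hq] at h4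
    rw [div_le_iff₀ hR'] at hR
    rw [← mul_div_assoc, le_div_iff₀ hm0]
    nlinarith
  rw [avgFourier, norm_mul]
  refine le_min ?_ ?_
  · calc _ ≤ 1 / (m:ℝ) * 1 := mul_le_mul hsaw hker1 (norm_nonneg _) (by positivity)
      _ = _ := mul_one _
  · calc _ ≤ 1 / (m:ℝ) * (R / m) := mul_le_mul hsaw hker2 (norm_nonneg _) (by positivity)
      _ = _ := by field_simp

lemma sum_min_inv_le {R : ℕ} (hR0 : 0 < R) (n : ℕ) :
    ∑ m ∈ Finset.Ico 1 n, min (1 / (m:ℝ)) (R / (m:ℝ) ^ 2) ≤ 3 + Real.log R := by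
  have hR' : (0:ℝ) < R := by exact_mod_cast hR0
  have hsub : Finset.Ico 1 n ⊆ Finset.Ico 1 (R + 1) ∪ Finset.Ioc R (max R n) := by
    intro m hm
    simp only [Finset.mem_Ico, Finset.mem_union, Finset.mem_Ioc] at hm ⊢
    have := le_max_right R n
    omega
  refine (Finset.sum_le_sum_of_subset_of_nonneg hsub fun m _ _ => by positivity).trans ?_
  rw [Finset.sum_union (Finset.disjoint_left.2 fun m hm hm' => by
    rw [Finset.mem_Ico] at hm; rw [Finset.mem_Ioc] at hm'; omega)]
  have h1 : ∑ m ∈ Finset.Ico 1 (R + 1), min (1 / (m:ℝ)) (R / (m:ℝ) ^ 2) ≤ 2 + Real.log R := by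
    have h2 : Real.log ((R + 1 : ℕ) : ℝ) ≤ 1 + Real.log R := by
      have h3 : ((R + 1 : ℕ) : ℝ) ≤ 2 * R := by
        push_cast
        have : (1:ℝ) ≤ R := by exact_mod_cast hR0
        linarith
      have h4 := Real.log_le_log (by positivity) h3
      rw [Real.log_mul (by norm_num) hR'.ne'] at h4
      have h5 : Real.log 2 ≤ 2 - 1 := Real.log_le_sub_one_of_pos (by norm_num)
      linarith
    refine (Finset.sum_le_sum fun m _ => min_le_left _ _).trans ?_
    have := sum_inv_Ico_le (R + 1)
    linarith
  have h2 : ∑ m ∈ Finset.Ioc R (max R n), min (1 / (m:ℝ)) (R / (m:ℝ) ^ 2) ≤ 1 := by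
    refine (Finset.sum_le_sum fun m _ => min_le_right _ _).trans ?_
    simp only [div_eq_mul_inv]
    rw [← Finset.mul_sum]
    have h3 := sum_Ioc_inv_sq_le_sub (α := ℝ) hR0.ne' (le_max_left R n)
    have h4 : (0:ℝ) ≤ ((max R n : ℕ) : ℝ)⁻¹ := by positivity
    calc (R:ℝ) * ∑ m ∈ Finset.Ioc R (max R n), ((m:ℝ) ^ 2)⁻¹ ≤ R * (R:ℝ)⁻¹ := by
          gcongr; linarith
      _ = 1 := mul_inv_cancel₀ hR'.ne'
  linarith

lemma sum_comp_val (q : ℕ) [NeZero q] {M : Type*} [AddCommMonoid M] (F : ℕ → M) :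
    ∑ h : ZMod q, F h.val = ∑ v ∈ Finset.range q, F v := by
  refine Finset.sum_bij (fun h _ => h.val) (fun h _ => Finset.mem_range.2 h.val_lt)
    (fun a _ b _ hab => ZMod.val_injective q hab) (fun v hv => ?_) (fun _ _ => rfl)
  exact ⟨(v : ZMod q), Finset.mem_univ _, ZMod.val_cast_of_lt (Finset.mem_range.1 hv)⟩

lemma sum_norm_avgFourier_le {q : ℕ} [Fact q.Prime] {T R : ℕ} (hR : (q:ℝ) / R ≤ T) (hT : 0 < T)
    (hR0 : 0 < R) :
    ∑ h : ZMod q, ‖avgFourier q T h‖ ≤ 6 + 2 * Real.log R := by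
  set F : ℕ → ℝ := fun m => min (1 / (m:ℝ)) (R / (m:ℝ) ^ 2) with hF
  have hF0 : ∀ m, 0 ≤ F m := fun m => by positivity
  have hFz : F 0 = 0 := by simp [hF]
  have key : ∀ h : ZMod q, ‖avgFourier q T h‖ ≤ F h.val + F (q - h.val) := by
    intro h
    rcases eq_or_ne h 0 with rfl | hh
    · rw [avgFourier, sawFourier_zero, zero_mul, norm_zero]
      exact add_nonneg (hF0 _) (hF0 _)
    · refine (norm_avgFourier_le hR hT hR0 hh).trans ?_
      change F (h.valMinAbs.natAbs) ≤ _
      rw [ZMod.valMinAbs_natAbs_eq_min]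
      rcases min_choice h.val (q - h.val) with h1 | h1 <;> rw [h1]
      · linarith [hF0 (q - h.val)]
      · linarith [hF0 h.val]
  have hall : ∑ m ∈ Finset.range (q + 1), F m ≤ 3 + Real.log R := by
    rw [Finset.range_eq_Ico, Finset.sum_eq_sum_Ico_succ_bot (by omega), hFz, zero_add]
    exact sum_min_inv_le hR0 (q + 1)
  have h1 : ∑ v ∈ Finset.range q, F v ≤ ∑ m ∈ Finset.range (q + 1), F m := by
    rw [Finset.sum_range_succ]; linarith [hF0 q]
  have h2 : ∑ v ∈ Finset.range q, F (q - v) = ∑ m ∈ Finset.range (q + 1), F m := by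
    rw [Finset.sum_range_succ', hFz, add_zero, ← Finset.sum_range_reflect]
    refine Finset.sum_congr rfl fun v hv => ?_
    rw [Finset.mem_range] at hv
    congr 1
    omega
  refine (Finset.sum_le_sum fun h _ => key h).trans ?_
  rw [Finset.sum_add_distrib, sum_comp_val q F, sum_comp_val q (fun v => F (q - v)), h2]
  linarith

lemma le_sum_sawMod {q : ℕ} [Fact q.Prime] {T R : ℕ} (hR : (q:ℝ) / R ≤ T) (hT : 0 < T)
    (hR0 : 0 < R) {B : ℝ} {k : ZMod q} (hk : k ≠ 0)
    (hB : ∀ h : ZMod q, h ≠ 0 →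
      ‖∑ n ∈ Finset.Ico 1 q, (ZMod.stdAddChar (h * (n : ZMod q)⁻¹) : ℂ) / n‖ ≤ B) :
    -((6 + 2 * Real.log R) * B) - T / q * (1 + Real.log q) ≤
      ∑ n ∈ Finset.Ico 1 q, sawMod q (k * (n : ZMod q)⁻¹) / n := by
  have hT' : (0:ℝ) < T := by exact_mod_cast hT
  have hB0 : 0 ≤ B := (norm_nonneg _).trans (hB 1 one_ne_zero)
  have hq : (0:ℝ) < q := by exact_mod_cast Nat.pos_of_ne_zero (NeZero.ne q)
  set g : ZMod q → ℝ := fun a => (T:ℝ)⁻¹ * ∑ t ∈ Finset.range T, sawMod q (a + (t : ZMod q)) with hg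
  have hgle : ∀ a, g a - T / q ≤ sawMod q a := by
    intro a
    have h1 : ∑ t ∈ Finset.range T, sawMod q (a + (t : ZMod q)) ≤
        ∑ t ∈ Finset.range T, (sawMod q a + T / q) := by
      refine Finset.sum_le_sum fun t ht => (sawMod_add_le a t).trans ?_
      have : (t:ℝ) ≤ T := by exact_mod_cast (Finset.mem_range.1 ht).le
      gcongr
    rw [Finset.sum_const, Finset.card_range, nsmul_eq_mul] at h1
    have h2 : g a ≤ sawMod q a + T / q := by
      rw [hg]
      exact (inv_mul_le_iff₀ hT').2 h1
    linarith
  have hfour : ((∑ n ∈ Finset.Ico 1 q, g (k * (n : ZMod q)⁻¹) / n : ℝ) : ℂ) =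
      ∑ h : ZMod q, avgFourier q T h *
        ∑ n ∈ Finset.Ico 1 q, (ZMod.stdAddChar (h * k * (n : ZMod q)⁻¹) : ℂ) / n := by
    simp only [Finset.mul_sum]
    rw [Finset.sum_comm, Complex.ofReal_sum]
    refine Finset.sum_congr rfl fun n _ => ?_
    rw [hg]
    push_cast
    rw [sum_avgFourier, Finset.sum_div]
    refine Finset.sum_congr rfl fun h _ => ?_
    rw [mul_assoc h, mul_div_assoc]
  have hbd : |∑ n ∈ Finset.Ico 1 q, g (k * (n : ZMod q)⁻¹) / n| ≤ (6 + 2 * Real.log R) * B := by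
    rw [← Real.norm_eq_abs, ← Complex.norm_real, hfour]
    refine (norm_sum_le _ _).trans ?_
    refine le_trans (Finset.sum_le_sum (g := fun h => ‖avgFourier q T h‖ * B) fun h _ => ?_) ?_
    · rw [norm_mul]
      rcases eq_or_ne h 0 with rfl | hh
      · rw [avgFourier, sawFourier_zero, zero_mul, norm_zero, zero_mul, zero_mul]
      · exact mul_le_mul_of_nonneg_left (hB _ (mul_ne_zero hh hk)) (norm_nonneg _)
    · rw [← Finset.sum_mul]
      exact mul_le_mul_of_nonneg_right (sum_norm_avgFourier_le hR hT hR0) hB0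
  have hlow : ∑ n ∈ Finset.Ico 1 q, g (k * (n : ZMod q)⁻¹) / n -
      T / q * ∑ n ∈ Finset.Ico 1 q, (1:ℝ) / n ≤
      ∑ n ∈ Finset.Ico 1 q, sawMod q (k * (n : ZMod q)⁻¹) / n := by
    rw [Finset.mul_sum, ← Finset.sum_sub_distrib]
    refine Finset.sum_le_sum fun n _ => ?_
    rw [mul_one_div, ← sub_div]
    exact div_le_div_of_nonneg_right (hgle _) (by positivity)
  have h3 : (T:ℝ) / q * ∑ n ∈ Finset.Ico 1 q, (1:ℝ) / n ≤ T / q * (1 + Real.log q) :=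
    mul_le_mul_of_nonneg_left (sum_inv_Ico_le q) (by positivity)
  have h4 := (abs_le.1 hbd).1
  linarith

lemma abs_sum_sawMod_le {q : ℕ} [Fact q.Prime] {T R : ℕ} (hR : (q:ℝ) / R ≤ T) (hT : 0 < T)
    (hR0 : 0 < R) {B : ℝ} {k : ZMod q} (hk : k ≠ 0)
    (hB : ∀ h : ZMod q, h ≠ 0 →
      ‖∑ n ∈ Finset.Ico 1 q, (ZMod.stdAddChar (h * (n : ZMod q)⁻¹) : ℂ) / n‖ ≤ B) :
    |∑ n ∈ Finset.Ico 1 q, sawMod q (k * (n : ZMod q)⁻¹) / n| ≤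
      (6 + 2 * Real.log R) * B + T / q * (1 + Real.log q) := by
  have h1 := le_sum_sawMod hR hT hR0 hk hB
  have h2 := le_sum_sawMod hR hT hR0 (neg_ne_zero.2 hk) hB
  simp only [neg_mul, sawMod_neg, neg_div, Finset.sum_neg_distrib] at h2
  rw [abs_le]
  constructor <;> linarith

/-- The weighted sawtooth sum over inverses has size `O((log q)^{2/3} (log log q)^2)`. -/
lemma exists_abs_sum_sawMod_le : ∃ C : ℝ, 0 ≤ C ∧ ∀ q : ℕ, ∀ [Fact q.Prime], 17 ≤ q →
    ∀ k : ZMod q, k ≠ 0 →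
    |∑ n ∈ Finset.Ico 1 q, sawMod q (k * (n : ZMod q)⁻¹) / n| ≤
      C * (Real.log q ^ ((2:ℝ) / 3) * Real.log (Real.log q) ^ 2) := by
  obtain ⟨C, hC, hCq⟩ := exists_norm_sum_stdAddChar_inv_le
  refine ⟨10 * C + 4, by positivity, fun q _ hq k hk => ?_⟩
  have hL1 := exp_one_le_log hq
  have hℓ1 := one_le_log_log hq
  have hq0 : (0:ℝ) < q := by positivity
  have hmain := fun (T R : ℕ) hR hT hR0 => abs_sum_sawMod_le (T := T) (R := R) hR hT hR0 hk (hCq q hq)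
  have hLq : Real.log q ≤ q := Real.log_le_self hq0.le
  generalize Real.log q = L at *
  generalize hℓ : Real.log L = ℓ at *
  have hL2 : 2 < L := by linarith [Real.exp_one_gt_d9]
  have hΛ2 : L ^ ((2:ℝ) / 3) = (L ^ ((1:ℝ) / 3)) ^ 2 := by
    rw [← Real.rpow_natCast, ← Real.rpow_mul (by linarith)]; norm_num
  have hΛ3 : (L ^ ((1:ℝ) / 3)) ^ 3 = L := by
    rw [← Real.rpow_natCast, ← Real.rpow_mul (by linarith)]; norm_num
  have hΛ1 : 1 ≤ L ^ ((1:ℝ) / 3) := Real.one_le_rpow (by linarith) (by norm_num)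
  rw [hΛ2]
  simp only [hΛ2] at hmain
  clear hΛ2 hCq
  generalize L ^ ((1:ℝ) / 3) = Λ at *
  have hΛL : Λ ≤ L := by rw [← hΛ3]; exact le_self_pow₀ hΛ1 (by norm_num)
  set R := ⌈Λ⌉₊ with hRdef
  have hR1 : Λ ≤ R := Nat.le_ceil _
  have hR2 : (R:ℝ) ≤ 2 * L := by
    have := Nat.ceil_lt_add_one (a := Λ) (by linarith)
    linarith
  have hR0 : 0 < R := Nat.ceil_pos.2 (by linarith)
  have hR0' : (0:ℝ) < R := by exact_mod_cast hR0
  set T := ⌊(q:ℝ) / R⌋₊ + 1 with hTdef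
  have hT1 : (q:ℝ) / R ≤ T := by
    rw [hTdef]; push_cast; exact (Nat.lt_floor_add_one _).le
  have hT2 : (T:ℝ) / q ≤ 2 / Λ := by
    have h1 : (T:ℝ) ≤ q / R + 1 := by
      rw [hTdef]; push_cast
      linarith [Nat.floor_le (a := (q:ℝ) / R) (by positivity)]
    calc (T:ℝ) / q ≤ (q / R + 1) / q := by gcongr
      _ = 1 / R + 1 / q := by field_simp
      _ ≤ 1 / Λ + 1 / Λ := by
        gcongr
        linarith
      _ = 2 / Λ := by ring
  refine (hmain T R hT1 (by omega) hR0).trans ?_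
  have hlogR : Real.log R ≤ 2 * ℓ := by
    have h1 := Real.log_le_log hR0' hR2
    rw [Real.log_mul (by norm_num) (by linarith), hℓ] at h1
    have h5 : Real.log 2 ≤ 2 - 1 := Real.log_le_sub_one_of_pos (by norm_num)
    linarith
  have e1 : (6 + 2 * Real.log R) * (C * (Λ ^ 2 * ℓ)) ≤ (10 * ℓ) * (C * (Λ ^ 2 * ℓ)) := by
    gcongr
    linarith
  have e2 : (T:ℝ) / q * (1 + L) ≤ 4 * Λ ^ 2 := by
    calc (T:ℝ) / q * (1 + L) ≤ 2 / Λ * (2 * L) := by gcongr; linarith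
      _ = 4 * Λ ^ 2 := by rw [← hΛ3]; field_simp; norm_num
  have e3 : Λ ^ 2 * 1 ≤ Λ ^ 2 * ℓ ^ 2 := by
    gcongr; exact one_le_pow₀ hℓ1
  linarith

/-- The generating function `∑ₙ exp (-(n + c) t)`. -/
noncomputable def expQuot (c t : ℝ) : ℝ := Real.exp (-c * t) / (1 - Real.exp (-t))

lemma abs_exp_neg_sub_le {t : ℝ} (h0 : 0 ≤ t) (h1 : t ≤ 1) : |Real.exp (-t) - 1 + t| ≤ t ^ 2 := by
  have := Real.abs_exp_sub_one_sub_id_le (x := -t) (by rw [abs_neg, abs_of_nonneg h0]; exact h1)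
  rwa [sub_neg_eq_add, neg_sq] at this

lemma half_le_one_sub_exp_neg {t : ℝ} (h0 : 0 ≤ t) (h1 : t ≤ 1 / 2) :
    t / 2 ≤ 1 - Real.exp (-t) := by
  have := (abs_le.1 (abs_exp_neg_sub_le h0 (by linarith))).2
  nlinarith

lemma one_sub_exp_neg_pos {t : ℝ} (h0 : 0 < t) : 0 < 1 - Real.exp (-t) := by
  have : Real.exp (-t) < 1 := Real.exp_lt_one_iff.2 (by linarith)
  linarith

lemma continuousOn_expQuot (c : ℝ) : ContinuousOn (expQuot c) (Set.Ioi 0) := by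
  unfold expQuot
  refine ContinuousOn.div (by fun_prop) (by fun_prop) fun t ht => ?_
  exact (one_sub_exp_neg_pos ht).ne'

lemma expQuot_le_of_one_le {c t : ℝ} (ht : 1 ≤ t) : expQuot c t ≤ 2 * Real.exp (-c * t) := by
  have h1 : Real.exp (-t) ≤ 1 / 2 := by
    have h2 : Real.exp (-t) ≤ Real.exp (-1) := Real.exp_le_exp.2 (by linarith)
    have h3 : Real.exp (-1) ≤ 1 / 2 := by
      rw [Real.exp_neg, one_div]
      exact inv_anti₀ (by norm_num) (by linarith [Real.exp_one_gt_d9])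
    linarith
  rw [expQuot, div_le_iff₀ (by linarith)]
  nlinarith [Real.exp_pos (-c * t)]

lemma expQuot_nonneg {c t : ℝ} (ht : 0 < t) : 0 ≤ expQuot c t :=
  div_nonneg (Real.exp_pos _).le (one_sub_exp_neg_pos ht).le

lemma isBigO_expQuot_atTop (c : ℝ) :
    (fun t => (expQuot c t : ℂ)) =O[Filter.atTop] fun t => Real.exp (-c * t) := by
  refine Asymptotics.IsBigO.of_bound 2 ?_
  filter_upwards [Filter.eventually_ge_atTop 1] with t ht
  rw [Complex.norm_real, Real.norm_of_nonneg (expQuot_nonneg (by linarith)),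
    Real.norm_of_nonneg (Real.exp_pos _).le]
  exact expQuot_le_of_one_le ht

lemma isBigO_expQuot_zero {c : ℝ} (hc : 0 ≤ c) :
    (fun t => (expQuot c t : ℂ)) =O[nhdsWithin 0 (Set.Ioi 0)] fun t : ℝ => t ^ (-1 : ℝ) := by
  refine Asymptotics.IsBigO.of_bound 2 ?_
  filter_upwards [Ioc_mem_nhdsGT (by norm_num : (0:ℝ) < 1 / 2)] with t ht
  have h1 := half_le_one_sub_exp_neg ht.1.le ht.2
  rw [Complex.norm_real, Real.norm_of_nonneg (expQuot_nonneg ht.1),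
    Real.norm_of_nonneg (Real.rpow_nonneg ht.1.le _), Real.rpow_neg_one, expQuot]
  have h2 : Real.exp (-c * t) ≤ 1 := Real.exp_le_one_iff.2 (by nlinarith [ht.1])
  calc Real.exp (-c * t) / (1 - Real.exp (-t)) ≤ 1 / (t / 2) :=
        div_le_div₀ zero_le_one h2 (by linarith [ht.1]) h1
    _ = 2 * t⁻¹ := by field_simp

lemma locallyIntegrableOn_expQuot (c : ℝ) :
    LocallyIntegrableOn (fun t => (expQuot c t : ℂ)) (Set.Ioi 0) :=
  (Complex.continuous_ofReal.comp_continuousOn (continuousOn_expQuot c)).locallyIntegrableOn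
    measurableSet_Ioi

lemma hasMellin_expQuot {c : ℝ} (hc : 0 < c) (hc1 : c ≤ 1) {s : ℂ} (hs : 1 < s.re) :
    HasMellin (fun t => (expQuot c t : ℂ)) s
      (Complex.Gamma s * HurwitzZeta.hurwitzZeta (c : UnitAddCircle) s) := by
  refine ⟨mellinConvergent_of_isBigO_rpow_exp hc (locallyIntegrableOn_expQuot c)
    (isBigO_expQuot_atTop c) (isBigO_expQuot_zero hc.le) hs, ?_⟩
  have hp : ∀ n : ℕ, 0 < (n:ℝ) + c := fun n => by positivity
  have h1 := hasSum_mellin (a := fun _ : ℕ => (1:ℂ)) (p := fun n => (n:ℝ) + c)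
    (F := fun t => (expQuot c t : ℂ)) (s := s) (fun n => Or.inr (hp n)) (by linarith) ?_ ?_
  · have h2 := (HurwitzZeta.hasSum_hurwitzZeta_of_one_lt_re (a := c) ⟨hc.le, hc1⟩ hs).mul_left
      (Complex.Gamma s)
    refine h1.unique ?_
    refine (congrArg (fun f => HasSum f _) (funext fun n => ?_)).mp h2
    rw [Complex.ofReal_add, Complex.ofReal_natCast, mul_one_div, mul_one]
  · intro t ht
    have h3 : HasSum (fun n : ℕ => Real.exp (-((n:ℝ) + c) * t)) (expQuot c t) := by
      have h4 := (hasSum_geometric_of_lt_one (Real.exp_pos (-t)).le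
        (Real.exp_lt_one_iff.2 (by linarith [Set.mem_Ioi.1 ht]))).mul_left (Real.exp (-c * t))
      rw [← div_eq_mul_inv] at h4
      refine (congrArg (fun f => HasSum f _) (funext fun n => ?_)).mp h4
      rw [← Real.exp_nat_mul, ← Real.exp_add]
      ring_nf
    simpa using Complex.hasSum_ofReal.2 h3
  · have := (Real.summable_one_div_nat_add_rpow c s.re).2 hs
    convert this using 2 with n
    rw [norm_one, abs_of_pos (hp n)]

/-- The generating function of `ζ(s, c) - ζ(s, 1)` with its value at zero removed. -/
noncomputable def expQuotDiff (c t : ℝ) : ℂ :=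
  (expQuot c t : ℂ) - (expQuot 1 t : ℂ) -
    (1 - c : ℂ) • Set.indicator (Set.Ioc (0:ℝ) 1) (fun _ => (1:ℂ)) t

lemma isBigO_expQuotDiff_atTop {c : ℝ} (hc1 : c ≤ 1) :
    expQuotDiff c =O[Filter.atTop] fun t => Real.exp (-c * t) := by
  refine ((isBigO_expQuot_atTop c).sub ((isBigO_expQuot_atTop 1).trans ?_)).sub ?_
  · refine Asymptotics.IsBigO.of_bound 1 ?_
    filter_upwards [Filter.eventually_ge_atTop 0] with t ht
    rw [Real.norm_of_nonneg (Real.exp_pos _).le, Real.norm_of_nonneg (Real.exp_pos _).le, one_mul]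
    exact Real.exp_le_exp.2 (by nlinarith)
  · refine Asymptotics.IsBigO.of_bound 1 ?_
    filter_upwards [Filter.eventually_gt_atTop 1] with t ht
    rw [Set.indicator_of_notMem (fun h => not_lt.2 h.2 ht), smul_zero, norm_zero]
    positivity

lemma isBigO_expQuotDiff_zero {c : ℝ} (hc : 0 < c) (hc1 : c ≤ 1) :
    expQuotDiff c =O[nhdsWithin 0 (Set.Ioi 0)] fun t : ℝ => t ^ (-(-1) : ℝ) := by
  refine Asymptotics.IsBigO.of_bound 4 ?_
  filter_upwards [Ioc_mem_nhdsGT (by norm_num : (0:ℝ) < 1 / 2)] with t ht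
  have ht0 := ht.1
  have ht1 := ht.2
  have h1 := half_le_one_sub_exp_neg ht0.le ht1
  have hpos := one_sub_exp_neg_pos ht0
  have h2 : expQuotDiff c t = (((Real.exp (-(c * t)) - 1 + c * t) -
      c * (Real.exp (-t) - 1 + t)) / (1 - Real.exp (-t)) : ℝ) := by
    rw [expQuotDiff, Set.indicator_of_mem (Set.mem_Ioc.2 ⟨ht0, by linarith⟩), expQuot, expQuot,
      smul_eq_mul, mul_one]
    have h3 : expQuot c t - expQuot 1 t - (1 - c) = ((Real.exp (-(c * t)) - 1 + c * t) -
      c * (Real.exp (-t) - 1 + t)) / (1 - Real.exp (-t)) := by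
      rw [expQuot, expQuot, eq_div_iff hpos.ne', sub_mul, sub_mul, div_mul_cancel₀ _ hpos.ne',
        div_mul_cancel₀ _ hpos.ne', neg_mul, neg_one_mul]
      ring
    rw [← h3, expQuot, expQuot]
    push_cast; ring
  rw [h2, Complex.norm_real, Real.norm_eq_abs, abs_div, abs_of_pos hpos, neg_neg, Real.rpow_one,
    Real.norm_of_nonneg ht0.le, div_le_iff₀ hpos]
  have h4 := abs_exp_neg_sub_le ht0.le (by linarith)
  have h5 := abs_exp_neg_sub_le (t := c * t) (by positivity) (by nlinarith)
  have h6 : |(Real.exp (-(c * t)) - 1 + c * t) - c * (Real.exp (-t) - 1 + t)| ≤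
      (c * t) ^ 2 + c * t ^ 2 := by
    refine (abs_sub _ _).trans (add_le_add h5 ?_)
    rw [abs_mul, abs_of_pos hc]
    gcongr
  have h7 : (c * t) ^ 2 + c * t ^ 2 ≤ 2 * t ^ 2 := by
    have : c ^ 2 ≤ 1 := pow_le_one₀ hc.le hc1
    nlinarith [sq_nonneg t]
  nlinarith

lemma locallyIntegrableOn_expQuotDiff (c : ℝ) :
    LocallyIntegrableOn (expQuotDiff c) (Set.Ioi 0) := by
  refine ((locallyIntegrableOn_expQuot c).sub (locallyIntegrableOn_expQuot 1)).sub ?_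
  refine Integrable.locallyIntegrable ?_ |>.locallyIntegrableOn _
  have h : Integrable (Set.indicator (Set.Ioc (0:ℝ) 1) (fun _ => (1:ℂ))) := by
    rw [integrable_indicator_iff measurableSet_Ioc]
    simp
  exact h.smul (1 - c : ℂ)

lemma Gamma_mul_hurwitzZeta_sub {c : ℝ} (hc : 0 < c) (hc1 : c ≤ 1) {s : ℂ} (hs : 1 < s.re) :
    Complex.Gamma (s + 1) * (HurwitzZeta.hurwitzZeta (c : UnitAddCircle) s -
      HurwitzZeta.hurwitzZeta ((1:ℝ) : UnitAddCircle) s) =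
      s * mellin (expQuotDiff c) s + (1 - c) := by
  have hs0 : s ≠ 0 := by rintro rfl; norm_num at hs
  have h1 := hasMellin_expQuot hc hc1 hs
  have h2 := hasMellin_expQuot one_pos le_rfl hs
  have h3 := hasMellin_sub h1.1 h2.1
  have h4 := hasMellin_const_smul (hasMellin_one_Ioc (by linarith : 0 < s.re)).1 (1 - c : ℂ)
  have h5 := (hasMellin_sub h3.1 h4.1).2
  have h6 : mellin (expQuotDiff c) s = mellin (fun t => (expQuot c t : ℂ)) s -
      mellin (fun t => (expQuot 1 t : ℂ)) s -
      (1 - c : ℂ) • mellin (Set.indicator (Set.Ioc 0 1) (fun _ => 1 : ℝ → ℂ)) s := by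
    rw [← h3.2, ← h4.2, ← h5]
    rfl
  rw [h6, h1.2, h2.2, (hasMellin_one_Ioc (by linarith : 0 < s.re)).2, Complex.Gamma_add_one s hs0,
    smul_eq_mul]
  field_simp
  ring

/-- The value of the Hurwitz zeta function at `0`. -/
lemma hurwitzZeta_apply_zero {c : ℝ} (hc : 0 < c) (hc1 : c ≤ 1) :
    HurwitzZeta.hurwitzZeta (c : UnitAddCircle) 0 = 1 / 2 - c := by
  set U : Set ℂ := {s | -1 < s.re} with hU
  have hUo : IsOpen U := isOpen_lt continuous_const Complex.continuous_re
  have hUc : IsPreconnected U := (convex_halfSpace_re_gt (-1)).isPreconnected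
  set D : ℂ → ℂ := fun s => HurwitzZeta.hurwitzZeta (c : UnitAddCircle) s -
      HurwitzZeta.hurwitzZeta ((1:ℝ) : UnitAddCircle) s with hD
  have hf : AnalyticOnNhd ℂ (fun s => Complex.Gamma (s + 1) * D s) U := by
    refine DifferentiableOn.analyticOnNhd (fun s hs => ?_) hUo
    refine DifferentiableAt.differentiableWithinAt (DifferentiableAt.mul ?_ ?_)
    · refine DifferentiableAt.comp s (Complex.differentiableAt_Gamma _ fun m hm => ?_) (by fun_prop)
      have h1 := congrArg Complex.re hm
      simp only [Complex.add_re, Complex.one_re, Complex.neg_re, Complex.natCast_re] at h1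
      have h2 : -1 < s.re := hs
      have h3 : (0:ℝ) ≤ m := by positivity
      linarith
    · exact HurwitzZeta.differentiable_hurwitzZeta_sub_hurwitzZeta _ _ s
  have hg : AnalyticOnNhd ℂ (fun s => s * mellin (expQuotDiff c) s + (1 - c)) U := by
    refine DifferentiableOn.analyticOnNhd (fun s hs => ?_) hUo
    refine DifferentiableAt.differentiableWithinAt ?_
    have := mellin_differentiableAt_of_isBigO_rpow_exp hc (locallyIntegrableOn_expQuotDiff c)
      (isBigO_expQuotDiff_atTop hc1) (isBigO_expQuotDiff_zero hc hc1) hs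
    fun_prop
  have heq := hf.eqOn_of_preconnected_of_eventuallyEq hg hUc (z₀ := 2) (by simp [hU]; norm_num) ?_
  · have h0 := heq (x := 0) (by simp [hU])
    simp only [zero_add, Complex.Gamma_one, one_mul, zero_mul, hD] at h0
    have h1 : ((1:ℝ) : UnitAddCircle) = 0 := AddCircle.coe_period 1
    rw [h1, HurwitzZeta.hurwitzZeta_zero, riemannZeta_zero] at h0
    linear_combination h0
  · have : {s : ℂ | 1 < s.re} ∈ nhds (2:ℂ) :=
      (isOpen_lt continuous_const Complex.continuous_re).mem_nhds (by simp)
    filter_upwards [this] with s hs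
    exact Gamma_mul_hurwitzZeta_sub hc hc1 hs

lemma LFunction_char_apply_zero {q : ℕ} [Fact q.Prime] (χ : DirichletCharacter ℂ q) :
    DirichletCharacter.LFunction χ 0 = -∑ a : ZMod q, χ a * sawMod q a := by
  have hq : (0:ℝ) < q := by exact_mod_cast Nat.pos_of_ne_zero (NeZero.ne q)
  rw [DirichletCharacter.LFunction, ZMod.LFunction, neg_zero, cpow_zero, one_mul,
    ← Finset.sum_neg_distrib]
  refine Finset.sum_congr rfl fun a _ => ?_
  rcases eq_or_ne a 0 with rfl | ha
  · rw [MulChar.map_zero, zero_mul, zero_mul, neg_zero]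
  · rw [ZMod.toAddCircle_apply, hurwitzZeta_apply_zero, sawMod_of_ne ha]
    · push_cast; ring
    · have : 0 < a.val := by
        rw [Nat.pos_iff_ne_zero, Ne, ZMod.val_eq_zero]; exact ha
      positivity
    · rw [div_le_one hq]
      exact_mod_cast a.val_lt.le

lemma norm_sum_range_periodic_le {q : ℕ} [NeZero q] {Φ : ZMod q → ℂ} (hsum : ∑ a, Φ a = 0)
    (hb : ∀ a, ‖Φ a‖ ≤ 1) (N : ℕ) : ‖∑ n ∈ Finset.range N, Φ (n : ZMod q)‖ ≤ q := by
  have hper : ∀ m r : ℕ, ∑ n ∈ Finset.range (q * m + r), Φ (n : ZMod q) =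
      ∑ n ∈ Finset.range r, Φ (n : ZMod q) := by
    intro m
    induction m with
    | zero => intro r; simp
    | succ m ih =>
      intro r
      rw [Nat.mul_succ, add_assoc, ih, Finset.sum_range_add]
      have h1 := sum_comp_val q (fun v => Φ (v : ZMod q))
      simp only [ZMod.natCast_zmod_val] at h1
      rw [← h1, hsum, zero_add]
      simp
  rw [← Nat.div_add_mod N q, hper]
  refine (norm_sum_le _ _).trans ((Finset.sum_le_sum fun n _ => hb _).trans ?_)
  rw [Finset.sum_const, Finset.card_range, nsmul_eq_mul, mul_one]
  exact_mod_cast (Nat.mod_lt N (Nat.pos_of_ne_zero (NeZero.ne q))).le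

lemma LSeriesSummable_of_norm_le_one {f : ℕ → ℂ} (hb : ∀ n, ‖f n‖ ≤ 1) {s : ℂ} (hs : 1 < s.re) :
    LSeriesSummable f s :=
  LSeriesSummable_of_bounded_of_one_lt_re (m := 1) (fun n _ => hb n) hs

/-- If the partial sums of `f` are bounded by `B` and vanish below `B`, then
its Dirichlet series is bounded by `1` to the right of `1`. -/
lemma norm_LSeries_le_one {f : ℕ → ℂ} {B : ℕ} (hB : 1 ≤ B) (hf : ∀ n, ‖f n‖ ≤ 1)
    (h0 : ∀ N < B, ∑ n ∈ Finset.Icc 1 N, f n = 0) (hle : ∀ N, ‖∑ n ∈ Finset.Icc 1 N, f n‖ ≤ B)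
    {s : ℝ} (hs : 1 < s) : ‖LSeries f s‖ ≤ 1 := by
  have hB0 : (0:ℝ) < B := by exact_mod_cast hB
  have hB1 : (1:ℝ) ≤ B := by exact_mod_cast hB
  rw [LSeries_eq_mul_integral f le_rfl (by rw [Complex.ofReal_re]; linarith)
    (LSeriesSummable_of_norm_le_one hf (by rwa [Complex.ofReal_re])) ?_]
  · have hint : IntegrableOn (fun t : ℝ => t ^ (-(s + 1))) (Set.Ici (B:ℝ)) := by
      rw [integrableOn_Ici_iff_integrableOn_Ioi]
      exact integrableOn_Ioi_rpow_of_lt (by linarith) hB0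
    have h1 : ‖∫ t in Set.Ioi (1 : ℝ), (∑ k ∈ Finset.Icc 1 ⌊t⌋₊, f k) * (t:ℂ) ^ (-((s:ℂ) + 1))‖ ≤
        ∫ t in Set.Ioi (1 : ℝ), (Set.Ici (B:ℝ)).indicator (fun t => B * t ^ (-(s + 1))) t := by
      refine norm_integral_le_of_norm_le ?_ ?_
      · refine Integrable.integrableOn ?_
        rw [integrable_indicator_iff measurableSet_Ici]
        exact hint.const_mul _
      · refine (ae_restrict_iff' measurableSet_Ioi).2 (Filter.Eventually.of_forall fun t ht => ?_)
        have ht0 : 0 < t := one_pos.trans ht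
        by_cases h : (B:ℝ) ≤ t
        · rw [Set.indicator_of_mem (Set.mem_Ici.2 h), norm_mul,
            Complex.norm_cpow_eq_rpow_re_of_pos ht0]
          have : (-((s:ℂ) + 1)).re = -(s + 1) := by simp
          rw [this]
          exact mul_le_mul_of_nonneg_right (hle _) (Real.rpow_nonneg ht0.le _)
        · rw [Set.indicator_of_notMem (by simpa using h), h0 _ ((Nat.floor_lt ht0.le).2 (not_le.1 h)),
            zero_mul, norm_zero]
    have h2 : ∫ t in Set.Ioi (1 : ℝ), (Set.Ici (B:ℝ)).indicator (fun t => B * t ^ (-(s + 1))) t ≤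
        ∫ t in Set.Ici (B:ℝ), B * t ^ (-(s + 1)) := by
      rw [← integral_indicator measurableSet_Ici]
      refine setIntegral_le_integral ?_ (Filter.Eventually.of_forall fun t => ?_)
      · rw [integrable_indicator_iff measurableSet_Ici]
        exact hint.const_mul _
      · refine Set.indicator_nonneg (fun t ht => ?_) t
        exact mul_nonneg hB0.le (Real.rpow_nonneg (hB0.le.trans ht) _)
    rw [integral_Ici_eq_integral_Ioi, integral_const_mul,
      integral_Ioi_rpow_of_lt (by linarith) hB0] at h2
    have h3 : (B:ℝ) * (-(B:ℝ) ^ (-(s + 1) + 1) / (-(s + 1) + 1)) = (B:ℝ) ^ (1 - s) / s := by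
      have h4 : -(s + 1) + 1 = -s := by ring
      rw [h4, neg_div_neg_eq, sub_eq_add_neg, Real.rpow_add hB0, Real.rpow_one, mul_div_assoc]
    rw [h3] at h2
    rw [norm_mul, Complex.norm_real, Real.norm_of_nonneg (by linarith)]
    calc s * _ ≤ s * ((B:ℝ) ^ (1 - s) / s) := by
          refine mul_le_mul_of_nonneg_left (h1.trans h2) (by linarith)
      _ = (B:ℝ) ^ (1 - s) := by
          have : s ≠ 0 := by linarith
          field_simp
      _ ≤ 1 := Real.rpow_le_one_of_one_le_of_nonpos hB1 (by linarith)
  · refine Asymptotics.IsBigO.of_bound B (Filter.Eventually.of_forall fun N => ?_)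
    rw [Real.rpow_zero, norm_one, mul_one]
    exact hle N

lemma norm_LFunction_one_sub_le {q : ℕ} [NeZero q] {Φ : ZMod q → ℂ} (h0 : Φ 0 = 0)
    (hsum : ∑ a, Φ a = 0) (hb : ∀ a, ‖Φ a‖ ≤ 1) :
    ‖ZMod.LFunction Φ 1 - ∑ n ∈ Finset.Ico 1 q, Φ (n : ZMod q) / n‖ ≤ 1 := by
  have hq : 1 ≤ q := Nat.pos_of_ne_zero (NeZero.ne q)
  have hIcc : ∀ N : ℕ, ∑ n ∈ Finset.Icc 1 N, Φ (n : ZMod q) =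
      ∑ n ∈ Finset.range (N + 1), Φ (n : ZMod q) := by
    intro N
    rw [Finset.sum_range_succ', Nat.cast_zero, h0, add_zero, Finset.range_eq_Ico,
      Finset.sum_Ico_add' (fun n : ℕ => Φ (n : ZMod q)) 0 N 1]
    rfl
  have hfull : ∑ n ∈ Finset.range q, Φ (n : ZMod q) = 0 := by
    have h1 := sum_comp_val q (fun v => Φ (v : ZMod q))
    simp only [ZMod.natCast_zmod_val] at h1
    rw [← h1, hsum]
  have hkey : ∀ s : ℝ, 1 < s →
      ‖ZMod.LFunction Φ s - ∑ n ∈ Finset.Ico 1 q, Φ (n : ZMod q) / (n : ℂ) ^ (s : ℂ)‖ ≤ 1 := by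
    intro s hs
    have hs' : 1 < (s : ℂ).re := by rwa [Complex.ofReal_re]
    have hg : LSeries (fun n => if n < q then Φ (n : ZMod q) else 0) s =
        ∑ n ∈ Finset.Ico 1 q, Φ (n : ZMod q) / (n : ℂ) ^ (s : ℂ) := by
      rw [LSeries, tsum_eq_sum (s := Finset.Ico 1 q)]
      · refine Finset.sum_congr rfl fun n hn => ?_
        rw [Finset.mem_Ico] at hn
        rw [LSeries.term_of_ne_zero (by omega), if_pos hn.2]
      · intro n hn
        rw [Finset.mem_Ico] at hn
        rcases Nat.eq_zero_or_pos n with rfl | hn0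
        · exact LSeries.term_zero _ _
        · rw [LSeries.term_of_ne_zero (by omega), if_neg (by omega), zero_div]
    rw [ZMod.LFunction_eq_LSeries _ hs', ← hg, ← LSeries_sub
      (LSeriesSummable_of_norm_le_one (fun n => hb _) hs')
      (LSeriesSummable_of_norm_le_one (fun n => ?_) hs')]
    · have hdiff : ((fun n : ℕ => Φ (n : ZMod q)) - fun n => if n < q then Φ (n : ZMod q) else 0) =
          fun n => if n < q then 0 else Φ (n : ZMod q) := by
        funext n
        by_cases h : n < q <;> simp [h]
      rw [hdiff]
      have hlow : ∀ N < q, ∑ n ∈ Finset.Icc 1 N, (if n < q then 0 else Φ (n : ZMod q)) = 0 := by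
        intro N hN
        refine Finset.sum_eq_zero fun n hn => if_pos ?_
        exact (Finset.mem_Icc.1 hn).2.trans_lt hN
      refine norm_LSeries_le_one (B := q) hq (fun n => ?_) hlow (fun N => ?_) hs
      · split_ifs
        · simp
        · exact hb _
      · rcases lt_or_ge N q with hN | hN
        · rw [hlow N hN, norm_zero]; positivity
        · have h2 : ∑ n ∈ Finset.Icc 1 N, (if n < q then 0 else Φ (n : ZMod q)) =
              ∑ n ∈ Finset.range (N + 1), Φ (n : ZMod q) := by
            have h3 : ∑ n ∈ Finset.Icc 1 N, (if n < q then Φ (n : ZMod q) else 0) = 0 := by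
              have h4 : ∑ n ∈ Finset.Icc 1 (q - 1), Φ (n : ZMod q) = 0 := by
                rw [hIcc, Nat.sub_add_cancel hq, hfull]
              rw [← Finset.sum_filter, ← h4]
              congr 1
              ext n
              simp only [Finset.mem_filter, Finset.mem_Icc]
              omega
            have h5 := Finset.sum_add_distrib (s := Finset.Icc 1 N)
              (f := fun n => if n < q then 0 else Φ (n : ZMod q))
              (g := fun n => if n < q then Φ (n : ZMod q) else 0)
            rw [h3, add_zero] at h5
            rw [← hIcc, ← h5]
            refine Finset.sum_congr rfl fun n _ => ?_
            by_cases h : n < q <;> simp [h]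
          rw [h2]
          exact norm_sum_range_periodic_le hsum hb _
    · split_ifs
      · exact hb _
      · simp
  have hcont : ContinuousAt (fun s : ℝ =>
      ‖ZMod.LFunction Φ s - ∑ n ∈ Finset.Ico 1 q, Φ (n : ZMod q) / (n : ℂ) ^ (s : ℂ)‖) 1 := by
    refine ContinuousAt.norm (ContinuousAt.sub ?_ ?_)
    · exact ((ZMod.differentiable_LFunction_of_sum_zero hsum).continuous.comp
        Complex.continuous_ofReal).continuousAt
    · refine Continuous.continuousAt (continuous_finsetSum _ fun n hn => ?_)
      have hn0 : (n:ℂ) ≠ 0 := by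
        have := (Finset.mem_Ico.1 hn).1
        exact_mod_cast (by omega : n ≠ 0)
      refine Continuous.div continuous_const ?_ fun s => ?_
      · exact Continuous.const_cpow Complex.continuous_ofReal (Or.inl hn0)
      · rw [Ne, Complex.cpow_eq_zero_iff]; tauto
  have h4 := le_of_tendsto (hcont.tendsto.mono_left nhdsWithin_le_nhds)
    (eventually_nhdsWithin_of_forall (s := Set.Ioi (1:ℝ)) fun s hs => hkey s hs)
  simpa using h4

lemma abs_saw_le (x : ℝ) : |saw x| ≤ 1 / 2 := by
  unfold saw
  split_ifs
  · norm_num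
  · rw [abs_le]
    constructor <;> linarith [Int.fract_nonneg x, Int.fract_lt_one x]

lemma sum_sawMod_mul_inv {q : ℕ} [Fact q.Prime] {k : ZMod q} (hk : k ≠ 0) :
    ∑ a : ZMod q, sawMod q (k * a⁻¹) = 0 := by
  rw [← sum_sawMod q]
  exact Fintype.sum_equiv ((Equiv.inv (ZMod q)).trans (Equiv.mulLeft₀ k hk)) _ _ fun a => by
    simp only [Equiv.trans_apply, Equiv.inv_apply, Equiv.mulLeft₀_apply]

lemma norm_LFunction_sawMod_one_le {q : ℕ} [Fact q.Prime] {k : ZMod q} (hk : k ≠ 0) :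
    ‖ZMod.LFunction (fun a : ZMod q => (sawMod q (k * a⁻¹) : ℂ)) 1‖ ≤
      |∑ n ∈ Finset.Ico 1 q, sawMod q (k * (n : ZMod q)⁻¹) / n| + 1 := by
  have h := norm_LFunction_one_sub_le (Φ := fun a : ZMod q => (sawMod q (k * a⁻¹) : ℂ))
    (by simp [sawMod_zero]) (by rw [← Complex.ofReal_sum, sum_sawMod_mul_inv hk, Complex.ofReal_zero])
    (fun a => by
      rw [Complex.norm_real, Real.norm_eq_abs]
      exact (abs_saw_le _).trans (by norm_num))
  have h2 : ‖∑ n ∈ Finset.Ico 1 q, (sawMod q (k * (n : ZMod q)⁻¹) : ℂ) / n‖ =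
      |∑ n ∈ Finset.Ico 1 q, sawMod q (k * (n : ZMod q)⁻¹) / n| := by
    rw [← Real.norm_eq_abs, ← Complex.norm_real]
    push_cast
    rfl
  rw [← h2]
  exact (norm_le_norm_add_norm_sub _ _).trans (add_le_add le_rfl (by rwa [norm_sub_rev]))

/-- The average of `conj χ(k) w(χ)` over the nonprincipal characters modulo `q`. -/
noncomputable def charAvg (q : ℕ) [NeZero q] (w : DirichletCharacter ℂ q → ℂ) (k : ZMod q) : ℂ :=
  (q.totient : ℂ)⁻¹ * ∑ χ ∈ Finset.univ.filter (fun χ : DirichletCharacter ℂ q => χ ≠ 1),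
    (starRingEnd ℂ) (χ k) * w χ

lemma conj_char_eq {q : ℕ} [Fact q.Prime] (χ : DirichletCharacter ℂ q) (k : ZMod q) :
    (starRingEnd ℂ) (χ k) = χ k⁻¹ := by
  rw [← MulChar.inv_apply', ← MulChar.star_apply']
  rfl

lemma charAvg_zero {q : ℕ} [Fact q.Prime] (w : DirichletCharacter ℂ q → ℂ) :
    charAvg q w 0 = 0 := by
  rw [charAvg, Finset.sum_eq_zero, mul_zero]
  intro χ _
  rw [MulChar.map_zero, map_zero, zero_mul]

lemma LFunction_one_char_apply_zero {q : ℕ} [Fact q.Prime] :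
    DirichletCharacter.LFunction (1 : DirichletCharacter ℂ q) 0 = 0 := by
  rw [LFunction_char_apply_zero, neg_eq_zero]
  have h : ∀ a : ZMod q, (1 : DirichletCharacter ℂ q) a * sawMod q a = sawMod q a := by
    intro a
    rcases eq_or_ne a 0 with rfl | ha
    · rw [sawMod_zero, Complex.ofReal_zero, mul_zero]
    · rw [MulChar.one_apply (isUnit_iff_ne_zero.2 ha), one_mul]
  simp_rw [h]
  rw [← Complex.ofReal_sum, sum_sawMod, Complex.ofReal_zero]

lemma charAvg_LFunction_eq {q : ℕ} [Fact q.Prime] {k : ZMod q} (hk : k ≠ 0) :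
    charAvg q (fun χ => DirichletCharacter.LFunction χ 0 * DirichletCharacter.LFunction χ 1) k =
      -ZMod.LFunction (fun a : ZMod q => (sawMod q (k * a⁻¹) : ℂ)) 1 := by
  have hphi : (q.totient : ℂ) ≠ 0 := by
    exact_mod_cast (Nat.totient_pos.2 (Nat.pos_of_ne_zero (NeZero.ne q))).ne'
  have h1 : ∑ χ ∈ Finset.univ.filter (fun χ : DirichletCharacter ℂ q => χ ≠ 1),
      (starRingEnd ℂ) (χ k) *
        (DirichletCharacter.LFunction χ 0 * DirichletCharacter.LFunction χ 1) =
      ∑ χ : DirichletCharacter ℂ q, (starRingEnd ℂ) (χ k) *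
        (DirichletCharacter.LFunction χ 0 * DirichletCharacter.LFunction χ 1) := by
    refine Finset.sum_filter_of_ne fun χ _ h hχ => h ?_
    rw [hχ, LFunction_one_char_apply_zero, zero_mul, mul_zero]
  have h2 : ∀ χ : DirichletCharacter ℂ q, (starRingEnd ℂ) (χ k) *
        (DirichletCharacter.LFunction χ 0 * DirichletCharacter.LFunction χ 1) =
      -((q : ℂ) ^ (-1 : ℂ) * ∑ b : ZMod q, HurwitzZeta.hurwitzZeta (ZMod.toAddCircle b) 1 *
        ∑ a : ZMod q, (sawMod q a : ℂ) * (χ k⁻¹ * χ (a * b))) := by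
    intro χ
    have h5 : ∑ b : ZMod q, HurwitzZeta.hurwitzZeta (ZMod.toAddCircle b) 1 *
        ∑ a : ZMod q, (sawMod q a : ℂ) * (χ k⁻¹ * χ (a * b)) =
        χ k⁻¹ * ((∑ b : ZMod q, χ b * HurwitzZeta.hurwitzZeta (ZMod.toAddCircle b) 1) *
          ∑ a : ZMod q, χ a * sawMod q a) := by
      rw [Finset.sum_mul_sum, Finset.mul_sum]
      refine Finset.sum_congr rfl fun b _ => ?_
      rw [Finset.mul_sum, Finset.mul_sum]
      refine Finset.sum_congr rfl fun a _ => ?_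
      rw [map_mul]
      ring
    rw [h5, LFunction_char_apply_zero, DirichletCharacter.LFunction, ZMod.LFunction,
      conj_char_eq]
    ring
  have h3 : ∀ b : ZMod q, ∑ a : ZMod q, (sawMod q a : ℂ) *
      ∑ χ : DirichletCharacter ℂ q, χ k⁻¹ * χ (a * b) =
      (q.totient : ℂ) * sawMod q (k * b⁻¹) := by
    intro b
    simp_rw [DirichletCharacter.sum_char_inv_mul_char_eq ℂ (isUnit_iff_ne_zero.2 hk)]
    rcases eq_or_ne b 0 with rfl | hb
    · simp [hk, sawMod_zero]
    · have h4 : ∀ a : ZMod q, k = a * b ↔ k * b⁻¹ = a := fun a => (mul_inv_eq_iff_eq_mul₀ hb).symm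
      simp_rw [h4, mul_ite, mul_zero]
      rw [Finset.sum_ite_eq, if_pos (Finset.mem_univ _), mul_comm]
  rw [charAvg, h1, Finset.sum_congr rfl fun χ _ => h2 χ, Finset.sum_neg_distrib, ← Finset.mul_sum,
    Finset.sum_comm, mul_neg, neg_inj, ZMod.LFunction, mul_left_comm]
  congr 1
  rw [Finset.mul_sum]
  refine Finset.sum_congr rfl fun b _ => ?_
  rw [← Finset.mul_sum, Finset.sum_comm]
  simp_rw [← Finset.mul_sum]
  rw [h3]
  field_simp

lemma exists_norm_charAvg_LFunction_le : ∃ C : ℝ, 0 ≤ C ∧ ∀ q : ℕ, ∀ [Fact q.Prime], 17 ≤ q →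
    ∀ k : ZMod q, ‖charAvg q (fun χ =>
      DirichletCharacter.LFunction χ 0 * DirichletCharacter.LFunction χ 1) k‖ ≤
      C * (Real.log q ^ ((2:ℝ)/3) * Real.log (Real.log q)^2) := by
  obtain ⟨C, hC, h⟩ := exists_abs_sum_sawMod_le
  refine ⟨C + 1, by linarith, fun q _ hq k => ?_⟩
  have h1 : 1 ≤ Real.log q := by
    linarith [exp_one_le_log hq, Real.add_one_le_exp (1:ℝ)]
  have h2 : 1 ≤ Real.log q ^ ((2:ℝ)/3) * Real.log (Real.log q)^2 :=
    one_le_mul_of_one_le_of_one_le (Real.one_le_rpow h1 (by norm_num))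
      (one_le_pow₀ (one_le_log_log hq))
  rcases eq_or_ne k 0 with rfl | hk
  · rw [charAvg_zero, norm_zero]
    exact mul_nonneg (by linarith) (by linarith)
  · rw [charAvg_LFunction_eq hk, norm_neg]
    have h3 := norm_LFunction_sawMod_one_le hk
    have h4 := h q hq k hk
    rw [add_mul]
    linarith

lemma charAvg_mul_char {q : ℕ} [Fact q.Prime] (w : DirichletCharacter ℂ q → ℂ) (k u : ZMod q) :
    charAvg q (fun χ => w χ * χ u) k = charAvg q w (k * u⁻¹) := by
  unfold charAvg
  congr 1
  refine Finset.sum_congr rfl fun χ _ => ?_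
  rw [map_mul, map_mul, conj_char_eq χ u⁻¹, inv_inv]
  ring

lemma charAvg_add {q : ℕ} [NeZero q] (v w : DirichletCharacter ℂ q → ℂ) (k : ZMod q) :
    charAvg q (fun χ => v χ + w χ) k = charAvg q v k + charAvg q w k := by
  simp_rw [charAvg, mul_add, Finset.sum_add_distrib, mul_add]

lemma charAvg_const_mul {q : ℕ} [NeZero q] (c : ℂ) (w : DirichletCharacter ℂ q → ℂ)
    (k : ZMod q) : charAvg q (fun χ => c * w χ) k = c * charAvg q w k := by
  simp_rw [charAvg, Finset.mul_sum]
  exact Finset.sum_congr rfl fun χ _ => by ring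

lemma norm_charAvg_mul_factor_le {q : ℕ} [Fact q.Prime] {w : DirichletCharacter ℂ q → ℂ} {M : ℝ}
    (hM : ∀ k, ‖charAvg q w k‖ ≤ M) (u : ZMod q) (c : ℂ) (k : ZMod q) :
    ‖charAvg q (fun χ => w χ * (1 - (1 - χ u) ^ 2 / c)) k‖ ≤ M * (1 + 4 / ‖c‖) := by
  have h1 : (fun χ : DirichletCharacter ℂ q => w χ * (1 - (1 - χ u) ^ 2 / c)) = fun χ =>
      (w χ + (-c⁻¹) * w χ) + ((2 * c⁻¹) * (w χ * χ u) + (-c⁻¹) * (w χ * χ u * χ u)) := by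
    funext χ
    ring
  rw [h1]
  simp only [charAvg_add, charAvg_const_mul, charAvg_mul_char]
  have h2 := hM k
  have h3 := hM (k * u⁻¹)
  have h4 := hM (k * u⁻¹ * u⁻¹)
  refine (norm_add_le _ _).trans ((add_le_add (norm_add_le _ _) (norm_add_le _ _)).trans ?_)
  simp only [norm_mul, norm_neg, norm_inv, Complex.norm_ofNat]
  have h5 : 0 ≤ ‖c‖⁻¹ := by positivity
  calc _ ≤ (M + ‖c‖⁻¹ * M) + (2 * ‖c‖⁻¹ * M + ‖c‖⁻¹ * M) := by gcongr
    _ = M * (1 + 4 / ‖c‖) := by ring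

/-- The Euler factor of `A_{q,χ}` at `p`. -/
noncomputable def eulerFactor (q : ℕ) (χ : DirichletCharacter ℂ q) (p : ℕ) : ℂ :=
  if p ∣ q then 1 else 1 - (1 - χ (p : ZMod q)) ^ 2 / ((p : ℂ) - 1) ^ 2

lemma norm_charAvg_mul_prod_le {q : ℕ} [Fact q.Prime] {w : DirichletCharacter ℂ q → ℂ} {M : ℝ}
    (hM : ∀ k, ‖charAvg q w k‖ ≤ M) (S : Finset Nat.Primes) (k : ZMod q) :
    ‖charAvg q (fun χ => w χ * ∏ p ∈ S, eulerFactor q χ p) k‖ ≤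
      M * ∏ p ∈ S, (1 + 4 / ((p : ℕ) - 1 : ℝ) ^ 2) := by
  induction S using Finset.induction_on generalizing k with
  | empty => simpa using hM k
  | insert p S hp ih =>
    have h1 : (fun χ => w χ * ∏ p ∈ insert p S, eulerFactor q χ p) = fun χ =>
        (w χ * ∏ p ∈ S, eulerFactor q χ p) * eulerFactor q χ p := by
      funext χ
      rw [Finset.prod_insert hp]
      ring
    rw [h1, Finset.prod_insert hp, mul_comm (1 + _ : ℝ), ← mul_assoc]
    have hM0 : 0 ≤ M * ∏ p ∈ S, (1 + 4 / ((p : ℕ) - 1 : ℝ) ^ 2) := (norm_nonneg _).trans (ih k)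
    by_cases h : (p : ℕ) ∣ q
    · simp only [eulerFactor, if_pos h, mul_one] at ih ⊢
      refine (ih k).trans (le_mul_of_one_le_right hM0 ?_)
      have : 0 ≤ 4 / ((p : ℕ) - 1 : ℝ) ^ 2 := by positivity
      linarith
    · have h2 := norm_charAvg_mul_factor_le ih (p : ZMod q) (((p : ℕ) - 1 : ℂ) ^ 2) k
      have h3 : ‖((p : ℕ) - 1 : ℂ) ^ 2‖ = ((p : ℕ) - 1 : ℝ) ^ 2 := by
        have : ((p : ℕ) - 1 : ℂ) = (((p : ℕ) - 1 : ℝ) : ℂ) := by push_cast; rfl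
        rw [norm_pow, this, Complex.norm_real, Real.norm_eq_abs, sq_abs]
      rw [h3] at h2
      simpa only [eulerFactor, if_neg h] using h2

lemma summable_four_div_prime_sub_one_sq :
    Summable fun p : Nat.Primes => 4 / (((p : ℕ) : ℝ) - 1) ^ 2 := by
  have h1 : Summable fun n : ℕ => 4 / ((n:ℝ) - 1) ^ 2 := by
    have h2 : Summable fun n : ℕ => 4 * (1 / (n:ℝ) ^ 2) :=
      (Real.summable_one_div_nat_pow.2 one_lt_two).mul_left 4
    refine (summable_nat_add_iff 1).1 (h2.congr fun n => ?_)
    push_cast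
    ring
  exact h1.comp_injective Subtype.val_injective

lemma tendsto_prod_eulerFactor {q : ℕ} (χ : DirichletCharacter ℂ q) :
    Filter.Tendsto (fun S : Finset Nat.Primes => ∏ p ∈ S, eulerFactor q χ p) Filter.atTop
      (nhds (Aq q χ)) := by
  have h1 : Multipliable fun p : Nat.Primes => 1 + (eulerFactor q χ p - 1) := by
    refine Complex.multipliable_one_add_of_summable
      (Summable.of_norm_bounded summable_four_div_prime_sub_one_sq fun p => ?_)
    unfold eulerFactor
    split_ifs
    · rw [sub_self, norm_zero]
      positivity
    · have h2 : ‖1 - χ ((p : ℕ) : ZMod q)‖ ≤ 2 :=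
        (norm_sub_le _ _).trans (by rw [norm_one]; linarith [χ.norm_le_one ((p : ℕ) : ZMod q)])
      have h3 : ‖((p : ℕ) - 1 : ℂ) ^ 2‖ = ((p : ℕ) - 1 : ℝ) ^ 2 := by
        have : ((p : ℕ) - 1 : ℂ) = (((p : ℕ) - 1 : ℝ) : ℂ) := by push_cast; rfl
        rw [norm_pow, this, Complex.norm_real, Real.norm_eq_abs, sq_abs]
      rw [sub_sub_cancel_left, norm_neg, norm_div, h3, norm_pow]
      gcongr
      nlinarith [norm_nonneg (1 - χ ((p : ℕ) : ZMod q))]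
  simp only [add_sub_cancel] at h1
  have h2 : Aq q χ = ∏' p : Nat.Primes, eulerFactor q χ p := rfl
  rw [h2]
  simpa only [HasProd, SummationFilter.unconditional_filter] using h1.hasProd

lemma norm_charAvg_mul_Aq_le {q : ℕ} [Fact q.Prime] {w : DirichletCharacter ℂ q → ℂ} {M : ℝ}
    (hM : ∀ k, ‖charAvg q w k‖ ≤ M) (k : ZMod q) :
    ‖charAvg q (fun χ => w χ * Aq q χ) k‖ ≤
      M * Real.exp (∑' p : Nat.Primes, 4 / (((p : ℕ) : ℝ) - 1) ^ 2) := by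
  have hM0 : 0 ≤ M := (norm_nonneg _).trans (hM k)
  have h1 : Filter.Tendsto (fun S : Finset Nat.Primes =>
      charAvg q (fun χ => w χ * ∏ p ∈ S, eulerFactor q χ p) k) Filter.atTop
      (nhds (charAvg q (fun χ => w χ * Aq q χ) k)) := by
    refine Filter.Tendsto.const_mul _ (tendsto_finsetSum _ fun χ _ => ?_)
    exact ((tendsto_prod_eulerFactor χ).const_mul _).const_mul _
  refine le_of_tendsto h1.norm (Filter.Eventually.of_forall fun S => ?_)
  refine (norm_charAvg_mul_prod_le hM S k).trans (mul_le_mul_of_nonneg_left ?_ hM0)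
  calc ∏ p ∈ S, (1 + 4 / (((p : ℕ) : ℝ) - 1) ^ 2)
      ≤ ∏ p ∈ S, Real.exp (4 / (((p : ℕ) : ℝ) - 1) ^ 2) := by
        refine Finset.prod_le_prod (fun p _ => by positivity) fun p _ => ?_
        rw [add_comm]
        exact Real.add_one_le_exp _
    _ = Real.exp (∑ p ∈ S, 4 / (((p : ℕ) : ℝ) - 1) ^ 2) := (Real.exp_sum _ _).symm
    _ ≤ _ := Real.exp_le_exp.2 (summable_four_div_prime_sub_one_sq.sum_le_tsum _
        fun p _ => by positivity)

/-- Pointwise upper bound for `C(k)` (Theorem 1, part 4). -/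
theorem pointwise_bound_C :
    ∃ A : ℝ, ∀ q : ℕ, q.Prime → 17 ≤ q → ∀ k : ℤ,
      |Cfun q k| ≤ A * Real.log q ^ ((2 : ℝ)/3) * Real.log (Real.log q) ^ 2 := by
  obtain ⟨C, hC, h⟩ := exists_norm_charAvg_LFunction_le
  refine ⟨C * Real.exp (∑' p : Nat.Primes, 4 / (((p : ℕ) : ℝ) - 1) ^ 2), fun q hq hq17 k => ?_⟩
  have : Fact q.Prime := ⟨hq⟩
  have h1 := norm_charAvg_mul_Aq_le (h q hq17) (k : ZMod q)
  have h2 : Cfun q k = (charAvg q (fun χ => DirichletCharacter.LFunction χ 0 *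
      DirichletCharacter.LFunction χ 1 * Aq q χ) (k : ZMod q)).re := by
    rw [Cfun, dif_neg hq.ne_zero, charAvg]
    simp only [mul_assoc]
  rw [h2]
  refine (Complex.abs_re_le_norm _).trans (h1.trans (le_of_eq ?_))
  ring
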